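/- arXiv:1401.2174 — 2 statements merged into one kernel-verified Lean document; each statement's English description precedes it below -/
import Mathlib

section
/- Let Δ be the root system of type A_ℓ with simple roots α₁, …, α_ℓ in the standard ordering, and let Σ be a subset of the simple roots such that the grading it determines on sl(ℓ+1, ℂ) is of Monge type. (a) If ℓ ≥ 5 and α₁, α_ℓ ∉ Σ (Σ is interior to the Dynkin diagram), then the grading is rigid. (b) Up to the order-reversing automorphism of the Dynkin diagram, the non-rigid gradings of Monge type of type A_ℓ are exactly Σ = {α₁, α₂} for ℓ ≥ 2 and Σ = {α₁, α₂, α₃} for ℓ ≥ 3. -/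
open scoped RealInnerProductSpace BigOperators Classical

/-- A reduced crystallographic root system in a real inner product space,
together with a chosen base of simple roots and the coordinates of each
root with respect to the base. -/
structure RootSystemBase (V : Type*) [NormedAddCommGroup V] [InnerProductSpace ℝ V] where
  /-- the set of roots -/
  Δ : Finset V
  /-- the set of simple roots (the base) -/
  Δ0 : Finset V
  base_sub : Δ0 ⊆ Δ
  ne_zero : ∀ β ∈ Δ, β ≠ (0 : V)
  indep : LinearIndependent ℝ (fun a : ↥Δ0 => (a : V))
  neg_mem : ∀ β ∈ Δ, -β ∈ Δ
  /-- `coeff β α` is the coefficient `n_α` of the simple root `α` in `β = ∑ n_α • α` -/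
  coeff : V → V → ℤ
  coeff_spec : ∀ β ∈ Δ, β = ∑ α ∈ Δ0, (coeff β α : ℝ) • α
  coeff_sign : ∀ β ∈ Δ, (∀ α ∈ Δ0, 0 ≤ coeff β α) ∨ (∀ α ∈ Δ0, coeff β α ≤ 0)
  crystal : ∀ α ∈ Δ, ∀ β ∈ Δ, ∃ k : ℤ, 2 * ⟪β, α⟫ / ⟪α, α⟫ = (k : ℝ)
  reflect_mem : ∀ α ∈ Δ, ∀ β ∈ Δ, β - (2 * ⟪β, α⟫ / ⟪α, α⟫) • α ∈ Δ
  reduced : ∀ α ∈ Δ, (2 : ℝ) • α ∉ Δ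

namespace RootSystemBase

variable {V : Type*} [NormedAddCommGroup V] [InnerProductSpace ℝ V]

variable (R : RootSystemBase V)

/-- The height `ht_Σ(β)` of a root `β` relative to a subset `Sg` of the simple roots. -/
def ht (Sg : Finset V) (β : V) : ℤ := ∑ α ∈ Sg, R.coeff β α

/-- positive roots -/
def IsPos (β : V) : Prop := β ∈ R.Δ ∧ ∀ α ∈ R.Δ0, 0 ≤ R.coeff β α

/-- negative roots -/
def IsNeg (β : V) : Prop := β ∈ R.Δ ∧ ∀ α ∈ R.Δ0, R.coeff β α ≤ 0

/-- Irreducibility of the root system (the Dynkin diagram is connected); this is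
equivalent to the corresponding complex Lie algebra being simple. -/
def Irred : Prop :=
  ¬ ∃ S : Finset V, S ⊆ R.Δ0 ∧ S.Nonempty ∧ S ≠ R.Δ0 ∧
      ∀ a ∈ S, ∀ b ∈ R.Δ0, b ∉ S → ⟪a, b⟫ = 0

/-- Adjacency of two (simple) roots in the Dynkin diagram. -/
def Adj (a b : V) : Prop := a ≠ b ∧ ⟪a, b⟫ ≠ 0

end RootSystemBase

namespace RootSystemBase

variable {V : Type*} [NormedAddCommGroup V] [InnerProductSpace ℝ V]

/-- The Cartan pairing `⟨a, b⟩ = 2(a,b)/(b,b)`. -/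
noncomputable def cInt (a b : V) : ℝ := 2 * ⟪a, b⟫ / ⟪b, b⟫

end RootSystemBase

namespace RootSystemBase

variable {V : Type*} [NormedAddCommGroup V] [InnerProductSpace ℝ V]

/-- The reflection `s_a` in the root `a`:  `s_a(v) = v - ⟨v, a⟩ a`. -/
noncomputable def refl (a v : V) : V := v - cInt v a • a

variable (R : RootSystemBase V)

/-- `θ` is the highest root. -/
def IsHighest (θ : V) : Prop :=
  θ ∈ R.Δ ∧ ∀ β ∈ R.Δ, ∀ α ∈ R.Δ0, R.coeff β α ≤ R.coeff θ α

/-- `Δ_σ = σ(Δ⁻) ∩ Δ⁺` for the length-two Weyl group element `σ = s_a ∘ s_b`;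
equivalently the positive roots mapped to negative roots by `σ⁻¹ = s_b ∘ s_a`. -/
noncomputable def Dsig (a b : V) : Finset V :=
  R.Δ.filter (fun β => R.IsPos β ∧ R.IsNeg (refl b (refl a β)))

/-- The grading determined by `Sg` is *non-rigid*:  there is `σ = s_a ∘ s_b ∈ W²_Σ`
(`a ≠ b` simple, `Δ_σ ⊆ Δ⁺_Σ`, `|Δ_σ| = 2`) whose harmonic representative has
positive homogeneity weight, i.e.
`⟨θ, a⟩ + (⟨θ, b⟩ + 1)·ht_Σ(s_a(b)) ≥ ht_Σ(θ)`.  By Kostant's theorem this is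
equivalent to the nonvanishing of `H²(𝔤₋, 𝔤)` in some positive homogeneity weight. -/
noncomputable def NonRigid (Sg : Finset V) (θ : V) : Prop :=
  ∃ a ∈ R.Δ0, ∃ b ∈ R.Δ0, a ≠ b ∧
    (R.Dsig a b).card = 2 ∧ (∀ β ∈ R.Dsig a b, 0 < R.ht Sg β) ∧
    (R.ht Sg θ : ℝ) ≤ cInt θ a + (cInt θ b + 1) * (R.ht Sg (refl a b) : ℝ)

end RootSystemBase

namespace RootSystemBase

variable {V : Type*} [NormedAddCommGroup V] [InnerProductSpace ℝ V]

/-- `R` is the root system whose simple roots are `α 1, …, α ℓ` (standard ordering)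
with Cartan matrix `M`, i.e. `M i j = ⟨αᵢ, αⱼ^∨⟩`. -/
def IsTypeOf (R : RootSystemBase V) (ℓ : ℕ) (α : ℕ → V) (M : ℕ → ℕ → ℝ) : Prop :=
  Set.InjOn α (Set.Icc 1 ℓ) ∧ R.Δ0 = (Finset.Icc 1 ℓ).image α ∧
    ∀ i ∈ Finset.Icc 1 ℓ, ∀ j ∈ Finset.Icc 1 ℓ, cInt (α i) (α j) = M i j

/-- The Cartan matrix of type `Aₗ`. -/
def matA (i j : ℕ) : ℝ :=
  if i = j then 2 else if i + 1 = j ∨ j + 1 = i then -1 else 0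

/-- The Cartan matrix of type `Bₗ` (with `α_ℓ` the short simple root). -/
def matB (ℓ i j : ℕ) : ℝ :=
  if i = j then 2
  else if i + 1 = j then (if j = ℓ then -2 else -1)
  else if j + 1 = i then -1 else 0

/-- The Cartan matrix of type `Cₗ` (with `α_ℓ` the long simple root). -/
def matC (ℓ i j : ℕ) : ℝ :=
  if i = j then 2
  else if i + 1 = j then -1
  else if j + 1 = i then (if i = ℓ then -2 else -1) else 0

/-- The Cartan matrix of type `Dₗ`. -/
def matD (ℓ i j : ℕ) : ℝ :=
  if i = j then 2
  else if ((i + 1 = j ∨ j + 1 = i) ∧ ¬(i = ℓ - 1 ∧ j = ℓ) ∧ ¬(j = ℓ - 1 ∧ i = ℓ)) ∨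
      (i = ℓ - 2 ∧ j = ℓ) ∨ (j = ℓ - 2 ∧ i = ℓ) then -1 else 0

/-- The Cartan matrix of type `G₂` (with `α₁` the short simple root, Humphreys'
labelling). -/
def matG2 (i j : ℕ) : ℝ :=
  if i = j then 2 else if i = 1 ∧ j = 2 then -1 else if i = 2 ∧ j = 1 then -3 else 0

/-- The Cartan matrix of type `F₄` (Humphreys' labelling). -/
def matF4 (i j : ℕ) : ℝ :=
  if i = j then 2
  else if i = 2 ∧ j = 3 then -2
  else if i + 1 = j ∨ j + 1 = i then -1 else 0

/-- Adjacency in the Dynkin diagram of type `E_ℓ` (`ℓ = 6, 7, 8`), Humphreys'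
labelling: the node `2` is attached to the node `4` of the chain `1,3,4,…,ℓ`. -/
def eAdj (ℓ i j : ℕ) : Prop :=
  (min i j, max i j) ∈
    ([(1,3),(3,4),(4,5),(5,6),(2,4),(6,7),(7,8)].filter (fun p => p.2 ≤ ℓ))

/-- The Cartan matrix of type `E_ℓ` (`ℓ = 6, 7, 8`), Humphreys' labelling. -/
noncomputable def matE (ℓ i j : ℕ) : ℝ :=
  if i = j then 2 else if eAdj ℓ i j then -1 else 0

end RootSystemBase

/-- The root space decomposition data of a complex semisimple Lie algebra `L` with
root system `base`: a Cartan subalgebra `H`, one-dimensional root spaces `rs β`,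
and the standard bracket relations among them. -/
structure GradedLieData (V : Type*) [NormedAddCommGroup V] [InnerProductSpace ℝ V]
    (L : Type*) [LieRing L] [LieAlgebra ℂ L] where
  /-- the underlying root system with base -/
  base : RootSystemBase V
  /-- the Cartan subalgebra -/
  H : Submodule ℂ L
  /-- the root spaces -/
  rs : V → Submodule ℂ L
  rs_dim : ∀ β ∈ base.Δ, Module.finrank ℂ ↥(rs β) = 1
  rs_bot : ∀ v : V, v ∉ base.Δ → rs v = ⊥
  sup_eq_top : H ⊔ (⨆ β ∈ base.Δ, rs β) = ⊤
  h_indep : Disjoint H (⨆ β ∈ base.Δ, rs β)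
  rs_indep : ∀ β ∈ base.Δ, Disjoint (rs β) (H ⊔ ⨆ γ ∈ base.Δ.erase β, rs γ)
  /-- `toH v` is the element of the Cartan subalgebra representing `v` via the Killing
  form -/
  toH : V → L
  toH_mem : ∀ v : V, toH v ∈ H
  toH_add : ∀ u v : V, toH (u + v) = toH u + toH v
  H_span : H = Submodule.span ℂ (toH '' ↑base.Δ0)
  br_toH : ∀ v : V, ∀ β ∈ base.Δ, ∀ x ∈ rs β, ⁅toH v, x⁆ = ((⟪β, v⟫ : ℝ) : ℂ) • x
  br_h_h : ∀ h ∈ H, ∀ h' ∈ H, ⁅h, h'⁆ = (0 : L)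
  br_h_rs : ∀ β ∈ base.Δ, ∀ h ∈ H, ∀ x ∈ rs β, ⁅h, x⁆ ∈ rs β
  br_rs_mem : ∀ β ∈ base.Δ, ∀ γ ∈ base.Δ, β + γ ∈ base.Δ →
      ∀ x ∈ rs β, ∀ y ∈ rs γ, ⁅x, y⁆ ∈ rs (β + γ)
  br_rs_zero : ∀ β ∈ base.Δ, ∀ γ ∈ base.Δ, β + γ ∉ base.Δ → β + γ ≠ 0 →
      ∀ x ∈ rs β, ∀ y ∈ rs γ, ⁅x, y⁆ = (0 : L)
  br_rs_opp : ∀ β ∈ base.Δ, ∀ x ∈ rs β, ∀ y ∈ rs (-β),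
      ⁅x, y⁆ ∈ Submodule.span ℂ ({toH β} : Set L)
  br_nondeg : ∀ β ∈ base.Δ, ∀ γ ∈ base.Δ, β + γ ∈ base.Δ →
      ∀ x ∈ rs β, ∀ y ∈ rs γ, ⁅x, y⁆ = (0 : L) → x = 0 ∨ y = 0

namespace GradedLieData

variable {V : Type*} [NormedAddCommGroup V] [InnerProductSpace ℝ V]
variable {L : Type*} [LieRing L] [LieAlgebra ℂ L]

variable (G : GradedLieData V L)

/-- The grading component `𝔤ⱼ` of the grading of `L` determined by the subset `Sg`
of the simple roots. -/
def g (Sg : Finset V) (j : ℤ) : Submodule ℂ L :=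
  if j = 0 then G.H ⊔ ⨆ β ∈ G.base.Δ.filter (fun β => G.base.ht Sg β = 0), G.rs β
  else ⨆ β ∈ G.base.Δ.filter (fun β => G.base.ht Sg β = j), G.rs β

/-- The grading of `L` determined by `Sg` is of *Monge type*: the component `𝔤₋₁`
contains a nonzero abelian subalgebra `Y` of codimension one with
`dim 𝔤₋₂ = dim Y`. -/
def Monge (Sg : Finset V) : Prop :=
  ∃ Y : Submodule ℂ L, Y ≤ G.g Sg (-1) ∧ Y ≠ ⊥ ∧
    (∀ a ∈ Y, ∀ b ∈ Y, ⁅a, b⁆ = (0 : L)) ∧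
    Module.finrank ℂ ↥Y + 1 = Module.finrank ℂ ↥(G.g Sg (-1)) ∧
    Module.finrank ℂ ↥(G.g Sg (-2)) = Module.finrank ℂ ↥Y

end GradedLieData

namespace MongeA

open RootSystemBase

variable {V : Type*} [NormedAddCommGroup V] [InnerProductSpace ℝ V]

/-- The vectors `E i = α i + ... + α ℓ`, so that the roots are the `E i - E j`. -/
noncomputable def EE (ℓ : ℕ) (α : ℕ → V) (i : ℕ) : V :=
  ∑ k ∈ Finset.Icc 1 ℓ, (if i ≤ k then (1 : ℝ) else 0) • α k

lemma EE_top (ℓ : ℕ) (α : ℕ → V) : EE ℓ α (ℓ + 1) = 0 := by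
  apply Finset.sum_eq_zero
  intro k hk
  rw [Finset.mem_Icc] at hk
  rw [if_neg (by omega), zero_smul]

lemma EE_sub (ℓ : ℕ) (α : ℕ → V) (i : ℕ) (h1 : 1 ≤ i) (h2 : i ≤ ℓ) :
    EE ℓ α i - EE ℓ α (i + 1) = α i := by
  unfold EE
  rw [← Finset.sum_sub_distrib, Finset.sum_eq_single i]
  · simp
  · intro k hk hki
    by_cases h : i ≤ k
    · rw [if_pos h, if_pos (by omega), sub_self]
    · rw [if_neg h, if_neg (by omega), sub_self]
  · intro h
    exact absurd (Finset.mem_Icc.2 ⟨h1, h2⟩) h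

lemma cInt_add (u v a : V) : cInt (u + v) a = cInt u a + cInt v a := by
  unfold cInt; rw [inner_add_left]; ring

lemma cInt_sub (u v a : V) : cInt (u - v) a = cInt u a - cInt v a := by
  unfold cInt; rw [inner_sub_left]; ring

lemma cInt_neg (u a : V) : cInt (-u) a = -cInt u a := by
  unfold cInt; rw [inner_neg_left]; ring

lemma cInt_smul (c : ℝ) (u a : V) : cInt (c • u) a = c * cInt u a := by
  unfold cInt; rw [real_inner_smul_left]; ring

lemma cInt_self (a : V) (ha : a ≠ 0) : cInt a a = 2 := by
  unfold cInt
  have : ⟪a, a⟫ ≠ 0 := by simpa using ha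
  field_simp

lemma refl_refl (a v : V) (ha : a ≠ 0) : refl a (refl a v) = v := by
  unfold RootSystemBase.refl
  rw [cInt_sub, cInt_smul, cInt_self a ha]
  module

lemma refl_neg (a v : V) : refl a (-v) = - refl a v := by
  unfold RootSystemBase.refl
  rw [cInt_neg]
  module

lemma refl_self (a : V) (ha : a ≠ 0) : refl a a = -a := by
  unfold RootSystemBase.refl
  rw [cInt_self a ha]
  module

section
variable (R : RootSystemBase V) (ℓ : ℕ) (α : ℕ → V)

lemma refl_mem (a b : V) (ha : a ∈ R.Δ) (hb : b ∈ R.Δ) : refl a b ∈ R.Δ :=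
  R.reflect_mem a ha b hb


lemma al_mem0 (hA : R.IsTypeOf ℓ α matA)
    (i : ℕ) (h1 : 1 ≤ i) (h2 : i ≤ ℓ) : α i ∈ R.Δ0 := by
  rw [hA.2.1]
  exact Finset.mem_image_of_mem _ (Finset.mem_Icc.2 ⟨h1, h2⟩)

lemma al_mem (hA : R.IsTypeOf ℓ α matA)
    (i : ℕ) (h1 : 1 ≤ i) (h2 : i ≤ ℓ) : α i ∈ R.Δ :=
  R.base_sub (al_mem0 R ℓ α hA i h1 h2)

lemma al_ne (hA : R.IsTypeOf ℓ α matA)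
    (i : ℕ) (h1 : 1 ≤ i) (h2 : i ≤ ℓ) : α i ≠ 0 :=
  R.ne_zero _ (al_mem R ℓ α hA i h1 h2)

lemma al_cInt (hA : R.IsTypeOf ℓ α matA)
    (i m : ℕ) (h1 : 1 ≤ i) (h2 : i ≤ ℓ) (h3 : 1 ≤ m) (h4 : m ≤ ℓ) :
    cInt (α i) (α m) = if i = m then 2 else if i + 1 = m ∨ m + 1 = i then -1 else 0 :=
  hA.2.2 i (Finset.mem_Icc.2 ⟨h1, h2⟩) m (Finset.mem_Icc.2 ⟨h3, h4⟩)

lemma forall_simple (hA : R.IsTypeOf ℓ α matA)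
    (P : V → Prop) : (∀ a ∈ R.Δ0, P a) ↔ ∀ k, 1 ≤ k → k ≤ ℓ → P (α k) := by
  rw [hA.2.1]
  simp only [Finset.mem_image, Finset.mem_Icc]
  constructor
  · intro h k h1 h2
    exact h _ ⟨k, ⟨h1, h2⟩, rfl⟩
  · rintro h _ ⟨k, ⟨h1, h2⟩, rfl⟩
    exact h k h1 h2

lemma sum_simple (hA : R.IsTypeOf ℓ α matA)
    {M : Type*} [AddCommMonoid M] (f : V → M) :
    ∑ a ∈ R.Δ0, f a = ∑ k ∈ Finset.Icc 1 ℓ, f (α k) := by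
  rw [hA.2.1, Finset.sum_image]
  intro a ha b hb hab
  exact hA.1 (by simpa using ha) (by simpa using hb) hab

lemma spec (hA : R.IsTypeOf ℓ α matA)
    (β : V) (hβ : β ∈ R.Δ) :
    β = ∑ k ∈ Finset.Icc 1 ℓ, (R.coeff β (α k) : ℝ) • α k := by
  conv_lhs => rw [R.coeff_spec β hβ]
  exact sum_simple R ℓ α hA (fun a => (R.coeff β a : ℝ) • a)

lemma indep' (hA : R.IsTypeOf ℓ α matA)
    (c : ℕ → ℝ) (h : ∑ k ∈ Finset.Icc 1 ℓ, c k • α k = 0) :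
    ∀ k, 1 ≤ k → k ≤ ℓ → c k = 0 := by
  have hi : LinearIndependent ℝ (fun k : ↥(Finset.Icc 1 ℓ) => α k) := by
    have := R.indep.comp (fun k : ↥(Finset.Icc 1 ℓ) => (⟨α k, by
      rw [hA.2.1]; exact Finset.mem_image_of_mem _ k.2⟩ : ↥R.Δ0)) (by
        intro a b hab
        have h' : α a = α b := congrArg Subtype.val hab
        have ha := a.2
        have hb := b.2
        rw [Finset.mem_Icc] at ha hb
        exact Subtype.ext (hA.1 ha hb h'))
    exact this
  rw [Fintype.linearIndependent_iff] at hi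
  intro k h1 h2
  refine hi (fun k => c k) ?_ ⟨k, Finset.mem_Icc.2 ⟨h1, h2⟩⟩
  rw [← h, ← Finset.sum_coe_sort (Finset.Icc 1 ℓ)]

lemma coeff_unique (hA : R.IsTypeOf ℓ α matA)
    (β : V) (hβ : β ∈ R.Δ) (n : ℕ → ℤ)
    (h : β = ∑ k ∈ Finset.Icc 1 ℓ, (n k : ℝ) • α k) (k : ℕ) (h1 : 1 ≤ k) (h2 : k ≤ ℓ) :
    R.coeff β (α k) = n k := by
  have h3 := spec R ℓ α hA β hβ
  have := indep' R ℓ α hA (fun k => (R.coeff β (α k) : ℝ) - n k) (by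
    simp only [sub_smul, Finset.sum_sub_distrib]
    rw [← h3, ← h, sub_self]) k h1 h2
  have : (R.coeff β (α k) : ℝ) = n k := by linarith
  exact_mod_cast this

lemma coeff_add (hA : R.IsTypeOf ℓ α matA)
    (β γ : V) (hβ : β ∈ R.Δ) (hγ : γ ∈ R.Δ) (h : β + γ ∈ R.Δ)
    (k : ℕ) (h1 : 1 ≤ k) (h2 : k ≤ ℓ) :
    R.coeff (β + γ) (α k) = R.coeff β (α k) + R.coeff γ (α k) := by
  refine coeff_unique R ℓ α hA _ h (fun k => R.coeff β (α k) + R.coeff γ (α k)) ?_ k h1 h2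
  push_cast
  simp only [add_smul, Finset.sum_add_distrib]
  rw [← spec R ℓ α hA β hβ, ← spec R ℓ α hA γ hγ]

lemma coeff_neg (hA : R.IsTypeOf ℓ α matA)
    (β : V) (hβ : β ∈ R.Δ) (k : ℕ) (h1 : 1 ≤ k) (h2 : k ≤ ℓ) :
    R.coeff (-β) (α k) = - R.coeff β (α k) := by
  refine coeff_unique R ℓ α hA _ (R.neg_mem _ hβ) (fun k => -R.coeff β (α k)) ?_ k h1 h2
  push_cast
  simp only [neg_smul, Finset.sum_neg_distrib]
  rw [← spec R ℓ α hA β hβ]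

lemma coeff_EE (hA : R.IsTypeOf ℓ α matA)
    (i j : ℕ) (h : EE ℓ α i - EE ℓ α j ∈ R.Δ) (k : ℕ) (h1 : 1 ≤ k) (h2 : k ≤ ℓ) :
    R.coeff (EE ℓ α i - EE ℓ α j) (α k) =
      (if i ≤ k then 1 else 0) - (if j ≤ k then 1 else 0) := by
  refine coeff_unique R ℓ α hA _ h
    (fun k => (if i ≤ k then 1 else 0) - (if j ≤ k then 1 else 0)) ?_ k h1 h2
  unfold EE
  push_cast
  simp only [sub_smul, Finset.sum_sub_distrib]

lemma coeff_al (hA : R.IsTypeOf ℓ α matA)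
    (m k : ℕ) (h1 : 1 ≤ m) (h2 : m ≤ ℓ) (h3 : 1 ≤ k) (h4 : k ≤ ℓ) :
    R.coeff (α m) (α k) = if m = k then 1 else 0 := by
  have h := coeff_EE R ℓ α hA m (m + 1) (by
    rw [EE_sub ℓ α m h1 h2]; exact al_mem R ℓ α hA m h1 h2) k h3 h4
  rw [EE_sub ℓ α m h1 h2] at h
  rw [h]
  split_ifs <;> omega

/-- coefficients of a reflected root -/
lemma coeff_refl (hA : R.IsTypeOf ℓ α matA)
    (β : V) (hβ : β ∈ R.Δ) (m : ℕ) (h1 : 1 ≤ m) (h2 : m ≤ ℓ) (z : ℤ)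
    (hz : cInt β (α m) = z) (k : ℕ) (h3 : 1 ≤ k) (h4 : k ≤ ℓ) :
    R.coeff (refl (α m) β) (α k) = R.coeff β (α k) - if k = m then z else 0 := by
  refine coeff_unique R ℓ α hA _ (refl_mem R _ _ (al_mem R ℓ α hA m h1 h2) hβ)
    (fun k => R.coeff β (α k) - if k = m then z else 0) ?_ k h3 h4
  push_cast
  simp only [sub_smul, Finset.sum_sub_distrib]
  rw [← spec R ℓ α hA β hβ]
  unfold RootSystemBase.refl
  rw [hz, Finset.sum_eq_single m]
  · simp
  · intro b _ hb
    simp [hb]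
  · intro h
    exact absurd (Finset.mem_Icc.2 ⟨h1, h2⟩) h

lemma cInt_EE (hA : R.IsTypeOf ℓ α matA)
    (m : ℕ) (h3 : 1 ≤ m) (h4 : m ≤ ℓ) (n : ℕ) : ∀ i, 1 ≤ i → i + n = ℓ + 1 →
    cInt (EE ℓ α i) (α m) =
      (if i = m then 1 else 0) - (if i = m + 1 then 1 else 0) + (if ℓ = m then 1 else 0) := by
  induction n with
  | zero =>
    intro i hi h
    have : i = ℓ + 1 := by omega
    subst this
    rw [EE_top, if_neg (by omega : ¬ (ℓ + 1 = m))]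
    have h0 : cInt (0 : V) (α m) = 0 := by simp [cInt]
    rw [h0]
    by_cases h : ℓ = m
    · simp [h]
    · rw [if_neg (by omega), if_neg h]; simp
  | succ n ih =>
    intro i hi h
    have h5 := ih (i + 1) (by omega) (by omega)
    have h6 : EE ℓ α i = α i + EE ℓ α (i + 1) := by
      rw [← EE_sub ℓ α i hi (by omega)]; abel
    rw [h6, cInt_add, h5, al_cInt R ℓ α hA i m hi (by omega) h3 h4]
    by_cases a1 : i = m
    · subst a1
      simp
      ring
    · by_cases a2 : i + 1 = m
      · subst a2
        simp
        omega
      · by_cases a3 : i = m + 1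
        · subst a3
          simp
          omega
        · have : ¬ (i + 1 = m + 1) := by omega
          have : ¬ (m + 1 = i) := by omega
          simp [*]

/-- the pairing of `E i - E j` with a simple root -/
lemma cInt_EE_sub (hA : R.IsTypeOf ℓ α matA)
    (m i j : ℕ) (h3 : 1 ≤ m) (h4 : m ≤ ℓ) (hi : 1 ≤ i) (hi' : i ≤ ℓ + 1)
    (hj : 1 ≤ j) (hj' : j ≤ ℓ + 1) :
    cInt (EE ℓ α i - EE ℓ α j) (α m) =
      (((if i = m then 1 else 0) - (if i = m + 1 then 1 else 0)
        - (if j = m then 1 else 0) + (if j = m + 1 then 1 else 0) : ℤ) : ℝ) := by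
  rw [cInt_sub, cInt_EE R ℓ α hA m h3 h4 (ℓ + 1 - i) i hi (by omega),
    cInt_EE R ℓ α hA m h3 h4 (ℓ + 1 - j) j hj (by omega)]
  push_cast
  ring

/-- simple reflections act as transpositions -/
lemma refl_EE (hA : R.IsTypeOf ℓ α matA)
    (m i j : ℕ) (h3 : 1 ≤ m) (h4 : m ≤ ℓ) (hi : 1 ≤ i) (hi' : i ≤ ℓ + 1)
    (hj : 1 ≤ j) (hj' : j ≤ ℓ + 1) :
    refl (α m) (EE ℓ α i - EE ℓ α j) =
      EE ℓ α (Equiv.swap m (m + 1) i) - EE ℓ α (Equiv.swap m (m + 1) j) := by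
  unfold RootSystemBase.refl
  rw [cInt_EE_sub R ℓ α hA m i j h3 h4 hi hi' hj hj']
  have h := EE_sub ℓ α m h3 h4
  rw [← h]
  simp only [Equiv.swap_apply_def]
  by_cases a1 : i = m
  · subst a1
    by_cases b1 : j = i
    · subst b1
      simp
    · by_cases b2 : j = i + 1
      · subst b2
        simp
        module
      · simp [b1, b2]
  · by_cases a2 : i = m + 1
    · subst a2
      by_cases b1 : j = m
      · subst b1
        simp
        module
      · by_cases b2 : j = m + 1
        · subst b2
          simp
        · simp [b1, b2]
    · by_cases b1 : j = m
      · subst b1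
        simp [a1, a2]
      · by_cases b2 : j = m + 1
        · subst b2
          simp [a1, a2]
        · simp [a1, a2, b1, b2]

lemma EE_mem_aux (hA : R.IsTypeOf ℓ α matA)
    (i : ℕ) (hi : 1 ≤ i) (n : ℕ) : i + n + 1 ≤ ℓ + 1 →
    EE ℓ α i - EE ℓ α (i + n + 1) ∈ R.Δ := by
  induction n with
  | zero =>
    intro h
    rw [add_zero, EE_sub ℓ α i hi (by omega)]
    exact al_mem R ℓ α hA i hi (by omega)
  | succ n ih =>
    intro h
    have h1 := ih (by omega)
    have h2 := refl_mem R _ _ (al_mem R ℓ α hA (i + n + 1) (by omega) (by omega)) h1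
    rw [refl_EE R ℓ α hA _ _ _ (by omega) (by omega) hi (by omega) (by omega) (by omega),
      Equiv.swap_apply_left, Equiv.swap_apply_of_ne_of_ne (by omega) (by omega)] at h2
    exact h2

lemma EE_mem (hA : R.IsTypeOf ℓ α matA)
    (i j : ℕ) (hi : 1 ≤ i) (hi' : i ≤ ℓ + 1) (hj : 1 ≤ j) (hj' : j ≤ ℓ + 1)
    (hij : i ≠ j) : EE ℓ α i - EE ℓ α j ∈ R.Δ := by
  rcases lt_or_gt_of_ne hij with h | h
  · have := EE_mem_aux R ℓ α hA i hi (j - i - 1) (by omega)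
    rwa [show i + (j - i - 1) + 1 = j by omega] at this
  · have := EE_mem_aux R ℓ α hA j hj (i - j - 1) (by omega)
    rw [show j + (i - j - 1) + 1 = i by omega] at this
    rw [← neg_sub]
    exact R.neg_mem _ this

lemma pos_refl (hA : R.IsTypeOf ℓ α matA)
    (β : V) (hβ : R.IsPos β) (m : ℕ) (h1 : 1 ≤ m) (h2 : m ≤ ℓ) (hne : β ≠ α m) :
    R.IsPos (refl (α m) β) := by
  have ham := al_mem R ℓ α hA m h1 h2
  have hmem := refl_mem R _ _ ham hβ.1
  refine ⟨hmem, ?_⟩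
  obtain ⟨z, hz⟩ := R.crystal (α m) ham β hβ.1
  change cInt β (α m) = z at hz
  have hp := hβ.2
  rw [forall_simple R ℓ α hA] at hp
  by_cases hex : ∃ k, 1 ≤ k ∧ k ≤ ℓ ∧ k ≠ m ∧ 0 < R.coeff β (α k)
  · obtain ⟨k, k1, k2, k3, k4⟩ := hex
    rcases R.coeff_sign _ hmem with h | h
    · exact h
    · have := h (α k) (al_mem0 R ℓ α hA k k1 k2)
      rw [coeff_refl R ℓ α hA β hβ.1 m h1 h2 z hz k k1 k2, if_neg k3] at this
      omega
  · exfalso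
    push Not at hex
    set c := R.coeff β (α m) with hc
    have hb : β = (c : ℝ) • α m := by
      conv_lhs => rw [spec R ℓ α hA β hβ.1]
      rw [Finset.sum_eq_single m]
      · intro b hb hbm
        rw [Finset.mem_Icc] at hb
        have e1 := hex b hb.1 hb.2 hbm
        have e2 := hp b hb.1 hb.2
        have : R.coeff β (α b) = 0 := le_antisymm e1 e2
        simp [this]
      · intro h
        exact absurd (Finset.mem_Icc.2 ⟨h1, h2⟩) h
    have hc0 : 0 ≤ c := hp m h1 h2
    have hc1 : c ≠ 0 := by
      intro h
      apply R.ne_zero _ hβ.1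
      rw [hb, h]; simp
    have hcr : (c : ℝ) ≠ 0 := by exact_mod_cast hc1
    obtain ⟨w, hw⟩ := R.crystal β hβ.1 (α m) ham
    have hw2 : (2 : ℝ) = w * c := by
      rw [← hw]
      nth_rewrite 1 2 3 [hb]
      simp only [real_inner_smul_left, real_inner_smul_right]
      have : ⟪α m, α m⟫ ≠ 0 := by simpa using al_ne R ℓ α hA m h1 h2
      field_simp
    have hw3 : (2 : ℤ) = w * c := by exact_mod_cast hw2
    have hdvd : c ∣ 2 := ⟨w, by rw [hw3]; ring⟩
    have hle : c ≤ 2 := Int.le_of_dvd (by norm_num) hdvd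
    have : c = 1 ∨ c = 2 := by omega
    rcases this with h | h
    · apply hne
      rw [hb, h]; simp
    · apply R.reduced _ ham
      have := hβ.1
      rw [hb, h] at this
      exact_mod_cast this

/-- the set of vectors `E i - E j` -/
def InP (β : V) : Prop :=
  ∃ i j, 1 ≤ i ∧ i ≤ ℓ + 1 ∧ 1 ≤ j ∧ j ≤ ℓ + 1 ∧ i ≠ j ∧ β = EE ℓ α i - EE ℓ α j

end
end MongeA
namespace MongeA

open RootSystemBase

variable {V : Type*} [NormedAddCommGroup V] [InnerProductSpace ℝ V]

section
variable (R : RootSystemBase V) (ℓ : ℕ) (α : ℕ → V)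

lemma swap_le (hA : R.IsTypeOf ℓ α matA)
    (m i : ℕ) (h3 : 1 ≤ m) (h4 : m ≤ ℓ) (hi : 1 ≤ i) (hi' : i ≤ ℓ + 1) :
    1 ≤ Equiv.swap m (m + 1) i ∧ Equiv.swap m (m + 1) i ≤ ℓ + 1 := by
  rw [Equiv.swap_apply_def]
  split_ifs <;> omega

lemma InP_refl (hA : R.IsTypeOf ℓ α matA)
    (β : V) (h : InP ℓ α β) (m : ℕ) (h3 : 1 ≤ m) (h4 : m ≤ ℓ) :
    InP ℓ α (refl (α m) β) := by
  obtain ⟨i, j, hi, hi', hj, hj', hij, rfl⟩ := h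
  have a := swap_le R ℓ α hA m i h3 h4 hi hi'
  have b := swap_le R ℓ α hA m j h3 h4 hj hj'
  exact ⟨_, _, a.1, a.2, b.1, b.2, fun h => hij ((Equiv.swap m (m + 1)).injective h),
    refl_EE R ℓ α hA m i j h3 h4 hi hi' hj hj'⟩

lemma InP_al (hA : R.IsTypeOf ℓ α matA)
    (m : ℕ) (h3 : 1 ≤ m) (h4 : m ≤ ℓ) : InP ℓ α (α m) :=
  ⟨m, m + 1, h3, by omega, by omega, by omega, by omega, (EE_sub ℓ α m h3 h4).symm⟩

lemma pos_InP (hA : R.IsTypeOf ℓ α matA)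
    (n : ℕ) : ∀ β, R.IsPos β →
    (∑ k ∈ Finset.Icc 1 ℓ, R.coeff β (α k)) ≤ n → InP ℓ α β := by
  induction n with
  | zero =>
    intro β hβ hs
    exfalso
    have hp := hβ.2
    rw [forall_simple R ℓ α hA] at hp
    have h0 : ∀ k ∈ Finset.Icc 1 ℓ, R.coeff β (α k) = 0 := by
      rw [← Finset.sum_eq_zero_iff_of_nonneg]
      · apply le_antisymm (by simpa using hs)
        apply Finset.sum_nonneg
        intro k hk
        rw [Finset.mem_Icc] at hk
        exact hp k hk.1 hk.2
      · intro k hk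
        rw [Finset.mem_Icc] at hk
        exact hp k hk.1 hk.2
    apply R.ne_zero _ hβ.1
    rw [spec R ℓ α hA β hβ.1]
    apply Finset.sum_eq_zero
    intro k hk
    rw [h0 k hk]; simp
  | succ n ih =>
    intro β hβ hs
    have hp := hβ.2
    rw [forall_simple R ℓ α hA] at hp
    have hpos : 0 < ⟪β, β⟫ := by
      rw [real_inner_self_pos]; exact R.ne_zero _ hβ.1
    have hex : ∃ k ∈ Finset.Icc 1 ℓ, 0 < (R.coeff β (α k) : ℝ) * ⟪β, α k⟫ := by
      by_contra hcon
      push Not at hcon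
      have h1 : ⟪β, β⟫ = ∑ k ∈ Finset.Icc 1 ℓ, (R.coeff β (α k) : ℝ) * ⟪β, α k⟫ := by
        nth_rewrite 2 [spec R ℓ α hA β hβ.1]
        rw [inner_sum]
        simp only [real_inner_smul_right]
      have h2 := Finset.sum_nonpos hcon
      linarith
    obtain ⟨k, hk, hk2⟩ := hex
    rw [Finset.mem_Icc] at hk
    obtain ⟨k1, k2⟩ := hk
    by_cases hbk : β = α k
    · rw [hbk]; exact InP_al R ℓ α hA k k1 k2
    · have hak := al_mem R ℓ α hA k k1 k2
      have hc : (0 : ℝ) ≤ R.coeff β (α k) := by exact_mod_cast hp k k1 k2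
      have hin : 0 < ⟪β, α k⟫ := by
        by_contra h
        push Not at h
        nlinarith
      obtain ⟨z, hz⟩ := R.crystal (α k) hak β hβ.1
      have hz0 : 0 < (z : ℝ) := by
        rw [← hz]
        have : 0 < ⟪α k, α k⟫ := by
          rw [real_inner_self_pos]; exact R.ne_zero _ hak
        positivity
      have hz1 : 0 < z := by exact_mod_cast hz0
      have hr := pos_refl R ℓ α hA β hβ k k1 k2 hbk
      have hsum : ∑ m ∈ Finset.Icc 1 ℓ, R.coeff (refl (α k) β) (α m) =
          (∑ m ∈ Finset.Icc 1 ℓ, R.coeff β (α m)) - z := by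
        have : ∀ m ∈ Finset.Icc 1 ℓ, R.coeff (refl (α k) β) (α m) =
            R.coeff β (α m) - if m = k then z else 0 := by
          intro m hm
          rw [Finset.mem_Icc] at hm
          exact coeff_refl R ℓ α hA β hβ.1 k k1 k2 z hz m hm.1 hm.2
        rw [Finset.sum_congr rfl this, Finset.sum_sub_distrib, Finset.sum_ite_eq',
          if_pos (Finset.mem_Icc.2 ⟨k1, k2⟩)]
      have h1 := ih _ hr (by rw [hsum]; push_cast at hs; omega)
      have h2 := InP_refl R ℓ α hA _ h1 k k1 k2
      rwa [refl_refl _ _ (al_ne R ℓ α hA k k1 k2)] at h2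

/-- classification of the roots in type A -/
lemma mem_InP (hA : R.IsTypeOf ℓ α matA)
    (β : V) (hβ : β ∈ R.Δ) : InP ℓ α β := by
  rcases R.coeff_sign β hβ with h | h
  · exact pos_InP R ℓ α hA (∑ k ∈ Finset.Icc 1 ℓ, R.coeff β (α k)).toNat β ⟨hβ, h⟩
      (Int.self_le_toNat _)
  · have hn : R.IsPos (-β) := by
      refine ⟨R.neg_mem _ hβ, ?_⟩
      rw [forall_simple R ℓ α hA] at h ⊢
      intro k h1 h2
      rw [coeff_neg R ℓ α hA β hβ k h1 h2]
      have := h k h1 h2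
      omega
    obtain ⟨i, j, hi, hi', hj, hj', hij, he⟩ :=
      pos_InP R ℓ α hA (∑ k ∈ Finset.Icc 1 ℓ, R.coeff (-β) (α k)).toNat (-β) hn
      (Int.self_le_toNat _)
    exact ⟨j, i, hj, hj', hi, hi', hij.symm, by rw [← neg_sub, ← he, neg_neg]⟩

lemma EE_inj (hA : R.IsTypeOf ℓ α matA)
    (i j i' j' : ℕ) (hi : 1 ≤ i) (hi1 : i ≤ ℓ + 1) (hj : 1 ≤ j) (hj1 : j ≤ ℓ + 1)
    (hi' : 1 ≤ i') (hi1' : i' ≤ ℓ + 1) (hj' : 1 ≤ j') (hj1' : j' ≤ ℓ + 1) (hij : i < j)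
    (he : EE ℓ α i - EE ℓ α j = EE ℓ α i' - EE ℓ α j') : i = i' ∧ j = j' := by
  have hm := EE_mem R ℓ α hA i j hi hi1 hj hj1 hij.ne
  have hm' : EE ℓ α i' - EE ℓ α j' ∈ R.Δ := he ▸ hm
  have key : ∀ k, 1 ≤ k → k ≤ ℓ → ((if i ≤ k then 1 else 0) - (if j ≤ k then 1 else 0) : ℤ) =
      (if i' ≤ k then 1 else 0) - (if j' ≤ k then 1 else 0) := by
    intro k h1 h2
    rw [← coeff_EE R ℓ α hA i j hm k h1 h2, ← coeff_EE R ℓ α hA i' j' hm' k h1 h2, he]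
  have a1 := key i hi (by omega)
  have a2 := key (j - 1) (by omega) (by omega)
  have hlt : i' < j' := by
    split_ifs at a1 <;> omega
  have a3 := key i' hi' (by omega)
  have a4 := key (j' - 1) (by omega) (by omega)
  have b1 : i' ≤ i := by split_ifs at a1 <;> omega
  have b2 : j ≤ j' := by split_ifs at a2 <;> omega
  have b3 : i ≤ i' := by split_ifs at a3 <;> omega
  have b4 : j' ≤ j := by split_ifs at a4 <;> omega
  omega

lemma theta_eq (hA : R.IsTypeOf ℓ α matA)
    (hl : 2 ≤ ℓ) (θ : V) (hθ : R.IsHighest θ) : θ = EE ℓ α 1 - EE ℓ α (ℓ + 1) := by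
  obtain ⟨i, j, hi, hi', hj, hj', hij, he⟩ := mem_InP R ℓ α hA θ hθ.1
  have hm := EE_mem R ℓ α hA 1 (ℓ + 1) (by omega) (by omega) (by omega) (by omega) (by omega)
  have a1 := hθ.2 _ hm (α 1) (al_mem0 R ℓ α hA 1 le_rfl (by omega))
  have a2 := hθ.2 _ hm (α ℓ) (al_mem0 R ℓ α hA ℓ (by omega) (by omega))
  have hm' := hθ.1
  rw [he] at hm' a1 a2
  rw [coeff_EE R ℓ α hA _ _ hm _ (by omega) (by omega),
    coeff_EE R ℓ α hA _ _ hm' _ (by omega) (by omega)] at a1 a2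
  have h1 : i = 1 := by split_ifs at a1 <;> omega
  have h2 : j = ℓ + 1 := by split_ifs at a2 <;> omega
  rw [he, h1, h2]

lemma pos_not_neg (hA : R.IsTypeOf ℓ α matA)
    (β : V) (h : R.IsPos β) (h' : R.IsNeg β) : False := by
  apply R.ne_zero _ h.1
  rw [R.coeff_spec _ h.1]
  apply Finset.sum_eq_zero
  intro a ha
  have : R.coeff β a = 0 := le_antisymm (h'.2 a ha) (h.2 a ha)
  simp [this]

lemma neg_isNeg (hA : R.IsTypeOf ℓ α matA)
    (β : V) (h : R.IsPos β) : R.IsNeg (-β) := by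
  refine ⟨R.neg_mem _ h.1, ?_⟩
  have h2 := h.2
  rw [forall_simple R ℓ α hA] at h2 ⊢
  intro k k1 k2
  rw [coeff_neg R ℓ α hA _ h.1 k k1 k2]
  have := h2 k k1 k2
  omega

lemma al_pos (hA : R.IsTypeOf ℓ α matA)
    (m : ℕ) (h1 : 1 ≤ m) (h2 : m ≤ ℓ) : R.IsPos (α m) := by
  refine ⟨al_mem R ℓ α hA m h1 h2, ?_⟩
  rw [forall_simple R ℓ α hA]
  intro k k1 k2
  rw [coeff_al R ℓ α hA m k h1 h2 k1 k2]
  split_ifs <;> omega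

lemma al_inj (hA : R.IsTypeOf ℓ α matA)
    (p q : ℕ) (h1 : 1 ≤ p) (h2 : p ≤ ℓ) (h3 : 1 ≤ q) (h4 : q ≤ ℓ) (h : α p = α q) :
    p = q := hA.1 ⟨h1, h2⟩ ⟨h3, h4⟩ h

lemma Dsig_eq (hA : R.IsTypeOf ℓ α matA)
    (p q : ℕ) (h1 : 1 ≤ p) (h2 : p ≤ ℓ) (h3 : 1 ≤ q) (h4 : q ≤ ℓ) (hpq : p ≠ q) :
    R.Dsig (α p) (α q) = {α p, refl (α p) (α q)} := by
  have hne : α p ≠ α q := fun h => hpq (al_inj R ℓ α hA p q h1 h2 h3 h4 h)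
  ext β
  unfold Dsig
  simp only [Finset.mem_filter, Finset.mem_insert, Finset.mem_singleton]
  have hp0 := al_ne R ℓ α hA p h1 h2
  have hq0 := al_ne R ℓ α hA q h3 h4
  constructor
  · rintro ⟨hβ, hpos, hneg⟩
    by_contra hcon
    push Not at hcon
    have a1 := pos_refl R ℓ α hA β hpos p h1 h2 hcon.1
    have a2 := pos_refl R ℓ α hA _ a1 q h3 h4 (by
      intro h
      apply hcon.2
      rw [← h, refl_refl _ _ hp0])
    exact pos_not_neg R ℓ α hA _ a2 hneg
  · rintro (rfl | rfl)
    · refine ⟨al_mem R ℓ α hA p h1 h2, al_pos R ℓ α hA p h1 h2, ?_⟩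
      rw [refl_self _ hp0, refl_neg]
      exact neg_isNeg R ℓ α hA _ (pos_refl R ℓ α hA _ (al_pos R ℓ α hA p h1 h2) q h3 h4 hne)
    · have := pos_refl R ℓ α hA _ (al_pos R ℓ α hA q h3 h4) p h1 h2 hne.symm
      refine ⟨this.1, this, ?_⟩
      rw [refl_refl _ _ hp0, refl_self _ hq0]
      exact neg_isNeg R ℓ α hA _ (al_pos R ℓ α hA q h3 h4)

lemma ht_image (hA : R.IsTypeOf ℓ α matA)
    (S : Finset ℕ) (hS : S ⊆ Finset.Icc 1 ℓ) (β : V) :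
    R.ht (S.image α) β = ∑ k ∈ S, R.coeff β (α k) := by
  unfold ht
  rw [Finset.sum_image]
  intro a ha b hb hab
  have a1 := Finset.mem_Icc.1 (hS ha)
  have b1 := Finset.mem_Icc.1 (hS hb)
  exact hA.1 a1 b1 hab

lemma ht_EE (hA : R.IsTypeOf ℓ α matA)
    (S : Finset ℕ) (hS : S ⊆ Finset.Icc 1 ℓ) (i j : ℕ) (hm : EE ℓ α i - EE ℓ α j ∈ R.Δ) :
    R.ht (S.image α) (EE ℓ α i - EE ℓ α j) =
      ∑ k ∈ S, ((if i ≤ k then 1 else 0) - (if j ≤ k then 1 else 0)) := by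
  rw [ht_image R ℓ α hA S hS]
  apply Finset.sum_congr rfl
  intro k hk
  have := Finset.mem_Icc.1 (hS hk)
  exact coeff_EE R ℓ α hA i j hm k this.1 this.2

/-- an interval meeting `S` in exactly one point has height one -/
lemma ht_one (hA : R.IsTypeOf ℓ α matA)
    (S : Finset ℕ) (hS : S ⊆ Finset.Icc 1 ℓ) (i j s : ℕ) (hi : 1 ≤ i) (hj : j ≤ ℓ + 1)
    (hs : s ∈ S) (his : i ≤ s) (hsj : s < j) (huniq : ∀ k ∈ S, i ≤ k → k < j → k = s) :
    R.ht (S.image α) (EE ℓ α j - EE ℓ α i) = -1 := by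
  rw [ht_EE R ℓ α hA S hS j i
    (EE_mem R ℓ α hA j i (by omega) (by omega) (by omega) (by omega) (by omega))]
  rw [Finset.sum_eq_single s]
  · rw [if_neg (by omega), if_pos his]; norm_num
  · intro k hk hks
    have := huniq k hk
    split_ifs <;> omega
  · intro h; exact absurd hs h

lemma ht_add (hA : R.IsTypeOf ℓ α matA)
    (S : Finset ℕ) (hS : S ⊆ Finset.Icc 1 ℓ) (β γ : V) (hβ : β ∈ R.Δ) (hγ : γ ∈ R.Δ)
    (h : β + γ ∈ R.Δ) :
    R.ht (S.image α) (β + γ) = R.ht (S.image α) β + R.ht (S.image α) γ := by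
  simp only [ht_image R ℓ α hA S hS]
  rw [← Finset.sum_add_distrib]
  apply Finset.sum_congr rfl
  intro k hk
  have := Finset.mem_Icc.1 (hS hk)
  exact coeff_add R ℓ α hA β γ hβ hγ h k this.1 this.2

lemma ht_neg (hA : R.IsTypeOf ℓ α matA)
    (S : Finset ℕ) (hS : S ⊆ Finset.Icc 1 ℓ) (β : V) (hβ : β ∈ R.Δ) :
    R.ht (S.image α) (-β) = - R.ht (S.image α) β := by
  simp only [ht_image R ℓ α hA S hS]
  rw [← Finset.sum_neg_distrib]
  apply Finset.sum_congr rfl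
  intro k hk
  have := Finset.mem_Icc.1 (hS hk)
  exact coeff_neg R ℓ α hA β hβ k this.1 this.2

end
end MongeA
namespace MongeA

open RootSystemBase

variable {V : Type*} [NormedAddCommGroup V] [InnerProductSpace ℝ V]
variable {L : Type*} [LieRing L] [LieAlgebra ℂ L]

section
variable (G : GradedLieData V L)

/-- the dimension of a sum of root spaces -/
lemma finrank_iSup_rs [FiniteDimensional ℂ L] (F : Finset V) (hF : F ⊆ G.base.Δ) :
    Module.finrank ℂ ↥(⨆ β ∈ F, G.rs β) = F.card := by
  induction F using Finset.induction_on with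
  | empty => simp
  | insert b F hb ih =>
    have hbm := hF (Finset.mem_insert_self b F)
    have hF' : F ⊆ G.base.Δ := fun x hx => hF (Finset.mem_insert_of_mem hx)
    rw [Finset.iSup_insert, Finset.card_insert_of_notMem hb, ← ih hF']
    have hd : Disjoint (G.rs b) (⨆ β ∈ F, G.rs β) := by
      refine (G.rs_indep b hbm).mono_right (le_sup_of_le_right ?_)
      apply iSup₂_le
      intro c hc
      exact le_iSup₂_of_le c (Finset.mem_erase.2 ⟨fun h => hb (h ▸ hc), hF' hc⟩) le_rfl
    have := Submodule.finrank_sup_add_finrank_inf_eq (G.rs b) (⨆ β ∈ F, G.rs β)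
    rw [hd.eq_bot, finrank_bot, G.rs_dim b hbm] at this
    omega

lemma g_ne (Sg : Finset V) (j : ℤ) (hj : j ≠ 0) : G.g Sg j =
    ⨆ β ∈ G.base.Δ.filter (fun β => G.base.ht Sg β = j), G.rs β := by
  unfold GradedLieData.g
  rw [if_neg hj]

lemma finrank_g [FiniteDimensional ℂ L] (Sg : Finset V) (j : ℤ) (hj : j ≠ 0) :
    Module.finrank ℂ ↥(G.g Sg j) =
      (G.base.Δ.filter (fun β => G.base.ht Sg β = j)).card := by
  rw [g_ne G Sg j hj]
  exact finrank_iSup_rs G _ (Finset.filter_subset _ _)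

lemma br_mem (x y : V) (hx : x ∈ G.base.Δ) (hy : y ∈ G.base.Δ) (hxy : x + y ≠ 0) (e f : L)
    (he : e ∈ G.rs x) (hf : f ∈ G.rs y) : ⁅e, f⁆ ∈ G.rs (x + y) := by
  by_cases h : x + y ∈ G.base.Δ
  · exact G.br_rs_mem x hx y hy h e he f hf
  · rw [G.br_rs_zero x hx y hy h hxy e he f hf]
    exact Submodule.zero_mem _

lemma rs_le_erase (v r : V) (h : v ≠ r) : G.rs v ≤ G.H ⊔ ⨆ γ ∈ G.base.Δ.erase r, G.rs γ := by
  by_cases hv : v ∈ G.base.Δ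
  · exact le_sup_of_le_right (le_iSup₂_of_le v (Finset.mem_erase.2 ⟨h, hv⟩) le_rfl)
  · rw [G.rs_bot v hv]; exact bot_le

lemma exists_root_vec (x : V) (hx : x ∈ G.base.Δ) : ∃ e ∈ G.rs x, e ≠ 0 := by
  have := G.rs_dim x hx
  obtain ⟨v, hv, -⟩ := finrank_eq_one_iff'.1 this
  exact ⟨v, v.2, fun h => hv (Subtype.ext h)⟩

lemma codim_one [FiniteDimensional ℂ L] (Y g : Submodule ℂ L) (hY : Y ≤ g)
    (hd : Module.finrank ℂ ↥Y + 1 = Module.finrank ℂ ↥g) (u v : L) (hu : u ∈ g) (hv : v ∈ g)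
    (hvY : v ∉ Y) : ∃ c : ℂ, u - c • v ∈ Y := by
  have hlt : Y < Y ⊔ Submodule.span ℂ {v} := by
    refine lt_of_le_of_ne le_sup_left ?_
    intro h
    apply hvY
    rw [h]
    exact Submodule.mem_sup_right (Submodule.mem_span_singleton_self v)
  have h1 := Submodule.finrank_lt_finrank_of_lt hlt
  have hle : Y ⊔ Submodule.span ℂ {v} ≤ g := by
    refine sup_le hY ?_
    rw [Submodule.span_singleton_le_iff_mem]; exact hv
  have he := Submodule.eq_of_le_of_finrank_le hle (by omega)
  rw [← he] at hu
  obtain ⟨y, hy, z, hz, hyz⟩ := Submodule.mem_sup.1 hu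
  obtain ⟨c, rfl⟩ := Submodule.mem_span_singleton.1 hz
  exact ⟨c, by rw [← hyz]; simpa using hy⟩

/-- If `x + y` is a root, the bracket of root vectors is not a combination of brackets
in other root spaces. -/
lemma key_indep (x y x' : V) (hx : x ∈ G.base.Δ) (hy : y ∈ G.base.Δ) (hx' : x' ∈ G.base.Δ)
    (hxy : x + y ∈ G.base.Δ) (h1 : x' ≠ x) (h2 : x' ≠ y) (h3 : x' + y ≠ 0) (h4 : x' + x ≠ 0)
    (ex ey ex' : L) (hex : ex ∈ G.rs x) (hey : ey ∈ G.rs y) (hex' : ex' ∈ G.rs x')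
    (nx : ex ≠ 0) (ny : ey ≠ 0) (c d : ℂ)
    (hbr : ⁅ex, ey⁆ = c • ⁅ex', ey⁆ + d • ⁅ex', ex⁆) : False := by
  have m1 := br_mem G x' y hx' hy h3 ex' ey hex' hey
  have m2 := br_mem G x' x hx' hx h4 ex' ex hex' hex
  have n1 := rs_le_erase G (x' + y) (x + y) (by simpa using h1) m1
  have n2 := rs_le_erase G (x' + x) (x + y) (by
    rw [add_comm x y]; simpa using h2) m2
  have m3 : ⁅ex, ey⁆ ∈ G.rs (x + y) := G.br_rs_mem x hx y hy hxy ex hex ey hey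
  have m4 : ⁅ex, ey⁆ ∈ G.H ⊔ ⨆ γ ∈ G.base.Δ.erase (x + y), G.rs γ := by
    rw [hbr]
    exact Submodule.add_mem _ (Submodule.smul_mem _ _ n1) (Submodule.smul_mem _ _ n2)
  have h0 := Submodule.disjoint_def.1 (G.rs_indep _ hxy) _ m3 m4
  rcases G.br_nondeg x hx y hy hxy ex hex ey hey h0 with h | h
  · exact nx h
  · exact ny h

/-- With `x + y` a root, no third root vector of degree `-1` lies outside of `Y`, if `x` does. -/
lemma third_aux (Y g : Submodule ℂ L) [FiniteDimensional ℂ L] (hY : Y ≤ g)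
    (hab : ∀ a ∈ Y, ∀ b ∈ Y, ⁅a, b⁆ = (0 : L))
    (hd : Module.finrank ℂ ↥Y + 1 = Module.finrank ℂ ↥g)
    (x y x' : V) (hx : x ∈ G.base.Δ) (hy : y ∈ G.base.Δ) (hx' : x' ∈ G.base.Δ)
    (hxy : x + y ∈ G.base.Δ) (h1 : x' ≠ x) (h2 : x' ≠ y) (h3 : x' + y ≠ 0) (h4 : x' + x ≠ 0)
    (ex ey ex' : L) (hex : ex ∈ G.rs x) (hey : ey ∈ G.rs y) (hex' : ex' ∈ G.rs x')
    (nx : ex ≠ 0) (ny : ey ≠ 0) (gx : ex ∈ g) (gy : ey ∈ g)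
    (gx' : ex' ∈ g) (hxY : ex ∉ Y) (hxY' : ex' ∉ Y) : False := by
  obtain ⟨c, hc⟩ := codim_one Y g hY hd ex ex' gx gx' hxY'
  obtain ⟨d, hd'⟩ := codim_one Y g hY hd ey ex gy gx hxY
  have h := hab _ hc _ hd'
  refine key_indep G x y x' hx hy hx' hxy h1 h2 h3 h4 ex ey ex' hex hey hex' nx ny c (-(c * d)) ?_
  simp only [sub_lie, lie_sub, smul_lie, lie_smul, lie_self] at h
  rw [← sub_eq_zero, ← h]
  module

/-- The obstruction: two disjoint pairs of degree `-1` roots with root sums. -/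
lemma obstruction [FiniteDimensional ℂ L] (ℓ : ℕ) (α : ℕ → V)
    (hA : G.base.IsTypeOf ℓ α matA) (S : Finset ℕ) (hS : S ⊆ Finset.Icc 1 ℓ)
    (hM : G.Monge (S.image α)) (x y z w : V)
    (hx : x ∈ G.base.Δ) (hy : y ∈ G.base.Δ) (hz : z ∈ G.base.Δ) (hw : w ∈ G.base.Δ)
    (hxy : x + y ∈ G.base.Δ) (hzw : z + w ∈ G.base.Δ)
    (tx : G.base.ht (S.image α) x = -1) (ty : G.base.ht (S.image α) y = -1)
    (tz : G.base.ht (S.image α) z = -1) (tw : G.base.ht (S.image α) w = -1)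
    (hxz : x ≠ z) (hxw : x ≠ w) (hyz : y ≠ z) (hyw : y ≠ w) : False := by
  obtain ⟨Y, hY, -, hab, hd, -⟩ := hM
  have nz : ∀ a b, a ∈ G.base.Δ → b ∈ G.base.Δ → G.base.ht (S.image α) a = -1 →
      G.base.ht (S.image α) b = -1 → a + b ≠ 0 := by
    intro a b ha hb hta htb h
    have : a = -b := eq_neg_of_add_eq_zero_left h
    rw [this, ht_neg G.base ℓ α hA S hS b hb, htb] at hta
    omega
  have ing : ∀ a, a ∈ G.base.Δ → G.base.ht (S.image α) a = -1 → ∀ e ∈ G.rs a,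
      e ∈ G.g (S.image α) (-1) := by
    intro a ha hta e he
    rw [g_ne G _ _ (by norm_num)]
    exact (le_iSup₂_of_le (f := fun β _ => G.rs β) a (Finset.mem_filter.2 ⟨ha, hta⟩) le_rfl) he
  have pair : ∀ a b, a ∈ G.base.Δ → b ∈ G.base.Δ → a + b ∈ G.base.Δ → ∀ e ∈ G.rs a, ∀ f ∈ G.rs b,
      e ≠ 0 → f ≠ 0 → e ∉ Y ∨ f ∉ Y := by
    intro a b ha hb hab' e he f hf ne nf
    by_contra hcon
    push Not at hcon
    rcases G.br_nondeg a ha b hb hab' e he f hf (hab e hcon.1 f hcon.2) with h | h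
    · exact ne h
    · exact nf h
  obtain ⟨ex, mx, nx⟩ := exists_root_vec G x hx
  obtain ⟨ey, my, ny⟩ := exists_root_vec G y hy
  obtain ⟨ez, mz, nz'⟩ := exists_root_vec G z hz
  obtain ⟨ew, mw, nw⟩ := exists_root_vec G w hw
  have hyx : y + x ∈ G.base.Δ := by rwa [add_comm]
  have T := third_aux G Y _ hY hab hd
  rcases pair x y hx hy hxy ex mx ey my nx ny with h | h
  · rcases pair z w hz hw hzw ez mz ew mw nz' nw with k | k
    · exact T x y z hx hy hz hxy hxz.symm hyz.symm (nz _ _ hz hy tz ty) (nz _ _ hz hx tz tx)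
        ex ey ez mx my mz nx ny (ing _ hx tx _ mx) (ing _ hy ty _ my) (ing _ hz tz _ mz) h k
    · exact T x y w hx hy hw hxy hxw.symm hyw.symm (nz _ _ hw hy tw ty) (nz _ _ hw hx tw tx)
        ex ey ew mx my mw nx ny (ing _ hx tx _ mx) (ing _ hy ty _ my) (ing _ hw tw _ mw) h k
  · rcases pair z w hz hw hzw ez mz ew mw nz' nw with k | k
    · exact T y x z hy hx hz hyx hyz.symm hxz.symm (nz _ _ hz hx tz tx) (nz _ _ hz hy tz ty)
        ey ex ez my mx mz ny nx (ing _ hy ty _ my) (ing _ hx tx _ mx) (ing _ hz tz _ mz) h k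
    · exact T y x w hy hx hw hyx hyw.symm hxw.symm (nz _ _ hw hx tw tx) (nz _ _ hw hy tw ty)
        ey ex ew my mx mw ny nx (ing _ hy ty _ my) (ing _ hx tx _ mx) (ing _ hw tw _ mw) h k

/-- A sufficient criterion for Monge type. -/
lemma monge_of [FiniteDimensional ℂ L] (Sg : Finset V) (r : V) (FY : Finset V)
    (hr : r ∈ G.base.Δ) (hr1 : G.base.ht Sg r = -1)
    (hFY : FY = (G.base.Δ.filter (fun β => G.base.ht Sg β = -1)).erase r) (hne : FY.Nonempty)
    (hab : ∀ β ∈ FY, ∀ γ ∈ FY, β + γ ∉ G.base.Δ ∧ β + γ ≠ 0)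
    (hc : (G.base.Δ.filter (fun β => G.base.ht Sg β = -2)).card = FY.card) : G.Monge Sg := by
  have hsub : FY ⊆ G.base.Δ := by
    rw [hFY]; exact (Finset.erase_subset _ _).trans (Finset.filter_subset _ _)
  have hfr := finrank_iSup_rs G FY hsub
  refine ⟨⨆ β ∈ FY, G.rs β, ?_, ?_, ?_, ?_, ?_⟩
  · rw [g_ne G _ _ (by norm_num)]
    apply biSup_mono
    intro b hb
    rw [hFY] at hb
    exact Finset.mem_of_mem_erase hb
  · intro h
    rw [h, finrank_bot] at hfr
    exact hne.card_pos.ne hfr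
  · have base : ∀ β ∈ FY, ∀ γ ∈ FY, ∀ a ∈ G.rs β, ∀ b ∈ G.rs γ, ⁅a, b⁆ = (0 : L) :=
      fun β hβ γ hγ a ha b hb =>
        G.br_rs_zero β (hsub hβ) γ (hsub hγ) (hab β hβ γ hγ).1 (hab β hβ γ hγ).2 a ha b hb
    have step1 : ∀ β ∈ FY, ∀ a ∈ G.rs β, ∀ b ∈ ⨆ β ∈ FY, G.rs β, ⁅a, b⁆ = (0 : L) := by
      intro β hβ a ha b hb
      have hle : (⨆ β ∈ FY, G.rs β) ≤ LinearMap.ker (LieAlgebra.ad ℂ L a : L →ₗ[ℂ] L) := by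
        apply iSup₂_le
        intro γ hγ c hcc
        rw [LinearMap.mem_ker, LieAlgebra.ad_apply]
        exact base β hβ γ hγ a ha c hcc
      have := hle hb
      rwa [LinearMap.mem_ker, LieAlgebra.ad_apply] at this
    intro a ha b hb
    have hle : (⨆ β ∈ FY, G.rs β) ≤ LinearMap.ker (LieAlgebra.ad ℂ L b : L →ₗ[ℂ] L) := by
      apply iSup₂_le
      intro γ hγ c hcc
      rw [LinearMap.mem_ker, LieAlgebra.ad_apply, ← lie_skew, step1 γ hγ c hcc b hb, neg_zero]
    have := hle ha
    rw [LinearMap.mem_ker, LieAlgebra.ad_apply] at this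
    rw [← lie_skew, this, neg_zero]
  · rw [hfr, finrank_g G _ _ (by norm_num), hFY]
    exact Finset.card_erase_add_one (Finset.mem_filter.2 ⟨hr, hr1⟩)
  · rw [hfr, finrank_g G _ _ (by norm_num), hc]

end
end MongeA
namespace MongeA

open RootSystemBase

variable {V : Type*} [NormedAddCommGroup V] [InnerProductSpace ℝ V]
variable {L : Type*} [LieRing L] [LieAlgebra ℂ L] [FiniteDimensional ℂ L]

section
variable (G : GradedLieData V L) (ℓ : ℕ) (α : ℕ → V)

lemma obs (hA : G.base.IsTypeOf ℓ α matA)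
    (S : Finset ℕ) (hS : S ⊆ Finset.Icc 1 ℓ) (hM : G.Monge (S.image α))
    (a b c a' b' c' s t s' t' : ℕ)
    (h1 : 1 ≤ a) (h2 : a < b) (h3 : b < c) (h4 : c ≤ ℓ + 1)
    (h1' : 1 ≤ a') (h2' : a' < b') (h3' : b' < c') (h4' : c' ≤ ℓ + 1)
    (m1 : s ∈ S ∧ a ≤ s ∧ s < b ∧ ∀ k ∈ S, a ≤ k → k < b → k = s)
    (m2 : t ∈ S ∧ b ≤ t ∧ t < c ∧ ∀ k ∈ S, b ≤ k → k < c → k = t)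
    (m3 : s' ∈ S ∧ a' ≤ s' ∧ s' < b' ∧ ∀ k ∈ S, a' ≤ k → k < b' → k = s')
    (m4 : t' ∈ S ∧ b' ≤ t' ∧ t' < c' ∧ ∀ k ∈ S, b' ≤ k → k < c' → k = t')
    (n1 : ¬ (a = a' ∧ b = b')) (n2 : ¬ (a = b' ∧ b = c')) (n3 : ¬ (b = a' ∧ c = b'))
    (n4 : ¬ (b = b' ∧ c = c')) : False := by
  have T : ∀ i j s, 1 ≤ i → j ≤ ℓ + 1 → (s ∈ S ∧ i ≤ s ∧ s < j ∧ ∀ k ∈ S, i ≤ k → k < j → k = s) →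
      G.base.ht (S.image α) (EE ℓ α j - EE ℓ α i) = -1 := fun i j s hi hj h =>
    ht_one G.base ℓ α hA S hS i j s hi hj h.1 h.2.1 h.2.2.1 h.2.2.2
  have Mm : ∀ i j, 1 ≤ i → i < j → j ≤ ℓ + 1 → EE ℓ α j - EE ℓ α i ∈ G.base.Δ :=
    fun i j hi hij hj =>
      EE_mem G.base ℓ α hA j i (by omega) (by omega) (by omega) (by omega) (by omega)
  have D : ∀ i j i' j', 1 ≤ i → i < j → j ≤ ℓ + 1 → 1 ≤ i' → i' < j' → j' ≤ ℓ + 1 →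
      ¬ (i = i' ∧ j = j') → EE ℓ α j - EE ℓ α i ≠ EE ℓ α j' - EE ℓ α i' := by
    intro i j i' j' q1 q2 q3 q4 q5 q6 hn he
    apply hn
    refine EE_inj G.base ℓ α hA i j i' j' q1 (by omega) (by omega) q3 q4 (by omega) (by omega)
      q6 q2 ?_
    rw [← neg_sub, he, neg_sub]
  refine obstruction G ℓ α hA S hS hM (EE ℓ α b - EE ℓ α a) (EE ℓ α c - EE ℓ α b)
    (EE ℓ α b' - EE ℓ α a') (EE ℓ α c' - EE ℓ α b')
    (Mm _ _ (by omega) (by omega) (by omega)) (Mm _ _ (by omega) (by omega) (by omega))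
    (Mm _ _ (by omega) (by omega) (by omega)) (Mm _ _ (by omega) (by omega) (by omega)) ?_ ?_
    (T _ _ _ (by omega) (by omega) m1) (T _ _ _ (by omega) (by omega) m2)
    (T _ _ _ (by omega) (by omega) m3) (T _ _ _ (by omega) (by omega) m4)
    (D _ _ _ _ (by omega) (by omega) (by omega) (by omega) (by omega) (by omega) n1)
    (D _ _ _ _ (by omega) (by omega) (by omega) (by omega) (by omega) (by omega) n2)
    (D _ _ _ _ (by omega) (by omega) (by omega) (by omega) (by omega) (by omega) n3)
    (D _ _ _ _ (by omega) (by omega) (by omega) (by omega) (by omega) (by omega) n4)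
  · rw [add_comm, sub_add_sub_cancel]
    exact Mm _ _ (by omega) (by omega) (by omega)
  · rw [add_comm, sub_add_sub_cancel]
    exact Mm _ _ (by omega) (by omega) (by omega)

lemma not_single (hA : G.base.IsTypeOf ℓ α matA)
    (m : ℕ) (h1 : 1 ≤ m) (h2 : m ≤ ℓ) (hM : G.Monge (({m} : Finset ℕ).image α)) :
    False := by
  obtain ⟨Y, -, hY0, -, -, hd⟩ := hM
  apply hY0
  rw [← Submodule.finrank_eq_zero (R := ℂ), ← hd, finrank_g G _ _ (by norm_num),
    Finset.card_eq_zero, Finset.filter_eq_empty_iff]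
  intro β hβ hht
  obtain ⟨i, j, -, -, -, -, -, rfl⟩ := mem_InP G.base ℓ α hA β hβ
  rw [ht_EE G.base ℓ α hA _ (by
    intro k hk
    rw [Finset.mem_singleton] at hk
    subst hk
    exact Finset.mem_Icc.2 ⟨h1, h2⟩) i j hβ, Finset.sum_singleton] at hht
  split_ifs at hht <;> omega

/-- the shape of the gradings of Monge type -/
lemma monge_shape (hA : G.base.IsTypeOf ℓ α matA)
    (S : Finset ℕ) (hS : S ⊆ Finset.Icc 1 ℓ) (hne : S.Nonempty)
    (hM : G.Monge (S.image α)) :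
    ∃ m, (S = {m, m + 1} ∧ (m = 1 ∨ m + 1 = ℓ)) ∨ S = {m, m + 1, m + 2} := by
  set M := S.max' hne with hMdef
  set m := S.min' hne with hmdef
  have hMS : M ∈ S := S.max'_mem hne
  have hmS : m ∈ S := S.min'_mem hne
  have hle : ∀ k ∈ S, k ≤ M := fun k hk => S.le_max' k hk
  have hge : ∀ k ∈ S, m ≤ k := fun k hk => S.min'_le k hk
  have hb : ∀ k ∈ S, 1 ≤ k ∧ k ≤ ℓ := fun k hk => Finset.mem_Icc.1 (hS hk)
  have hm1 := hb m hmS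
  have hM1 := hb M hMS
  have hmM := hge M hMS
  -- no gaps
  have step : ∀ s ∈ S, s < M → s + 1 ∈ S := by
    intro s hs hsM
    by_contra hcon
    have hne' : (S.filter (fun k => s < k)).Nonempty := ⟨M, Finset.mem_filter.2 ⟨hMS, hsM⟩⟩
    obtain ⟨t, ht⟩ : ∃ t, t = (S.filter (fun k => s < k)).min' hne' := ⟨_, rfl⟩
    have htS : t ∈ S.filter (fun k => s < k) := ht ▸ Finset.min'_mem _ hne'
    rw [Finset.mem_filter] at htS
    have hmin : ∀ k ∈ S, s < k → t ≤ k := fun k hk hsk =>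
      ht ▸ Finset.min'_le _ k (Finset.mem_filter.2 ⟨hk, hsk⟩)
    have hts : t ≠ s + 1 := fun h => hcon (h ▸ htS.1)
    have hs1 := hb s hs
    have ht1 := hb t htS.1
    have hst := htS.2
    have hf : ∀ k ∈ S, k ≤ s ∨ t ≤ k := fun k hk => by
      by_cases h : s < k
      · exact Or.inr (hmin k hk h)
      · left; omega
    refine obs G ℓ α hA S hS hM s (s + 1) (t + 1) s t (t + 1) s t s t
      (by omega) (by omega) (by omega) (by omega) (by omega) (by omega) (by omega) (by omega)
      ⟨hs, by omega, by omega, fun k hk h h' => ?_⟩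
      ⟨htS.1, by omega, by omega, fun k hk h h' => ?_⟩
      ⟨hs, by omega, by omega, fun k hk h h' => ?_⟩
      ⟨htS.1, by omega, by omega, fun k hk h h' => ?_⟩
      (by omega) (by omega) (by omega) (by omega)
    all_goals
      have := hf k hk
      omega
  have c1 : m < M → m + 1 ∈ S := step m hmS
  have c2 : m + 1 < M → m + 2 ∈ S := fun h => step (m + 1) (c1 (by omega)) h
  have hlen : M ≤ m + 2 := by
    by_contra hcon
    push Not at hcon
    have d1 := c1 (by omega)
    have d2 := c2 (by omega)
    have d3 := step (m + 2) d2 (by omega)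
    have e3 := hb _ d3
    exact obs G ℓ α hA S hS hM m (m + 1) (m + 2) (m + 2) (m + 3) (m + 4) m (m + 1) (m + 2) (m + 3)
      (by omega) (by omega) (by omega) (by omega) (by omega) (by omega) (by omega) (by omega)
      ⟨hmS, by omega, by omega, fun k hk h h' => by omega⟩
      ⟨d1, by omega, by omega, fun k hk h h' => by omega⟩
      ⟨d2, by omega, by omega, fun k hk h h' => by omega⟩
      ⟨d3, by omega, by omega, fun k hk h h' => by omega⟩
      (by omega) (by omega) (by omega) (by omega)
  refine ⟨m, ?_⟩
  obtain h | h | h : M = m ∨ M = m + 1 ∨ M = m + 2 := by omega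
  · exfalso
    have hSm : S = {m} := by
      ext k
      rw [Finset.mem_singleton]
      constructor
      · intro hk
        have := hle k hk
        have := hge k hk
        omega
      · intro hk
        rw [hk]; exact hmS
    have hM' : G.Monge (({m} : Finset ℕ).image α) := hSm ▸ hM
    exact not_single G ℓ α hA m hm1.1 hm1.2 hM'
  · left
    have d1 := c1 (by omega)
    have hSm : S = {m, m + 1} := by
      ext k
      rw [Finset.mem_insert, Finset.mem_singleton]
      constructor
      · intro hk
        have := hle k hk
        have := hge k hk
        omega
      · rintro (hk | hk)
        · rw [hk]; exact hmS
        · rw [hk]; exact d1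
    refine ⟨hSm, ?_⟩
    by_contra hcon
    push Not at hcon
    have hin : ∀ k ∈ S, k = m ∨ k = m + 1 := by
      intro k hk
      have := hle k hk
      have := hge k hk
      omega
    obtain ⟨u, hu⟩ : ∃ u, m = u + 1 := ⟨m - 1, by omega⟩
    have e1 := hb _ d1
    refine obs G ℓ α hA S hS hM m (m + 1) (m + 2) u (m + 1) (m + 3) m (m + 1) m (m + 1)
      (by omega) (by omega) (by omega) (by omega) (by omega) (by omega) (by omega) (by omega)
      ⟨hmS, by omega, by omega, fun k hk h h' => ?_⟩
      ⟨d1, by omega, by omega, fun k hk h h' => ?_⟩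
      ⟨hmS, by omega, by omega, fun k hk h h' => ?_⟩
      ⟨d1, by omega, by omega, fun k hk h h' => ?_⟩
      (by omega) (by omega) (by omega) (by omega)
    all_goals
      have := hin k hk
      omega
  · right
    have d1 := c1 (by omega)
    have d2 := c2 (by omega)
    ext k
    rw [Finset.mem_insert, Finset.mem_insert, Finset.mem_singleton]
    constructor
    · intro hk
      have := hle k hk
      have := hge k hk
      omega
    · rintro (hk | hk | hk)
      · rw [hk]; exact hmS
      · rw [hk]; exact d1
      · rw [hk]; exact d2

lemma sum_if (hA : G.base.IsTypeOf ℓ α matA)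
    (p i : ℕ) (hi : 1 ≤ i) :
    (∑ k ∈ Finset.Icc 1 (p + 1), if i ≤ k then (1 : ℤ) else 0) = ((p + 2 - i : ℕ) : ℤ) := by
  rw [Finset.sum_ite, Finset.sum_const_zero, add_zero, Finset.sum_const, nsmul_eq_mul, mul_one]
  have : (Finset.Icc 1 (p + 1)).filter (fun k => i ≤ k) = Finset.Icc i (p + 1) := by
    ext k
    simp only [Finset.mem_filter, Finset.mem_Icc]
    omega
  rw [this, Nat.card_Icc]

lemma ht_std (hA : G.base.IsTypeOf ℓ α matA)
    (p i j : ℕ) (hp : p + 1 ≤ ℓ) (hi : 1 ≤ i) (hj : 1 ≤ j)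
    (hm : EE ℓ α i - EE ℓ α j ∈ G.base.Δ) :
    G.base.ht ((Finset.Icc 1 (p + 1)).image α) (EE ℓ α i - EE ℓ α j) =
      ((p + 2 - i : ℕ) : ℤ) - ((p + 2 - j : ℕ) : ℤ) := by
  rw [ht_EE G.base ℓ α hA _ (Finset.Icc_subset_Icc_right hp) i j hm, Finset.sum_sub_distrib,
    sum_if G ℓ α hA p i hi, sum_if G ℓ α hA p j hj]

lemma monge_std (hA : G.base.IsTypeOf ℓ α matA)
    (p : ℕ) (hp1 : p = 1 ∨ p = 2) (hp : p + 1 ≤ ℓ) :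
    G.Monge ((Finset.Icc 1 (p + 1)).image α) := by
  have hsub : Finset.Icc 1 (p + 1) ⊆ Finset.Icc 1 ℓ := Finset.Icc_subset_Icc_right hp
  have hrm := EE_mem G.base ℓ α hA (p + 1) p (by omega) (by omega) (by omega) (by omega) (by omega)
  have cl : ∀ i j, 1 ≤ i → i ≤ ℓ + 1 → 1 ≤ j → j ≤ ℓ + 1 → i ≠ j →
      EE ℓ α i - EE ℓ α j ∈ G.base.Δ ∧
      G.base.ht ((Finset.Icc 1 (p + 1)).image α) (EE ℓ α i - EE ℓ α j) =
      ((p + 2 - i : ℕ) : ℤ) - ((p + 2 - j : ℕ) : ℤ) := by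
    intro i j h1 h2 h3 h4 h5
    have := EE_mem G.base ℓ α hA i j h1 h2 h3 h4 h5
    exact ⟨this, ht_std G ℓ α hA p i j hp h1 h3 this⟩
  have ne_r : ∀ i j, 1 ≤ i → i ≤ ℓ + 1 → 1 ≤ j → j ≤ ℓ + 1 →
      (EE ℓ α i - EE ℓ α j = EE ℓ α (p + 1) - EE ℓ α p) → i = p + 1 ∧ j = p := by
    intro i j h1 h2 h3 h4 he
    have := EE_inj G.base ℓ α hA p (p + 1) j i (by omega) (by omega) (by omega) (by omega)
      h3 h4 h1 h2 (by omega) (by rw [← neg_sub, ← he, neg_sub])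
    exact ⟨this.2.symm, this.1.symm⟩
  refine monge_of G _ (EE ℓ α (p + 1) - EE ℓ α p) _ hrm ?_ rfl ?_ ?_ ?_
  · rw [ht_std G ℓ α hA p _ _ hp (by omega) (by omega) hrm]
    omega
  · refine ⟨EE ℓ α (p + 2) - EE ℓ α (p + 1), ?_⟩
    have h := cl (p + 2) (p + 1) (by omega) (by omega) (by omega) (by omega) (by omega)
    rw [Finset.mem_erase, Finset.mem_filter]
    refine ⟨?_, h.1, ?_⟩
    · intro he
      have := ne_r _ _ (by omega) (by omega) (by omega) (by omega) he
      omega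
    · rw [h.2]; omega
  · have form : ∀ β ∈ (G.base.Δ.filter (fun β =>
        G.base.ht ((Finset.Icc 1 (p + 1)).image α) β = -1)).erase (EE ℓ α (p + 1) - EE ℓ α p),
        ∃ i j, EE ℓ α i - EE ℓ α j = β ∧ 1 ≤ j ∧ j < i ∧
          ((p = 2 ∧ i = 2 ∧ j = 1) ∨ (j = p + 1 ∧ p + 2 ≤ i)) := by
      intro β hβ
      rw [Finset.mem_erase, Finset.mem_filter] at hβ
      obtain ⟨hβr, hβ, hht⟩ := hβ
      obtain ⟨i, j, hi, hi', hj, hj', hij, rfl⟩ := mem_InP G.base ℓ α hA β hβ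
      rw [(cl i j hi hi' hj hj' hij).2] at hht
      refine ⟨i, j, rfl, hj, by omega, ?_⟩
      have : ¬ (i = p + 1 ∧ j = p) := by
        rintro ⟨rfl, rfl⟩
        exact hβr rfl
      omega
    intro β hβ γ hγ
    have hβ1 := hβ
    have hγ1 := hγ
    rw [Finset.mem_erase, Finset.mem_filter] at hβ1 hγ1
    constructor
    · intro hsum
      have hco := coeff_add G.base ℓ α hA β γ hβ1.2.1 hγ1.2.1 hsum
      obtain ⟨a, b, ha, ha', hb, hb', hab, he⟩ := mem_InP G.base ℓ α hA _ hsum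
      rw [he] at hsum
      simp only [he] at hco
      obtain ⟨i, j, rfl, hj, hji, hfi⟩ := form β hβ
      obtain ⟨i', j', rfl, hj', hji', hfi'⟩ := form γ hγ
      have hco' : ∀ k, 1 ≤ k → k ≤ ℓ →
          ((if a ≤ k then 1 else 0) - (if b ≤ k then 1 else 0) : ℤ) =
          ((if i ≤ k then 1 else 0) - (if j ≤ k then 1 else 0)) +
          ((if i' ≤ k then 1 else 0) - (if j' ≤ k then 1 else 0)) := by
        intro k h1 h2
        have := hco k h1 h2
        rwa [coeff_EE G.base ℓ α hA _ _ hsum k h1 h2, coeff_EE G.base ℓ α hA _ _ hβ1.2.1 k h1 h2,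
          coeff_EE G.base ℓ α hA _ _ hγ1.2.1 k h1 h2] at this
      have k1 := hco' 1 (by omega) (by omega)
      have k2 := hco' p (by omega) (by omega)
      have k3 := hco' (p + 1) (by omega) (by omega)
      rcases hfi with ⟨rfl, rfl, rfl⟩ | ⟨rfl, hi⟩
      · rcases hfi' with ⟨-, rfl, rfl⟩ | ⟨rfl, hi'⟩
        · norm_num at k1
          split_ifs at k1 <;> omega
        · rw [if_neg (by omega : ¬ i' ≤ 1)] at k1
          rw [if_neg (by omega : ¬ i' ≤ 2)] at k2
          rw [if_neg (by omega : ¬ i' ≤ 2 + 1)] at k3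
          norm_num at k1 k2 k3
          have q1 : b ≤ 1 := by split_ifs at k1 <;> omega
          have q3 : 3 < a := by split_ifs at k3 <;> omega
          rw [if_neg (by omega), if_pos (by omega)] at k2
          omega
      · rcases hfi' with ⟨rfl, rfl, rfl⟩ | ⟨rfl, hi'⟩
        · rw [if_neg (by omega : ¬ i ≤ 1)] at k1
          rw [if_neg (by omega : ¬ i ≤ 2)] at k2
          rw [if_neg (by omega : ¬ i ≤ 2 + 1)] at k3
          norm_num at k1 k2 k3
          have q1 : b ≤ 1 := by split_ifs at k1 <;> omega
          have q3 : 3 < a := by split_ifs at k3 <;> omega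
          rw [if_neg (by omega), if_pos (by omega)] at k2
          omega
        · rw [if_neg (by omega : ¬ i ≤ p + 1), if_neg (by omega : ¬ i' ≤ p + 1),
            if_pos (le_refl (p + 1))] at k3
          split_ifs at k3 <;> omega
    · intro h
      have h1 : γ = -β := (neg_eq_of_add_eq_zero_right h).symm
      have h2 := hγ1.2.2
      rw [h1, ht_neg G.base ℓ α hA _ hsub β hβ1.2.1, hβ1.2.2] at h2
      omega
  · have hpn := al_ne G.base ℓ α hA p (by omega) (by omega)
    refine Finset.card_nbij' (refl (α p)) (refl (α p)) ?_ ?_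
      (fun β _ => refl_refl _ _ hpn) (fun β _ => refl_refl _ _ hpn)
    · intro β hβ
      rw [Finset.mem_coe, Finset.mem_filter] at hβ
      obtain ⟨hβ, hht⟩ := hβ
      obtain ⟨i, j, hi, hi', hj, hj', hij, rfl⟩ := mem_InP G.base ℓ α hA β hβ
      rw [(cl i j hi hi' hj hj' hij).2] at hht
      rw [refl_EE G.base ℓ α hA p i j (by omega) (by omega) hi hi' hj hj']
      have a1 := swap_le G.base ℓ α hA p i (by omega) (by omega) hi hi'
      have a2 := swap_le G.base ℓ α hA p j (by omega) (by omega) hj hj'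
      have a3 : Equiv.swap p (p + 1) i ≠ Equiv.swap p (p + 1) j :=
        fun h => hij ((Equiv.swap p (p + 1)).injective h)
      have h := cl _ _ a1.1 a1.2 a2.1 a2.2 a3
      rw [Finset.mem_coe, Finset.mem_erase, Finset.mem_filter]
      refine ⟨?_, h.1, ?_⟩
      · intro he
        have := ne_r _ _ a1.1 a1.2 a2.1 a2.2 he
        simp only [Equiv.swap_apply_def] at this
        split_ifs at this <;> omega
      · rw [h.2]
        simp only [Equiv.swap_apply_def]
        split_ifs <;> omega
    · intro β hβ
      rw [Finset.mem_coe, Finset.mem_erase, Finset.mem_filter] at hβ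
      obtain ⟨hβr, hβ, hht⟩ := hβ
      obtain ⟨i, j, hi, hi', hj, hj', hij, rfl⟩ := mem_InP G.base ℓ α hA β hβ
      rw [(cl i j hi hi' hj hj' hij).2] at hht
      rw [refl_EE G.base ℓ α hA p i j (by omega) (by omega) hi hi' hj hj']
      have a1 := swap_le G.base ℓ α hA p i (by omega) (by omega) hi hi'
      have a2 := swap_le G.base ℓ α hA p j (by omega) (by omega) hj hj'
      have a3 : Equiv.swap p (p + 1) i ≠ Equiv.swap p (p + 1) j :=
        fun h => hij ((Equiv.swap p (p + 1)).injective h)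
      have h := cl _ _ a1.1 a1.2 a2.1 a2.2 a3
      rw [Finset.mem_coe, Finset.mem_filter]
      refine ⟨h.1, ?_⟩
      have : ¬ (i = p + 1 ∧ j = p) := by
        rintro ⟨rfl, rfl⟩
        exact hβr rfl
      rw [h.2]
      simp only [Equiv.swap_apply_def]
      split_ifs <;> omega

lemma nonrigid_std (hA : G.base.IsTypeOf ℓ α matA)
    (hl : 2 ≤ ℓ) (θ : V) (hθ : G.base.IsHighest θ) (p : ℕ) (hp1 : p = 1 ∨ p = 2)
    (hp : p + 1 ≤ ℓ) : G.base.NonRigid ((Finset.Icc 1 (p + 1)).image α) θ := by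
  have hth := theta_eq G.base ℓ α hA hl θ hθ
  have e1 := EE_sub ℓ α 1 le_rfl (by omega)
  have e2 := EE_sub ℓ α 2 (by omega) hl
  norm_num at e1 e2
  have hrefl : refl (α 1) (α 2) = EE ℓ α 1 - EE ℓ α 3 := by
    rw [← e2, refl_EE G.base ℓ α hA 1 2 3 (by omega) (by omega) (by omega) (by omega) (by omega)
      (by omega)]
    simp [Equiv.swap_apply_def]
  have m13 := EE_mem G.base ℓ α hA 1 3 (by omega) (by omega) (by omega) (by omega) (by omega)
  have m12 := EE_mem G.base ℓ α hA 1 2 (by omega) (by omega) (by omega) (by omega) (by omega)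
  have mth := EE_mem G.base ℓ α hA 1 (ℓ + 1) (by omega) (by omega) (by omega) (by omega) (by omega)
  have ht13 := ht_std G ℓ α hA p 1 3 hp (by omega) (by omega) m13
  have ht12 := ht_std G ℓ α hA p 1 2 hp (by omega) (by omega) m12
  have htth := ht_std G ℓ α hA p 1 (ℓ + 1) hp (by omega) (by omega) mth
  have hD := Dsig_eq G.base ℓ α hA 1 2 (by omega) (by omega) (by omega) hl (by omega)
  refine ⟨α 1, al_mem0 G.base ℓ α hA 1 (by omega) (by omega), α 2,
    al_mem0 G.base ℓ α hA 2 (by omega) (by omega), ?_, ?_, ?_, ?_⟩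
  · intro h
    have := al_inj G.base ℓ α hA 1 2 (by omega) (by omega) (by omega) hl h
    omega
  · rw [hD, Finset.card_pair]
    rw [hrefl, ← e1]
    intro h
    have := EE_inj G.base ℓ α hA 1 2 1 3 (by omega) (by omega) (by omega) (by omega) (by omega)
      (by omega) (by omega) (by omega) (by omega) h
    omega
  · intro β hβ
    rw [hD, Finset.mem_insert, Finset.mem_singleton] at hβ
    rcases hβ with rfl | rfl
    · rw [← e1, ht12]; omega
    · rw [hrefl, ht13]; omega
  · have q13 : ((p + 2 - 1 : ℕ) : ℤ) - ((p + 2 - 3 : ℕ) : ℤ) = 2 := by omega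
    have qth : ((p + 2 - 1 : ℕ) : ℤ) - ((p + 2 - (ℓ + 1) : ℕ) : ℤ) ≤ 3 := by omega
    rw [hrefl, ht13, q13, hth, htth]
    have c1 := cInt_EE_sub G.base ℓ α hA 1 1 (ℓ + 1) (by omega) (by omega) (by omega) (by omega)
      (by omega) (by omega)
    have c2 := cInt_EE_sub G.base ℓ α hA 2 1 (ℓ + 1) (by omega) (by omega) (by omega) (by omega)
      (by omega) (by omega)
    obtain ⟨X, hX, hX1⟩ : ∃ X : ℤ, cInt (EE ℓ α 1 - EE ℓ α (ℓ + 1)) (α 1) = X ∧ 1 ≤ X :=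
      ⟨_, c1, by split_ifs <;> omega⟩
    obtain ⟨Y, hY, hY1⟩ : ∃ Y : ℤ, cInt (EE ℓ α 1 - EE ℓ α (ℓ + 1)) (α 2) = Y ∧ 0 ≤ Y :=
      ⟨_, c2, by split_ifs <;> omega⟩
    rw [hX, hY]
    generalize ((p + 2 - 1 : ℕ) : ℤ) - ((p + 2 - (ℓ + 1) : ℕ) : ℤ) = T at qth
    have : T ≤ X + (Y + 1) * 2 := by linarith
    exact_mod_cast this

lemma rigid_interior (hA : G.base.IsTypeOf ℓ α matA)
    (hl : 2 ≤ ℓ) (θ : V) (hθ : G.base.IsHighest θ) (m : ℕ) (hm : 1 < m)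
    (hm2 : m + 2 < ℓ) :
    ¬ G.base.NonRigid (({m, m + 1, m + 2} : Finset ℕ).image α) θ := by
  have hS : ({m, m + 1, m + 2} : Finset ℕ) ⊆ Finset.Icc 1 ℓ := by
    intro k hk
    simp only [Finset.mem_insert, Finset.mem_singleton] at hk
    rw [Finset.mem_Icc]
    omega
  have hht : ∀ β, G.base.ht (({m, m + 1, m + 2} : Finset ℕ).image α) β =
      G.base.coeff β (α m) + (G.base.coeff β (α (m + 1)) + G.base.coeff β (α (m + 2))) := by
    intro β
    rw [ht_image G.base ℓ α hA _ hS, Finset.sum_insert (by simp), Finset.sum_insert (by simp),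
      Finset.sum_singleton]
  rintro ⟨a, ha, b, hb, hab, -, hD, hin⟩
  rw [hA.2.1, Finset.mem_image] at ha hb
  obtain ⟨p, hp, rfl⟩ := ha
  obtain ⟨q, hq, rfl⟩ := hb
  rw [Finset.mem_Icc] at hp hq
  have hpq : p ≠ q := fun h => hab (by rw [h])
  have hth := theta_eq G.base ℓ α hA hl θ hθ
  have mth := EE_mem G.base ℓ α hA 1 (ℓ + 1) (by omega) (by omega) (by omega) (by omega) (by omega)
  rw [Dsig_eq G.base ℓ α hA p q hp.1 hp.2 hq.1 hq.2 hpq] at hD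
  have hDp := hD (α p) (by simp)
  rw [hht, coeff_al G.base ℓ α hA p _ hp.1 hp.2 (by omega) (by omega),
    coeff_al G.base ℓ α hA p _ hp.1 hp.2 (by omega) (by omega),
    coeff_al G.base ℓ α hA p _ hp.1 hp.2 (by omega) (by omega)] at hDp
  have hpS : p = m ∨ p = m + 1 ∨ p = m + 2 := by
    split_ifs at hDp <;> omega
  have hth3 : G.base.ht (({m, m + 1, m + 2} : Finset ℕ).image α) θ = 3 := by
    rw [hht, hth, coeff_EE G.base ℓ α hA _ _ mth _ (by omega) (by omega),
      coeff_EE G.base ℓ α hA _ _ mth _ (by omega) (by omega),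
      coeff_EE G.base ℓ α hA _ _ mth _ (by omega) (by omega)]
    split_ifs <;> omega
  have hz : cInt (α q) (α p) = ((if q + 1 = p ∨ p + 1 = q then -1 else 0 : ℤ) : ℝ) := by
    rw [al_cInt G.base ℓ α hA q p hq.1 hq.2 hp.1 hp.2, if_neg hpq.symm]
    push_cast
    rfl
  have hcr := coeff_refl G.base ℓ α hA (α q) (al_mem G.base ℓ α hA q hq.1 hq.2) p hp.1 hp.2 _ hz
  have hr : G.base.ht (({m, m + 1, m + 2} : Finset ℕ).image α) (refl (α p) (α q)) ≤
      (if q = m ∨ q = m + 1 ∨ q = m + 2 then 1 else 0) + 1 := by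
    rw [hht, hcr _ (by omega) (by omega), hcr _ (by omega) (by omega), hcr _ (by omega) (by omega),
      coeff_al G.base ℓ α hA q _ hq.1 hq.2 (by omega) (by omega),
      coeff_al G.base ℓ α hA q _ hq.1 hq.2 (by omega) (by omega),
      coeff_al G.base ℓ α hA q _ hq.1 hq.2 (by omega) (by omega)]
    rcases hpS with rfl | rfl | rfl <;> simp <;> split_ifs <;> omega
  have c1 := cInt_EE_sub G.base ℓ α hA p 1 (ℓ + 1) (by omega) (by omega) (by omega) (by omega)
    (by omega) (by omega)
  have c2 := cInt_EE_sub G.base ℓ α hA q 1 (ℓ + 1) (by omega) (by omega) (by omega) (by omega)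
    (by omega) (by omega)
  rw [← hth] at c1 c2
  obtain ⟨X, hX, hX1⟩ : ∃ X : ℤ, cInt θ (α p) = X ∧ X = 0 :=
    ⟨_, c1, by split_ifs <;> omega⟩
  obtain ⟨Y, hY, hY1⟩ : ∃ Y : ℤ, cInt θ (α q) = Y ∧ (Y = 0 ∨ Y = 1 ∧ (q = 1 ∨ q = ℓ)) :=
    ⟨_, c2, by split_ifs <;> omega⟩
  rw [hth3, hX, hY] at hin
  generalize G.base.ht (({m, m + 1, m + 2} : Finset ℕ).image α) (refl (α p) (α q)) = h at hin hr
  have hin' : 3 ≤ X + (Y + 1) * h := by exact_mod_cast hin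
  rcases hY1 with rfl | ⟨rfl, hq'⟩
  · split_ifs at hr <;> omega
  · rw [if_neg (by omega)] at hr
    omega

end

lemma reverse_type (R : RootSystemBase V) (ℓ : ℕ) (α : ℕ → V) (hA : R.IsTypeOf ℓ α matA) :
    R.IsTypeOf ℓ (fun i => α (ℓ + 1 - i)) matA := by
  refine ⟨?_, ?_, ?_⟩
  · intro i hi j hj h
    have h' := hA.1 (x₁ := ℓ + 1 - i) (x₂ := ℓ + 1 - j)
      ⟨by have := hi.2; omega, by have := hi.1; omega⟩
      ⟨by have := hj.2; omega, by have := hj.1; omega⟩ h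
    have := hi.2
    have := hj.2
    omega
  · rw [hA.2.1]
    ext v
    simp only [Finset.mem_image, Finset.mem_Icc]
    constructor
    · rintro ⟨i, hi, rfl⟩
      exact ⟨ℓ + 1 - i, by omega, by congr 1; omega⟩
    · rintro ⟨i, hi, rfl⟩
      exact ⟨ℓ + 1 - i, by omega, rfl⟩
  · intro i hi j hj
    rw [Finset.mem_Icc] at hi hj
    rw [hA.2.2 _ (Finset.mem_Icc.2 (by omega)) _ (Finset.mem_Icc.2 (by omega))]
    unfold matA
    split_ifs <;> first | rfl | omega

lemma fwd (G : GradedLieData V L) (ℓ : ℕ) (hl : 2 ≤ ℓ) (α : ℕ → V)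
    (hA : G.base.IsTypeOf ℓ α matA) (Sg : Finset V) (hSg : Sg ⊆ G.base.Δ0) (hne : Sg.Nonempty)
    (θ : V) (hθ : G.base.IsHighest θ) (hM : G.Monge Sg) (hN : G.base.NonRigid Sg θ) :
      ((Sg = {α 1, α 2} ∨ Sg = {α ℓ, α (ℓ - 1)}) ∨
       (3 ≤ ℓ ∧ (Sg = {α 1, α 2, α 3} ∨ Sg = {α ℓ, α (ℓ - 1), α (ℓ - 2)}))) := by
  obtain ⟨S, hS, rfl⟩ : ∃ S ⊆ Finset.Icc 1 ℓ, S.image α = Sg := by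
    rw [hA.2.1] at hSg
    obtain ⟨S, h1, h2⟩ := Finset.subset_image_iff.1 hSg
    exact ⟨S, by exact_mod_cast h1, h2⟩
  have hb : ∀ k ∈ S, 1 ≤ k ∧ k ≤ ℓ := fun k hk => Finset.mem_Icc.1 (hS hk)
  obtain ⟨m, ⟨hm, hm'⟩ | hm⟩ := monge_shape G ℓ α hA S hS (Finset.image_nonempty.1 hne) hM
  · left
    rcases hm' with rfl | rfl
    · left
      rw [hm]; simp [Finset.image_insert]
    · right
      rw [hm]
      simp [Finset.image_insert, Finset.pair_comm]
  · right
    have h1 := hb m (by rw [hm]; simp)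
    have h2 := hb (m + 2) (by rw [hm]; simp)
    refine ⟨by omega, ?_⟩
    by_cases q1 : m = 1
    · left
      subst q1
      rw [hm]; simp [Finset.image_insert]
    · by_cases q2 : m + 2 = ℓ
      · right
        subst q2
        rw [hm]
        simp only [Finset.image_insert, Finset.image_singleton, Nat.add_sub_cancel,
          show m + 2 - 1 = m + 1 by omega]
        ext v
        simp only [Finset.mem_insert, Finset.mem_singleton]
        tauto
      · exfalso
        rw [hm] at hN
        exact rigid_interior G ℓ α hA hl θ hθ m (by omega) (by omega) hN

lemma bwd (G : GradedLieData V L) (ℓ : ℕ) (hl : 2 ≤ ℓ) (α : ℕ → V)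
    (hA : G.base.IsTypeOf ℓ α matA) (Sg : Finset V)
    (θ : V) (hθ : G.base.IsHighest θ)
    (h : Sg = {α 1, α 2} ∨ (3 ≤ ℓ ∧ Sg = {α 1, α 2, α 3})) :
    G.Monge Sg ∧ G.base.NonRigid Sg θ := by
  rcases h with rfl | ⟨h3, rfl⟩
  · have : ({α 1, α 2} : Finset V) = (Finset.Icc 1 (1 + 1)).image α := by
      rw [show Finset.Icc 1 (1 + 1) = ({1, 2} : Finset ℕ) from rfl]
      simp [Finset.image_insert]
    rw [this]
    exact ⟨monge_std G ℓ α hA 1 (by omega) (by omega),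
      nonrigid_std G ℓ α hA hl θ hθ 1 (by omega) (by omega)⟩
  · have : ({α 1, α 2, α 3} : Finset V) = (Finset.Icc 1 (2 + 1)).image α := by
      rw [show Finset.Icc 1 (2 + 1) = ({1, 2, 3} : Finset ℕ) from rfl]
      simp [Finset.image_insert]
    rw [this]
    exact ⟨monge_std G ℓ α hA 2 (by omega) (by omega),
      nonrigid_std G ℓ α hA hl θ hθ 2 (by omega) (by omega)⟩

end MongeA

/-- Let `𝔤` be a complex simple Lie algebra of type `Aₗ` (so
`𝔤 ≅ sl(ℓ+1, ℂ)`) with simple roots `α 1, …, α ℓ` in the standard ordering, graded by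
a subset `Σ` of the simple roots.  (a) If `ℓ ≥ 5`, the grading is of Monge type, and
`α₁, α_ℓ ∉ Σ` (`Σ` is interior to the Dynkin diagram), then the grading is rigid.
(b) Up to the order-reversing automorphism of the Dynkin diagram, the non-rigid
gradings of Monge type are exactly `Σ = {α₁, α₂}` (for `ℓ ≥ 2`) and
`Σ = {α₁, α₂, α₃}` (for `ℓ ≥ 3`). -/
theorem statement13 {V : Type*} [NormedAddCommGroup V] [InnerProductSpace ℝ V]
    {L : Type*} [LieRing L] [LieAlgebra ℂ L] [FiniteDimensional ℂ L]
    (G : GradedLieData V L)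
    (ℓ : ℕ) (hl : 2 ≤ ℓ) (α : ℕ → V)
    (hA : G.base.IsTypeOf ℓ α RootSystemBase.matA)
    (Sg : Finset V) (hSg : Sg ⊆ G.base.Δ0) (hne : Sg.Nonempty)
    (θ : V) (hθ : G.base.IsHighest θ) :
    (5 ≤ ℓ → α 1 ∉ Sg → α ℓ ∉ Sg → G.Monge Sg → ¬ G.base.NonRigid Sg θ) ∧
    ((G.Monge Sg ∧ G.base.NonRigid Sg θ) ↔
      ((Sg = {α 1, α 2} ∨ Sg = {α ℓ, α (ℓ - 1)}) ∨
       (3 ≤ ℓ ∧ (Sg = {α 1, α 2, α 3} ∨ Sg = {α ℓ, α (ℓ - 1), α (ℓ - 2)})))) := by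
  have hr := MongeA.reverse_type G.base ℓ α hA
  have F := MongeA.fwd G ℓ hl α hA Sg hSg hne θ hθ
  refine ⟨?_, ?_, ?_⟩
  · intro h5 h1 h2 hM hN
    rcases F hM hN with (h | h) | ⟨-, h | h⟩
    · exact h1 (by rw [h]; simp)
    · exact h2 (by rw [h]; simp)
    · exact h1 (by rw [h]; simp)
    · exact h2 (by rw [h]; simp)
  · exact fun h => F h.1 h.2
  · rintro ((h | h) | ⟨h3, h | h⟩)
    · exact MongeA.bwd G ℓ hl α hA Sg θ hθ (Or.inl h)
    · exact MongeA.bwd G ℓ hl _ hr Sg θ hθ (Or.inl h)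
    · exact MongeA.bwd G ℓ hl α hA Sg θ hθ (Or.inr ⟨h3, h⟩)
    · exact MongeA.bwd G ℓ hl _ hr Sg θ hθ (Or.inr ⟨h3, h⟩)
end

section
/- Let Δ be the root system of type C_ℓ, ℓ ≥ 3, with simple roots α₁, …, α_ℓ in the standard ordering (α_ℓ the long root), and let Σ be a subset of the simple roots such that the grading it determines on sp(2ℓ, ℂ) is of Monge type. (a) If ℓ ≥ 4 and Σ contains 3 simple roots, then the grading is rigid. (b) The non-rigid gradings of Monge type of type C are exactly Σ = {α₁, α₂, α₃} for C₃ and Σ = {α_{ℓ−1}, α_ℓ} for C_ℓ with ℓ ≥ 3. -/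
open scoped RealInnerProductSpace BigOperators Classical

namespace CProof

open RootSystemBase

set_option linter.unusedSectionVars false

variable {V : Type*} [NormedAddCommGroup V] [InnerProductSpace ℝ V]

def fold (ℓ k : ℕ) : ℕ := min k (2 * ℓ - k)

noncomputable def F (α : ℕ → V) (ℓ m : ℕ) : V := ∑ k ∈ Finset.Ico m (2 * ℓ), α (fold ℓ k)

def P (ℓ j m : ℕ) : ℤ :=
  if m = j ∨ m = 2 * ℓ - j then 1 else if m = j + 1 ∨ m = 2 * ℓ + 1 - j then -1 else 0

def pp (ℓ j m : ℕ) : ℕ :=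
  if m = j ∨ m = 2 * ℓ - j then m + 1 else if m = j + 1 ∨ m = 2 * ℓ + 1 - j then m - 1 else m

lemma F_succ (α : ℕ → V) (ℓ m : ℕ) (h : m < 2 * ℓ) :
    F α ℓ m = α (fold ℓ m) + F α ℓ (m + 1) := by
  unfold F
  rw [Finset.sum_eq_sum_Ico_succ_bot h]

lemma fold_mem {ℓ m : ℕ} (h1 : 1 ≤ m) (h : m < 2 * ℓ) : fold ℓ m ∈ Finset.Icc 1 ℓ := by
  simp only [fold, Finset.mem_Icc]; omega

lemma cInt_add (x y a : V) : cInt (x + y) a = cInt x a + cInt y a := by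
  simp only [cInt, inner_add_left]; ring

lemma cInt_sub (x y a : V) : cInt (x - y) a = cInt x a - cInt y a := by
  simp only [cInt, inner_sub_left]; ring

lemma cInt_zero (a : V) : cInt 0 a = 0 := by simp [cInt]

lemma cInt_smul (c : ℝ) (x a : V) : cInt (c • x) a = c * cInt x a := by
  simp only [cInt, real_inner_smul_left]; ring

lemma cInt_self (a : V) (h : a ≠ 0) : cInt a a = 2 := by
  have : ⟪a, a⟫ ≠ 0 := by simpa using h
  simp only [cInt]; field_simp

lemma refl_refl (a x : V) (h : a ≠ 0) : refl a (refl a x) = x := by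
  simp only [RootSystemBase.refl, cInt_sub, cInt_smul, cInt_self a h]
  module

lemma refl_neg (a x : V) : refl a (-x) = - refl a x := by
  have : cInt (-x) a = - cInt x a := by simp only [cInt, inner_neg_left]; ring
  simp only [RootSystemBase.refl, this]; module

section typeC

variable {R : RootSystemBase V} {ℓ : ℕ} {α : ℕ → V} (hl : 3 ≤ ℓ)
  (hC : R.IsTypeOf ℓ α (RootSystemBase.matC ℓ))

lemma matC_fold (hl : 3 ≤ ℓ) {m j : ℕ} (h1 : 1 ≤ m) (h : m < 2 * ℓ) (hj1 : 1 ≤ j) (hj : j ≤ ℓ) :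
    matC ℓ (fold ℓ m) j = P ℓ j m - P ℓ j (m + 1) := by
  unfold matC fold P
  rcases le_total m ℓ with hm | hm
  · rw [min_eq_left (by omega)]
    split_ifs <;> first | (exfalso; omega) | norm_num
  · rw [min_eq_right (by omega)]
    split_ifs <;> first | (exfalso; omega) | norm_num

include hl hC

lemma alpha_mem {j : ℕ} (hj1 : 1 ≤ j) (hj : j ≤ ℓ) : α j ∈ R.Δ0 := by
  rw [hC.2.1]; exact Finset.mem_image_of_mem _ (Finset.mem_Icc.2 ⟨hj1, hj⟩)

lemma alpha_ne {j : ℕ} (hj1 : 1 ≤ j) (hj : j ≤ ℓ) : α j ≠ 0 :=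
  R.ne_zero _ (R.base_sub (alpha_mem hl hC hj1 hj))

lemma cInt_F1 {j : ℕ} (hj1 : 1 ≤ j) (hj : j ≤ ℓ) (d : ℕ) : ∀ a, 1 ≤ a → a + d = 2 * ℓ →
    cInt (F α ℓ a) (α j) = P ℓ j a - P ℓ j (2 * ℓ) := by
  induction d with
  | zero => intro a h1 h; obtain rfl : a = 2 * ℓ := by omega
            simp [F, cInt_zero]
  | succ d ih =>
    intro a h1 h
    rw [F_succ _ _ _ (by omega), cInt_add, ih (a + 1) (by omega) (by omega),
      hC.2.2 _ (fold_mem h1 (by omega)) _ (Finset.mem_Icc.2 ⟨hj1, hj⟩),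
      matC_fold hl h1 (by omega) hj1 hj]
    ring

lemma cInt_F {j a b : ℕ} (hj1 : 1 ≤ j) (hj : j ≤ ℓ) (ha1 : 1 ≤ a) (ha : a ≤ 2 * ℓ)
    (hb1 : 1 ≤ b) (hb : b ≤ 2 * ℓ) :
    cInt (F α ℓ a - F α ℓ b) (α j) = P ℓ j a - P ℓ j b := by
  rw [cInt_sub, cInt_F1 hl hC hj1 hj (2 * ℓ - a) a ha1 (by omega),
    cInt_F1 hl hC hj1 hj (2 * ℓ - b) b hb1 (by omega)]
  ring

omit hC in
lemma F_pp {j a : ℕ} (hj1 : 1 ≤ j) (hj : j ≤ ℓ) (ha1 : 1 ≤ a) (ha : a ≤ 2 * ℓ) :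
    F α ℓ (pp ℓ j a) = F α ℓ a - (P ℓ j a : ℝ) • α j := by
  unfold pp P
  split_ifs with h1 h2
  · rw [F_succ α ℓ a (by omega)]
    have : fold ℓ a = j := by unfold fold; omega
    rw [this]; push_cast; module
  · obtain ⟨a, rfl⟩ : ∃ c, a = c + 1 := ⟨a - 1, by omega⟩
    rw [Nat.add_sub_cancel, F_succ α ℓ a (by omega)]
    have : fold ℓ a = j := by unfold fold; omega
    rw [this]; push_cast; module
  · simp

lemma refl_F {j a b : ℕ} (hj1 : 1 ≤ j) (hj : j ≤ ℓ) (ha1 : 1 ≤ a) (ha : a ≤ 2 * ℓ)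
    (hb1 : 1 ≤ b) (hb : b ≤ 2 * ℓ) :
    refl (α j) (F α ℓ a - F α ℓ b) = F α ℓ (pp ℓ j a) - F α ℓ (pp ℓ j b) := by
  rw [F_pp hl hj1 hj ha1 ha, F_pp hl hj1 hj hb1 hb, RootSystemBase.refl, cInt_F hl hC hj1 hj ha1 ha hb1 hb]
  module

omit hl hC in
lemma alpha_fold (k : ℕ) (hk : k < 2 * ℓ) : F α ℓ k - F α ℓ (k + 1) = α (fold ℓ k) := by
  rw [F_succ α ℓ k hk]; abel

omit hC in
lemma alpha_eq {j : ℕ} (hj : j ≤ ℓ) : α j = F α ℓ j - F α ℓ (j + 1) := by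
  rw [alpha_fold j (by omega)]; congr 1; unfold fold; omega

lemma refl_mem {j : ℕ} (hj1 : 1 ≤ j) (hj : j ≤ ℓ) {β : V} (hβ : β ∈ R.Δ) :
    refl (α j) β ∈ R.Δ :=
  R.reflect_mem _ (R.base_sub (alpha_mem hl hC hj1 hj)) _ hβ

omit hC in
lemma pp_range {j a : ℕ} (hj1 : 1 ≤ j) (hj : j ≤ ℓ) (ha1 : 1 ≤ a) (ha : a ≤ 2 * ℓ) :
    1 ≤ pp ℓ j a ∧ pp ℓ j a ≤ 2 * ℓ := by
  unfold pp; split_ifs <;> omega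

lemma mem_of_pp {j a b : ℕ} (hj1 : 1 ≤ j) (hj : j ≤ ℓ) (ha1 : 1 ≤ a) (ha : a ≤ 2 * ℓ)
    (hb1 : 1 ≤ b) (hb : b ≤ 2 * ℓ) (h : F α ℓ (pp ℓ j a) - F α ℓ (pp ℓ j b) ∈ R.Δ) :
    F α ℓ a - F α ℓ b ∈ R.Δ := by
  rw [← refl_F hl hC hj1 hj ha1 ha hb1 hb] at h
  have := refl_mem hl hC hj1 hj h
  rwa [refl_refl _ _ (alpha_ne hl hC hj1 hj)] at this

lemma F_mem_lt (d : ℕ) : ∀ a b, 1 ≤ a → b ≤ 2 * ℓ → a < b → b - a ≤ d →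
    F α ℓ a - F α ℓ b ∈ R.Δ := by
  induction d with
  | zero => intros; omega
  | succ d ih =>
    intro a b h1 h2 h3 h4
    by_cases hb : b = a + 1
    · subst hb
      rw [alpha_fold a (by omega)]
      have := Finset.mem_Icc.1 (fold_mem (ℓ := ℓ) h1 (by omega))
      exact R.base_sub (alpha_mem hl hC this.1 this.2)
    by_cases hb2 : b = 2 * ℓ - a
    · have := Finset.mem_Icc.1 (fold_mem (ℓ := ℓ) (m := b - 1) (by omega) (by omega))
      apply mem_of_pp hl hC this.1 this.2 h1 (by omega) (by omega) h2
      have e1 : pp ℓ (fold ℓ (b - 1)) a = a := by unfold pp fold; split_ifs <;> omega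
      have e2 : pp ℓ (fold ℓ (b - 1)) b = b - 1 := by unfold pp fold; split_ifs <;> omega
      rw [e1, e2]
      exact ih _ _ (by omega) (by omega) (by omega) (by omega)
    · have := Finset.mem_Icc.1 (fold_mem (ℓ := ℓ) (m := a) (by omega) (by omega))
      apply mem_of_pp hl hC this.1 this.2 h1 (by omega) (by omega) h2
      have e1 : pp ℓ (fold ℓ a) a = a + 1 := by unfold pp fold; split_ifs <;> omega
      have e2 : pp ℓ (fold ℓ a) b ≤ b ∧ b ≤ pp ℓ (fold ℓ a) b + 1 ∧ a + 1 < pp ℓ (fold ℓ a) b := by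
        unfold pp fold; split_ifs <;> omega
      rw [e1]
      exact ih _ _ (by omega) (by omega) (by omega) (by omega)

lemma F_mem {a b : ℕ} (ha1 : 1 ≤ a) (ha : a ≤ 2 * ℓ)
    (hb1 : 1 ≤ b) (hb : b ≤ 2 * ℓ) (hab : a ≠ b) : F α ℓ a - F α ℓ b ∈ R.Δ := by
  rcases lt_or_gt_of_ne hab with h | h
  · exact F_mem_lt hl hC _ _ _ ha1 hb h le_rfl
  · have := R.neg_mem _ (F_mem_lt hl hC _ _ _ hb1 ha h le_rfl)
    rwa [neg_sub] at this

end typeC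

section fun_

lemma exists_fun (R : RootSystemBase V) (c : V → ℝ) :
    ∃ f : V →ₗ[ℝ] ℝ, ∀ a ∈ R.Δ0, f a = c a := by
  obtain ⟨f, hf⟩ := LinearMap.exists_extend
    ((Module.Basis.span R.indep).constr ℝ (fun a : ↥R.Δ0 => c a))
  refine ⟨f, fun a ha => ?_⟩
  have h1 : ((Module.Basis.span R.indep) ⟨a, ha⟩ : V) = a := by
    rw [Module.Basis.span_apply]
  have h2 := LinearMap.congr_fun hf ((Module.Basis.span R.indep) ⟨a, ha⟩)
  rw [Module.Basis.constr_basis] at h2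
  simpa [h1] using h2

noncomputable def hF (R : RootSystemBase V) (Sg : Finset V) : V →ₗ[ℝ] ℝ :=
  (exists_fun R (fun a => if a ∈ Sg then 1 else 0)).choose

lemma hF_simple (R : RootSystemBase V) (Sg : Finset V) {a : V} (ha : a ∈ R.Δ0) :
    hF R Sg a = if a ∈ Sg then 1 else 0 :=
  (exists_fun R (fun a => if a ∈ Sg then 1 else 0)).choose_spec a ha

lemma ht_eq (R : RootSystemBase V) {Sg : Finset V} (h : Sg ⊆ R.Δ0) {β : V} (hβ : β ∈ R.Δ) :
    (R.ht Sg β : ℝ) = hF R Sg β := by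
  conv_rhs => rw [R.coeff_spec β hβ, map_sum]
  rw [ht]; push_cast
  rw [← Finset.sum_subset h (f := fun x => hF R Sg ((R.coeff β x : ℝ) • x))]
  · refine Finset.sum_congr rfl fun x hx => ?_
    simp [hF_simple R Sg (h hx), hx]
  · intro x hx hx'
    simp [hF_simple R Sg hx, hx']

lemma coeff_eq (R : RootSystemBase V) {a : V} (h : a ∈ R.Δ0) {β : V} (hβ : β ∈ R.Δ) :
    (R.coeff β a : ℝ) = hF R {a} β := by
  rw [← ht_eq R (by simpa using h) hβ]; simp [ht]

lemma ht_neg (R : RootSystemBase V) {Sg : Finset V} (h : Sg ⊆ R.Δ0) {β : V} (hβ : β ∈ R.Δ) :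
    R.ht Sg (-β) = - R.ht Sg β := by
  have : (R.ht Sg (-β) : ℝ) = ((- R.ht Sg β : ℤ) : ℝ) := by
    push_cast
    rw [ht_eq R h hβ, ht_eq R h (R.neg_mem _ hβ), map_neg]
  exact_mod_cast this

end fun_

section typeC2

variable {R : RootSystemBase V} {ℓ : ℕ} {α : ℕ → V} (hl : 3 ≤ ℓ)
  (hC : R.IsTypeOf ℓ α (RootSystemBase.matC ℓ))

include hl hC

/-- Every root of total height at most `n` which is positive is of the form `F a - F b`. -/
lemma pos_form (n : ℕ) : ∀ β ∈ R.Δ, (∀ x ∈ R.Δ0, 0 ≤ R.coeff β x) →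
    R.ht R.Δ0 β ≤ n → ∃ a b, 1 ≤ a ∧ a ≤ 2 * ℓ ∧ 1 ≤ b ∧ b ≤ 2 * ℓ ∧ a ≠ b ∧
      β = F α ℓ a - F α ℓ b := by
  induction n with
  | zero =>
    intro β hβ hpos hh
    exfalso
    have h0 : ∀ x ∈ R.Δ0, R.coeff β x = 0 := by
      have : R.ht R.Δ0 β = 0 := le_antisymm (by simpa using hh) (Finset.sum_nonneg hpos)
      exact (Finset.sum_eq_zero_iff_of_nonneg hpos).1 this
    apply R.ne_zero β hβ
    rw [R.coeff_spec β hβ]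
    exact Finset.sum_eq_zero fun x hx => by simp [h0 x hx]
  | succ n ih =>
    intro β hβ hpos hh
    have hβ0 := R.ne_zero β hβ
    -- a simple root pairing positively
    have : ∃ x ∈ R.Δ0, 0 < (R.coeff β x : ℝ) * ⟪x, β⟫ := by
      by_contra hcon
      push Not at hcon
      have h1 : ⟪β, β⟫ = ∑ x ∈ R.Δ0, (R.coeff β x : ℝ) * ⟪x, β⟫ := by
        have h0 : ⟪β, β⟫ = ⟪∑ x ∈ R.Δ0, (R.coeff β x : ℝ) • x, β⟫ :=
          congrArg (fun v => ⟪v, β⟫) (R.coeff_spec β hβ)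
        rw [h0, sum_inner]
        exact Finset.sum_congr rfl fun x _ => by rw [real_inner_smul_left]
      have h2 : 0 < ⟪β, β⟫ := real_inner_self_pos.2 hβ0
      have := Finset.sum_nonpos hcon
      linarith
    obtain ⟨x, hx, hx2⟩ := this
    have hxin : 0 < ⟪β, x⟫ := by
      rw [real_inner_comm]
      have : (0:ℝ) ≤ R.coeff β x := by exact_mod_cast hpos x hx
      exact pos_of_mul_pos_right hx2 this
    have hx' := hx
    rw [hC.2.1] at hx'
    obtain ⟨j, hj, rfl⟩ := Finset.mem_image.1 hx'
    rw [Finset.mem_Icc] at hj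
    have hc : 0 < cInt β (α j) := by
      have : 0 < ⟪α j, α j⟫ := real_inner_self_pos.2 (alpha_ne hl hC hj.1 hj.2)
      unfold cInt; positivity
    have hs := refl_mem hl hC hj.1 hj.2 hβ
    by_cases hother : ∃ y ∈ R.Δ0, y ≠ α j ∧ R.coeff β y ≠ 0
    · -- the reflection is positive
      obtain ⟨y, hy, hyj, hyc⟩ := hother
      have hcy : ∀ z ∈ R.Δ0, z ≠ α j → R.coeff (RootSystemBase.refl (α j) β) z = R.coeff β z := by
        intro z hz hzj
        have : (R.coeff (RootSystemBase.refl (α j) β) z : ℝ) = R.coeff β z := by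
          rw [coeff_eq R hz hs, coeff_eq R hz hβ, RootSystemBase.refl, map_sub, map_smul,
            hF_simple R _ hx]
          simp [hzj.symm]
        exact_mod_cast this
      have hpos' : ∀ z ∈ R.Δ0, 0 ≤ R.coeff (RootSystemBase.refl (α j) β) z := by
        rcases R.coeff_sign _ hs with h | h
        · exact h
        · exfalso
          have h1 := h y hy
          rw [hcy y hy hyj] at h1
          exact hyc (le_antisymm h1 (hpos y hy))
      have hlt : R.ht R.Δ0 (RootSystemBase.refl (α j) β) ≤ n := by
        have : (R.ht R.Δ0 (RootSystemBase.refl (α j) β) : ℝ) < R.ht R.Δ0 β := by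
          rw [ht_eq R subset_rfl hs, ht_eq R subset_rfl hβ, RootSystemBase.refl, map_sub,
            map_smul, hF_simple R _ hx]
          simpa [hx] using hc
        have : R.ht R.Δ0 (RootSystemBase.refl (α j) β) < R.ht R.Δ0 β := by exact_mod_cast this
        push_cast at hh
        omega
      obtain ⟨a, b, h1, h2, h3, h4, h5, h6⟩ := ih _ hs hpos' hlt
      refine ⟨pp ℓ j a, pp ℓ j b, (pp_range hl hj.1 hj.2 h1 h2).1, (pp_range hl hj.1 hj.2 h1 h2).2,
        (pp_range hl hj.1 hj.2 h3 h4).1, (pp_range hl hj.1 hj.2 h3 h4).2, ?_, ?_⟩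
      · unfold pp; split_ifs <;> omega
      · rw [← refl_F hl hC hj.1 hj.2 h1 h2 h3 h4, ← h6, refl_refl _ _ (alpha_ne hl hC hj.1 hj.2)]
    · push Not at hother
      have hb : β = (R.coeff β (α j) : ℝ) • α j := by
        conv_lhs => rw [R.coeff_spec β hβ]
        rw [Finset.sum_eq_single_of_mem _ hx]
        intro y hy hyj
        simp [hother y hy hyj]
      have hsq : 0 < ⟪α j, α j⟫ := real_inner_self_pos.2 (alpha_ne hl hC hj.1 hj.2)
      generalize hcdef : R.coeff β (α j) = c at hb
      have hc0 : 0 < c := by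
        have h1 := hpos _ hx
        rw [hcdef] at h1
        rcases h1.lt_or_eq with h | h
        · exact h
        · rw [← h] at hb; simp at hb; exact absurd hb hβ0
      obtain ⟨k, hk⟩ := R.crystal β hβ (α j) (R.base_sub hx)
      rw [hb, real_inner_smul_right, real_inner_smul_right, real_inner_smul_left] at hk
      have hcr : (0:ℝ) < c := by exact_mod_cast hc0
      have hk2 : (2:ℝ) = k * c := by
        field_simp at hk
        linarith
      have hk3 : (2:ℤ) = k * c := by exact_mod_cast hk2
      have hc2 : c ≤ 2 := Int.le_of_dvd (by norm_num) ⟨k, by rw [hk3]; ring⟩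
      have hc1 : c = 1 := by
        rcases (by omega : c = 1 ∨ c = 2) with h | h
        · exact h
        · exfalso
          apply R.reduced (α j) (R.base_sub hx)
          rw [h] at hb
          push_cast at hb
          rwa [← hb]
      refine ⟨j, j + 1, hj.1, by omega, by omega, by omega, by omega, ?_⟩
      rw [hb, hc1, ← alpha_eq hl hj.2]; simp

lemma root_form {β : V} (hβ : β ∈ R.Δ) : ∃ a b, 1 ≤ a ∧ a ≤ 2 * ℓ ∧ 1 ≤ b ∧ b ≤ 2 * ℓ ∧ a ≠ b ∧
      β = F α ℓ a - F α ℓ b := by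
  rcases R.coeff_sign β hβ with h | h
  · exact pos_form hl hC (R.ht R.Δ0 β).toNat β hβ h (Int.self_le_toNat _)
  · have hn := R.neg_mem _ hβ
    obtain ⟨a, b, h1, h2, h3, h4, h5, h6⟩ :=
      pos_form hl hC (R.ht R.Δ0 (-β)).toNat (-β) hn (by
        intro x hx
        have : R.coeff (-β) x = - R.coeff β x := by
          have h3 := ht_neg R (Sg := {x}) (by simpa using hx) hβ
          simpa [ht] using h3
        rw [this]; have := h x hx; omega) (Int.self_le_toNat _)
    exact ⟨b, a, h3, h4, h1, h2, h5.symm, by rw [← neg_sub, ← h6, neg_neg]⟩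

lemma hF_succ (Sg : Finset V) {m : ℕ} (h1 : 1 ≤ m) (h : m < 2 * ℓ) :
    hF R Sg (F α ℓ m) = (if α (fold ℓ m) ∈ Sg then 1 else 0) + hF R Sg (F α ℓ (m + 1)) := by
  have := Finset.mem_Icc.1 (fold_mem h1 h)
  rw [F_succ α ℓ m h, map_add, hF_simple R Sg (alpha_mem hl hC this.1 this.2)]

lemma ht_F {Sg : Finset V} (hSg : Sg ⊆ R.Δ0) (N : ℕ → ℤ)
    (hN : ∀ m, 1 ≤ m → m < 2 * ℓ → N m = (if α (fold ℓ m) ∈ Sg then 1 else 0) + N (m + 1))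
    {a b : ℕ} (ha1 : 1 ≤ a) (ha : a ≤ 2 * ℓ) (hb1 : 1 ≤ b) (hb : b ≤ 2 * ℓ) (hab : a ≠ b) :
    R.ht Sg (F α ℓ a - F α ℓ b) = N a - N b := by
  have key : ∀ d, ∀ a, 1 ≤ a → a + d = 2 * ℓ → hF R Sg (F α ℓ a) = N a - N (2 * ℓ) := by
    intro d
    induction d with
    | zero => intro a h1 h; obtain rfl : a = 2 * ℓ := by omega
              simp [F]
    | succ d ih =>
      intro a h1 h
      rw [hF_succ hl hC Sg h1 (by omega), ih (a + 1) (by omega) (by omega), hN a h1 (by omega)]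
      push_cast
      ring
  have : (R.ht Sg (F α ℓ a - F α ℓ b) : ℝ) = ((N a - N b : ℤ) : ℝ) := by
    rw [ht_eq R hSg (F_mem hl hC ha1 ha hb1 hb hab), map_sub, key (2 * ℓ - a) a ha1 (by omega),
      key (2 * ℓ - b) b hb1 (by omega)]
    push_cast; ring
  exact_mod_cast this

lemma ht_F_card {Sg : Finset V} (hSg : Sg ⊆ R.Δ0)
    {a b : ℕ} (ha1 : 1 ≤ a) (hb : b ≤ 2 * ℓ) (hab : a < b) :
    R.ht Sg (F α ℓ a - F α ℓ b) = ∑ k ∈ Finset.Ico a b, if α (fold ℓ k) ∈ Sg then 1 else 0 := by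
  rw [ht_F hl hC hSg
    (fun m => ∑ k ∈ Finset.Ico m (2 * ℓ), if α (fold ℓ k) ∈ Sg then 1 else 0) _ ha1 (by omega)
      (by omega) hb (by omega)]
  · rw [← Finset.sum_Ico_consecutive _ hab.le hb]; ring
  · intro m _ h
    rw [Finset.sum_eq_sum_Ico_succ_bot h]

lemma isPos_F {a b : ℕ} (ha1 : 1 ≤ a) (hb : b ≤ 2 * ℓ) (hab : a < b) :
    R.IsPos (F α ℓ a - F α ℓ b) := by
  refine ⟨F_mem hl hC ha1 (by omega) (by omega) hb (by omega), fun x hx => ?_⟩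
  have := ht_F_card hl hC (Sg := {x}) (by simpa using hx) ha1 hb hab
  simp only [ht, Finset.sum_singleton] at this
  rw [this]
  exact Finset.sum_nonneg fun k _ => by split_ifs <;> norm_num

lemma ht_tot {a b : ℕ} (ha1 : 1 ≤ a) (ha : a ≤ 2 * ℓ) (hb1 : 1 ≤ b) (hb : b ≤ 2 * ℓ)
    (hab : a ≠ b) : R.ht R.Δ0 (F α ℓ a - F α ℓ b) = (b : ℤ) - a := by
  rw [ht_F hl hC subset_rfl (fun m => (2 * ℓ : ℤ) - m) _ ha1 ha hb1 hb hab]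
  · simp
  · intro m h1 h
    have := Finset.mem_Icc.1 (fold_mem h1 h)
    rw [if_pos (alpha_mem hl hC this.1 this.2)]; push_cast; ring

lemma isPos_iff {a b : ℕ} (ha1 : 1 ≤ a) (ha : a ≤ 2 * ℓ) (hb1 : 1 ≤ b) (hb : b ≤ 2 * ℓ)
    (hab : a ≠ b) : R.IsPos (F α ℓ a - F α ℓ b) ↔ a < b := by
  constructor
  · intro h
    have h1 : 0 ≤ R.ht R.Δ0 (F α ℓ a - F α ℓ b) := Finset.sum_nonneg h.2
    rw [ht_tot hl hC ha1 ha hb1 hb hab] at h1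
    omega
  · exact isPos_F hl hC ha1 hb

lemma isNeg_iff {a b : ℕ} (ha1 : 1 ≤ a) (ha : a ≤ 2 * ℓ) (hb1 : 1 ≤ b) (hb : b ≤ 2 * ℓ)
    (hab : a ≠ b) : R.IsNeg (F α ℓ a - F α ℓ b) ↔ b < a := by
  constructor
  · intro h
    have h1 : R.ht R.Δ0 (F α ℓ a - F α ℓ b) ≤ 0 := Finset.sum_nonpos h.2
    rw [ht_tot hl hC ha1 ha hb1 hb hab] at h1
    omega
  · intro h
    refine ⟨F_mem hl hC ha1 ha hb1 hb hab, fun x hx => ?_⟩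
    have h1 := (isPos_F hl hC hb1 ha h).2 x hx
    have h2 := ht_neg R (Sg := {x}) (by simpa using hx) (F_mem hl hC hb1 hb ha1 ha hab.symm)
    simp only [ht, Finset.sum_singleton, neg_sub] at h2
    omega

lemma theta_eq {θ : V} (hθ : R.IsHighest θ) : θ = F α ℓ 1 - F α ℓ (2 * ℓ) := by
  obtain ⟨a, b, h1, h2, h3, h4, h5, rfl⟩ := root_form hl hC hθ.1
  have : R.ht R.Δ0 (F α ℓ 1 - F α ℓ (2 * ℓ)) ≤ R.ht R.Δ0 (F α ℓ a - F α ℓ b) :=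
    Finset.sum_le_sum fun x hx => hθ.2 _
      (F_mem hl hC le_rfl (by omega) (by omega) le_rfl (by omega)) x hx
  rw [ht_tot hl hC h1 h2 h3 h4 h5,
    ht_tot hl hC le_rfl (by omega) (by omega) le_rfl (by omega)] at this
  push_cast at this
  obtain rfl : a = 1 := by omega
  obtain rfl : b = 2 * ℓ := by omega
  rfl

/-- coordinates -/
def X (ℓ i m : ℕ) : ℤ := (if m = i then 1 else 0) - (if m + i = 2 * ℓ + 1 then 1 else 0)

lemma X_eq {a b c d : ℕ} (ha1 : 1 ≤ a) (ha : a ≤ 2 * ℓ) (hb1 : 1 ≤ b) (hb : b ≤ 2 * ℓ)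
    (hc1 : 1 ≤ c) (hc : c ≤ 2 * ℓ) (hd1 : 1 ≤ d) (hd : d ≤ 2 * ℓ)
    (h : F α ℓ a - F α ℓ b = F α ℓ c - F α ℓ d) {i : ℕ} (hi1 : 1 ≤ i) (hi : i ≤ 2 * ℓ) :
    X ℓ i a - X ℓ i b = X ℓ i c - X ℓ i d := by
  obtain ⟨f, hf⟩ := exists_fun R
    (fun v => ∑ j ∈ Finset.Icc 1 ℓ, if v = α j then ((X ℓ i j - X ℓ i (j + 1) : ℤ) : ℝ) else 0)
  have hfa : ∀ j, 1 ≤ j → j ≤ ℓ → f (α j) = X ℓ i j - X ℓ i (j + 1) := by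
    intro j h1 h2
    rw [hf _ (alpha_mem hl hC h1 h2), Finset.sum_eq_single_of_mem j (Finset.mem_Icc.2 ⟨h1, h2⟩)]
    · simp
    · intro k hk hkj
      rw [if_neg]
      intro e
      exact hkj (hC.1 (Finset.mem_Icc.1 hk) ⟨h1, h2⟩ e.symm)
  have key : ∀ d, ∀ a, 1 ≤ a → a + d = 2 * ℓ → f (F α ℓ a) = X ℓ i a - X ℓ i (2 * ℓ) := by
    intro d
    induction d with
    | zero => intro a h1 h; obtain rfl : a = 2 * ℓ := by omega
              simp [F]
    | succ d ih =>
      intro a h1 h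
      have hm := Finset.mem_Icc.1 (fold_mem (ℓ := ℓ) h1 (by omega))
      rw [F_succ α ℓ a (by omega), map_add, ih (a + 1) (by omega) (by omega), hfa _ hm.1 hm.2]
      have : X ℓ i (fold ℓ a) - X ℓ i (fold ℓ a + 1) = X ℓ i a - X ℓ i (a + 1) := by
        unfold X fold
        rcases le_total a ℓ with h | h
        · rw [min_eq_left (by omega)]
        · rw [min_eq_right (by omega)]
          split_ifs <;> omega
      have : (X ℓ i (fold ℓ a) - X ℓ i (fold ℓ a + 1) : ℝ) = X ℓ i a - X ℓ i (a + 1) := by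
        exact_mod_cast this
      linarith
  have h2 := congrArg f h
  rw [map_sub, map_sub, key (2 * ℓ - a) a ha1 (by omega), key (2 * ℓ - b) b hb1 (by omega),
    key (2 * ℓ - c) c hc1 (by omega), key (2 * ℓ - d) d hd1 (by omega)] at h2
  have : (X ℓ i a - X ℓ i b : ℝ) = X ℓ i c - X ℓ i d := by linarith
  exact_mod_cast this

lemma F_inj {a b c d : ℕ} (ha1 : 1 ≤ a) (hb : b ≤ 2 * ℓ) (hab : a < b)
    (hc1 : 1 ≤ c) (hd : d ≤ 2 * ℓ) (hcd : c < d)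
    (h : F α ℓ a - F α ℓ b = F α ℓ c - F α ℓ d) :
    (a = c ∧ b = d) ∨ (a + d = 2 * ℓ + 1 ∧ b + c = 2 * ℓ + 1) := by
  have h1 := X_eq hl hC ha1 (by omega) (by omega) hb hc1 (by omega) (by omega) hd h
    (i := a) ha1 (by omega)
  have h2 := X_eq hl hC ha1 (by omega) (by omega) hb hc1 (by omega) (by omega) hd h
    (i := b) (by omega) hb
  unfold X at h1 h2
  rw [if_pos rfl, if_neg (show ¬ a + a = 2 * ℓ + 1 by omega), if_neg (show ¬ b = a by omega)] at h1
  rw [if_pos rfl, if_neg (show ¬ b + b = 2 * ℓ + 1 by omega), if_neg (show ¬ a = b by omega)] at h2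
  by_cases k1 : c = a
  · by_cases k2 : d = b
    · omega
    · rw [if_neg k2] at h2
      split_ifs at h2 <;> omega
  · rw [if_neg k1] at h1
    by_cases k3 : d + a = 2 * ℓ + 1
    · by_cases k4 : c + b = 2 * ℓ + 1
      · omega
      · rw [if_neg k4] at h2
        split_ifs at h2 <;> omega
    · rw [if_neg k3] at h1
      split_ifs at h1 <;> omega

omit hC in
/-- duality -/
lemma F_dual_succ (m : ℕ) (h1 : 1 ≤ m) (h : m < 2 * ℓ) :
    F α ℓ m - F α ℓ (m + 1) = F α ℓ (2 * ℓ - m) - F α ℓ (2 * ℓ + 1 - m) := by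
  rw [show 2 * ℓ + 1 - m = 2 * ℓ - m + 1 by omega, alpha_fold m h, alpha_fold _ (by omega)]
  congr 1; unfold fold; omega

omit hC in
lemma F_dual (d : ℕ) : ∀ a b, 1 ≤ a → b ≤ 2 * ℓ → a + d = b →
    F α ℓ a - F α ℓ b = F α ℓ (2 * ℓ + 1 - b) - F α ℓ (2 * ℓ + 1 - a) := by
  induction d with
  | zero => intro a b h1 h2 h3; obtain rfl : a = b := by omega
            simp
  | succ d ih =>
    intro a b h1 h2 h3
    have e1 := ih (a + 1) b (by omega) h2 (by omega)
    have e2 := F_dual_succ (α := α) hl a h1 (by omega)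
    rw [show 2 * ℓ + 1 - (a + 1) = 2 * ℓ - a by omega] at e1
    have : F α ℓ a - F α ℓ b = (F α ℓ a - F α ℓ (a+1)) + (F α ℓ (a+1) - F α ℓ b) := by abel
    rw [this, e1, e2]; abel

end typeC2

section lie

variable {L : Type*} [LieRing L] [LieAlgebra ℂ L] [FiniteDimensional ℂ L]
  (G : GradedLieData V L)

lemma finrank_iSup (S : Finset V) (hS : S ⊆ G.base.Δ) :
    Module.finrank ℂ ↥(⨆ β ∈ S, G.rs β) = S.card := by
  induction S using Finset.induction_on with
  | empty => simp
  | insert β S hβ ih =>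
    rw [Finset.iSup_insert, Finset.card_insert_of_notMem hβ]
    have hβΔ : β ∈ G.base.Δ := hS (Finset.mem_insert_self _ _)
    have hSΔ : S ⊆ G.base.Δ := fun x hx => hS (Finset.mem_insert_of_mem hx)
    have hd : Disjoint (G.rs β) (⨆ γ ∈ S, G.rs γ) := by
      refine (G.rs_indep β hβΔ).mono_right (le_trans ?_ le_sup_right)
      refine iSup₂_le fun γ hγ => ?_
      exact le_iSup₂_of_le γ (Finset.mem_erase.2 ⟨fun e => hβ (e ▸ hγ), hSΔ hγ⟩) le_rfl
    have := Submodule.finrank_sup_add_finrank_inf_eq (G.rs β) (⨆ γ ∈ S, G.rs γ)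
    rw [hd.eq_bot, finrank_bot, G.rs_dim β hβΔ, ih hSΔ] at this
    omega

lemma g_eq (Sg : Finset V) {j : ℤ} (hj : j ≠ 0) :
    G.g Sg j = ⨆ β ∈ G.base.Δ.filter (fun β => G.base.ht Sg β = j), G.rs β := by
  rw [GradedLieData.g, if_neg hj]

lemma exists_rv {β : V} (hβ : β ∈ G.base.Δ) : ∃ e ∈ G.rs β, e ≠ 0 ∧ ∀ x ∈ G.rs β, ∃ c : ℂ, x = c • e := by
  obtain ⟨⟨e, he⟩, h0, h1⟩ := finrank_eq_one_iff'.1 (G.rs_dim β hβ)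
  refine ⟨e, he, fun h => h0 (by simpa using h), fun x hx => ?_⟩
  obtain ⟨c, hc⟩ := h1 ⟨x, hx⟩
  exact ⟨c, by simpa using congrArg Subtype.val hc.symm⟩

/-- a Monge grading has the star property -/
lemma star_of_monge {Sg : Finset V} (hSg : Sg ⊆ G.base.Δ0) (hM : G.Monge Sg) :
    ∃ β, ∀ γ ∈ G.base.Δ, ∀ δ ∈ G.base.Δ, G.base.ht Sg γ = 1 → G.base.ht Sg δ = 1 →
      γ ≠ β → δ ≠ β → γ + δ ∉ G.base.Δ := by
  obtain ⟨Y, hY, hY0, hab, hdim, -⟩ := hM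
  have hYlt : ¬ G.g Sg (-1) ≤ Y := by
    intro h
    have := Submodule.finrank_mono h
    omega
  rw [g_eq G Sg (by norm_num)] at hYlt hY hdim
  set A := G.base.Δ.filter (fun β => G.base.ht Sg β = -1) with hA
  have : ∃ β ∈ A, ¬ G.rs β ≤ Y := by
    by_contra hcon
    push Not at hcon
    exact hYlt (iSup₂_le hcon)
  obtain ⟨β, hβA, hβY⟩ := this
  have hβΔ : β ∈ G.base.Δ := (Finset.mem_filter.1 hβA).1
  have hβh := (Finset.mem_filter.1 hβA).2
  obtain ⟨e, he, he0, hespan⟩ := exists_rv G hβΔ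
  have heY : e ∉ Y := by
    intro h
    apply hβY
    intro x hx
    obtain ⟨c, rfl⟩ := hespan x hx
    exact Y.smul_mem c h
  have hsup : Y ⊔ Submodule.span ℂ {e} = ⨆ β ∈ A, G.rs β := by
    apply Submodule.eq_of_le_of_finrank_le
    · refine sup_le hY ?_
      rw [Submodule.span_singleton_le_iff_mem]
      exact (le_iSup₂_of_le (f := fun β (_ : β ∈ A) => G.rs β) β hβA le_rfl) he
    · rw [← hdim]
      have h1 : Y < Y ⊔ Submodule.span ℂ {e} := by
        refine lt_of_le_of_ne le_sup_left fun h => heY ?_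
        rw [h]
        exact (le_sup_right : Submodule.span ℂ {e} ≤ _) (Submodule.mem_span_singleton_self e)
      exact Submodule.finrank_lt_finrank_of_lt h1
  have hdec : ∀ x, x ∈ (⨆ β ∈ A, G.rs β) → ∃ c : ℂ, x - c • e ∈ Y := by
    intro x hx
    rw [← hsup] at hx
    obtain ⟨y, hy, z, hz, rfl⟩ := Submodule.mem_sup.1 hx
    obtain ⟨c, rfl⟩ := Submodule.mem_span_singleton.1 hz
    exact ⟨c, by simpa using hy⟩
  have hrs : ∀ γ ∈ A, ∀ δ ∈ A, ∀ x ∈ G.rs γ, ∀ y ∈ G.rs δ, ⁅x, y⁆ ∈ G.rs (γ + δ) := by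
    intro γ hγ δ hδ x hx y hy
    rw [hA, Finset.mem_filter] at hγ hδ
    by_cases hr : γ + δ ∈ G.base.Δ
    · exact G.br_rs_mem γ hγ.1 δ hδ.1 hr x hx y hy
    · rw [G.br_rs_zero γ hγ.1 δ hδ.1 hr _ x hx y hy]
      · exact Submodule.zero_mem _
      · intro h0
        have : γ = -δ := eq_neg_of_add_eq_zero_left h0
        have h2 := ht_neg G.base hSg hδ.1
        rw [← this] at h2
        omega
  refine ⟨-β, fun γ' hγ' δ' hδ' hγh hδh hγβ hδβ hsum => ?_⟩
  obtain ⟨γ, rfl⟩ : ∃ γ, γ' = -γ := ⟨-γ', by simp⟩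
  obtain ⟨δ, rfl⟩ : ∃ γ, δ' = -γ := ⟨-δ', by simp⟩
  have hγΔ : γ ∈ G.base.Δ := by simpa using G.base.neg_mem _ hγ'
  have hδΔ : δ ∈ G.base.Δ := by simpa using G.base.neg_mem _ hδ'
  have hγβ : γ ≠ β := fun h => hγβ (by rw [h])
  have hδβ : δ ≠ β := fun h => hδβ (by rw [h])
  have hsum : γ + δ ∈ G.base.Δ := by
    have := G.base.neg_mem _ hsum
    rwa [neg_add, neg_neg, neg_neg] at this
  rw [ht_neg _ hSg hγΔ] at hγh
  rw [ht_neg _ hSg hδΔ] at hδh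
  have hγA : γ ∈ A := Finset.mem_filter.2 ⟨hγΔ, by omega⟩
  have hδA : δ ∈ A := Finset.mem_filter.2 ⟨hδΔ, by omega⟩
  have hγδ : γ ≠ δ := by
    rintro rfl
    apply G.base.reduced γ hγΔ
    rwa [two_smul]
  obtain ⟨x, hx, hx0, -⟩ := exists_rv G hγΔ
  obtain ⟨y, hy, hy0, -⟩ := exists_rv G hδΔ
  obtain ⟨c, hc⟩ := hdec x ((le_iSup₂_of_le (f := fun β (_ : β ∈ A) => G.rs β) γ hγA le_rfl) hx)
  obtain ⟨d, hd⟩ := hdec y ((le_iSup₂_of_le (f := fun β (_ : β ∈ A) => G.rs β) δ hδA le_rfl) hy)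
  have hbr := hab _ hc _ hd
  have hbr2 : ⁅x, y⁆ = d • ⁅x, e⁆ + c • ⁅e, y⁆ := by
    simp only [sub_lie, lie_sub, lie_smul, smul_lie, lie_self, smul_zero, sub_zero] at hbr
    have h3 := sub_eq_zero.1 (by rw [← hbr]; abel : ⁅x, y⁆ - (d • ⁅x, e⁆ + c • ⁅e, y⁆) = 0)
    exact h3
  have hmem : ∀ η, η ≠ γ + δ → G.rs η ≤ G.H ⊔ ⨆ ν ∈ G.base.Δ.erase (γ + δ), G.rs ν := by
    intro η hη
    by_cases hηΔ : η ∈ G.base.Δ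
    · exact le_trans (le_iSup₂_of_le (f := fun ν (_ : ν ∈ G.base.Δ.erase (γ + δ)) => G.rs ν) η
        (Finset.mem_erase.2 ⟨hη, hηΔ⟩) le_rfl) le_sup_right
    · rw [G.rs_bot η hηΔ]; exact bot_le
  have h1 : ⁅x, y⁆ ∈ G.H ⊔ ⨆ ν ∈ G.base.Δ.erase (γ + δ), G.rs ν := by
    rw [hbr2]
    refine Submodule.add_mem _ (Submodule.smul_mem _ _ ?_) (Submodule.smul_mem _ _ ?_)
    · exact hmem (γ + β) (fun h => hδβ (add_left_cancel h).symm) (hrs γ hγA β hβA x hx e he)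
    · exact hmem (β + δ) (fun h => hγβ (add_right_cancel h).symm) (hrs β hβA δ hδA e he y hy)
  have h2 := Submodule.disjoint_def.1 (G.rs_indep _ hsum) _ (hrs γ hγA δ hδA x hx y hy) h1
  rcases G.br_nondeg γ hγΔ δ hδΔ hsum x hx y hy h2 with h | h
  · exact hx0 h
  · exact hy0 h

lemma exists_ht2_of_monge {Sg : Finset V} (hM : G.Monge Sg) :
    ∃ β ∈ G.base.Δ, G.base.ht Sg β = -2 := by
  obtain ⟨Y, hY, hY0, hab, hdim, h2⟩ := hM
  by_contra hcon
  push Not at hcon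
  have : G.base.Δ.filter (fun β => G.base.ht Sg β = -2) = ∅ := by
    rw [Finset.filter_eq_empty_iff]; exact fun x hx => hcon x hx
  rw [g_eq G Sg (by norm_num), finrank_iSup G _ (Finset.filter_subset _ _), this,
    Finset.card_empty] at h2
  exact hY0 (Submodule.finrank_eq_zero.1 h2.symm)

/-- sufficient condition for Monge type -/
lemma monge_of {Sg : Finset V} (hSg : Sg ⊆ G.base.Δ0) (β : V) (hβ : β ∈ G.base.Δ0) (hβS : β ∈ Sg)
    (h0 : ∃ γ ∈ G.base.Δ, G.base.ht Sg γ = 1 ∧ γ ≠ β)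
    (h1 : ∀ γ ∈ G.base.Δ, G.base.ht Sg γ = 1 → γ ≠ β →
      G.base.ht {β} γ = 0 ∧ γ + β ∈ G.base.Δ)
    (h2 : ∀ γ ∈ G.base.Δ, G.base.ht Sg γ = 2 →
      G.base.ht {β} γ = 1 ∧ γ - β ∈ G.base.Δ) : G.Monge Sg := by
  have hβΔ := G.base.base_sub hβ
  have hS1 : ({β} : Finset V) ⊆ G.base.Δ0 := by simpa using hβ
  have hadd : ∀ T ⊆ G.base.Δ0, ∀ γ ∈ G.base.Δ, ∀ δ ∈ G.base.Δ, γ + δ ∈ G.base.Δ →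
      G.base.ht T (γ + δ) = G.base.ht T γ + G.base.ht T δ := by
    intro T hT γ hγ δ hδ h
    have : (G.base.ht T (γ + δ) : ℝ) = ((G.base.ht T γ + G.base.ht T δ : ℤ) : ℝ) := by
      push_cast
      rw [ht_eq _ hT h, ht_eq _ hT hγ, ht_eq _ hT hδ, map_add]
    exact_mod_cast this
  have hβ1 : G.base.ht Sg β = 1 := by
    have := ht_eq G.base hSg hβΔ
    rw [hF_simple _ _ hβ, if_pos hβS] at this
    exact_mod_cast this
  have hβ11 : G.base.ht {β} β = 1 := by
    have := ht_eq G.base hS1 hβΔ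
    rw [hF_simple _ _ hβ, if_pos (Finset.mem_singleton_self _)] at this
    exact_mod_cast this
  set A := G.base.Δ.filter (fun β => G.base.ht Sg β = -1) with hA
  set B := G.base.Δ.filter (fun β => G.base.ht Sg β = -2) with hB
  have hnA : -β ∈ A := Finset.mem_filter.2
    ⟨G.base.neg_mem _ hβΔ, by rw [ht_neg _ hSg hβΔ, hβ1]⟩
  have hC : ∀ γ ∈ A.erase (-β), -γ ∈ G.base.Δ ∧ G.base.ht Sg (-γ) = 1 ∧ -γ ≠ β := by
    intro γ hγ
    rw [Finset.mem_erase, hA, Finset.mem_filter] at hγ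
    refine ⟨G.base.neg_mem _ hγ.2.1, by rw [ht_neg _ hSg hγ.2.1, hγ.2.2]; rfl, fun h => hγ.1 ?_⟩
    rw [← h, neg_neg]
  have hsubA : A.erase (-β) ⊆ G.base.Δ := fun x hx =>
    (Finset.mem_filter.1 (Finset.mem_of_mem_erase hx)).1
  have hcardB : B.card = (A.erase (-β)).card := by
    symm
    apply Finset.card_bij (fun γ _ => γ - β)
    · intro γ hγ
      obtain ⟨k1, k2, k3⟩ := hC γ hγ
      have hs := (h1 _ k1 k2 k3).2
      have e : γ - β = -(-γ + β) := by abel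
      rw [hB, Finset.mem_filter, e, ht_neg _ hSg hs, hadd Sg hSg _ k1 _ hβΔ hs, k2, hβ1]
      exact ⟨G.base.neg_mem _ hs, rfl⟩
    · intro x _ y _ h
      exact sub_left_injective h
    · intro δ hδ
      rw [hB, Finset.mem_filter] at hδ
      have k1 := G.base.neg_mem _ hδ.1
      have k2 : G.base.ht Sg (-δ) = 2 := by rw [ht_neg _ hSg hδ.1, hδ.2]; rfl
      obtain ⟨k3, k4⟩ := h2 _ k1 k2
      have k5 := G.base.neg_mem _ k4
      have e : -(-δ - β) = δ + β := by abel
      refine ⟨δ + β, ?_, by abel⟩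
      have hht := hadd Sg hSg _ k4 β hβΔ (by simpa using k1)
      rw [sub_add_cancel, k2, hβ1] at hht
      rw [Finset.mem_erase, hA, Finset.mem_filter]
      refine ⟨?_, by rw [← e]; exact k5, by rw [← e, ht_neg _ hSg k4]; omega⟩
      intro h
      have e2 : -δ = (2:ℝ) • β := by
        have : δ = -β - β := by rw [← h]; abel
        rw [this]; module
      rw [e2] at k1
      exact G.base.reduced _ hβΔ k1
  refine ⟨⨆ γ ∈ A.erase (-β), G.rs γ, ?_, ?_, ?_, ?_, ?_⟩
  · rw [g_eq G Sg (by norm_num), ← hA]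
    exact iSup₂_le fun γ hγ => le_iSup₂_of_le (f := fun β (_ : β ∈ A) => G.rs β) γ
      (Finset.mem_of_mem_erase hγ) le_rfl
  · intro hbot
    have := finrank_iSup G _ hsubA
    rw [hbot, finrank_bot] at this
    obtain ⟨γ, hγ, k1, k2⟩ := h0
    have hmem : -γ ∈ A.erase (-β) := by
      rw [Finset.mem_erase, hA, Finset.mem_filter]
      exact ⟨fun h => k2 (neg_injective h), G.base.neg_mem _ hγ, by rw [ht_neg _ hSg hγ, k1]⟩
    rw [Finset.card_eq_zero.1 this.symm] at hmem
    simp at hmem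
  · have hgen : ∀ γ ∈ A.erase (-β), ∀ δ ∈ A.erase (-β), ∀ x ∈ G.rs γ, ∀ y ∈ G.rs δ,
        ⁅x, y⁆ = 0 := by
      intro γ hγ δ hδ x hx y hy
      obtain ⟨k1, k2, k3⟩ := hC γ hγ
      obtain ⟨m1, m2, m3⟩ := hC δ hδ
      apply G.br_rs_zero γ (hsubA hγ) δ (hsubA hδ) _ _ x hx y hy
      · intro hs
        have hs' : -γ + -δ ∈ G.base.Δ := by
          have := G.base.neg_mem _ hs
          rwa [neg_add] at this
        have e1 := hadd Sg hSg _ k1 _ m1 hs'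
        rw [k2, m2] at e1
        have e2 := (h2 _ hs' e1).1
        rw [hadd _ hS1 _ k1 _ m1 hs', (h1 _ k1 k2 k3).1, (h1 _ m1 m2 m3).1] at e2
        norm_num at e2
      · intro h
        have : δ = -γ := eq_neg_of_add_eq_zero_right h
        rw [this, ht_neg _ hSg k1, k2] at m2
        norm_num at m2
    intro a ha b hb
    have step : ∀ γ ∈ A.erase (-β), ∀ x ∈ G.rs γ, ∀ b ∈ (⨆ γ ∈ A.erase (-β), G.rs γ),
        ⁅x, b⁆ = 0 := by
      intro γ hγ x hx b hb
      have : (⨆ γ ∈ A.erase (-β), G.rs γ) ≤ LinearMap.ker (LieAlgebra.ad ℂ L x : L →ₗ[ℂ] L) :=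
        iSup₂_le fun δ hδ y hy => by
          rw [LinearMap.mem_ker, LieAlgebra.ad_apply]; exact hgen γ hγ δ hδ x hx y hy
      have := this hb
      rwa [LinearMap.mem_ker, LieAlgebra.ad_apply] at this
    have : (⨆ γ ∈ A.erase (-β), G.rs γ) ≤ LinearMap.ker (LieAlgebra.ad ℂ L b : L →ₗ[ℂ] L) :=
      iSup₂_le fun δ hδ y hy => by
        rw [LinearMap.mem_ker, LieAlgebra.ad_apply, ← lie_skew, step δ hδ y hy b hb, neg_zero]
    have := this ha
    rw [LinearMap.mem_ker, LieAlgebra.ad_apply] at this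
    rw [← lie_skew, this, neg_zero]
  · rw [g_eq G Sg (by norm_num), ← hA, finrank_iSup G _ hsubA,
      finrank_iSup G _ (Finset.filter_subset _ _), Finset.card_erase_add_one hnA]
  · rw [g_eq G Sg (by norm_num), ← hB, finrank_iSup G _ hsubA,
      finrank_iSup G _ (Finset.filter_subset _ _), hcardB]

end lie

section comb

variable {R : RootSystemBase V} {ℓ : ℕ} {α : ℕ → V} (hl : 3 ≤ ℓ)
  (hC : R.IsTypeOf ℓ α (RootSystemBase.matC ℓ))

lemma exists_max_nat (D : ℕ → Prop) (n : ℕ) (h : ∃ i, 1 ≤ i ∧ i ≤ n ∧ D i) :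
    ∃ i, 1 ≤ i ∧ i ≤ n ∧ D i ∧ ∀ k, i < k → k ≤ n → ¬ D k := by
  induction n with
  | zero => obtain ⟨i, h1, h2, _⟩ := h; omega
  | succ n ih =>
    by_cases hn : D (n + 1)
    · exact ⟨n + 1, by omega, le_rfl, hn, fun k h1 h2 => by omega⟩
    · obtain ⟨i, h1, h2, h3⟩ := h
      have : i ≠ n + 1 := fun e => hn (e ▸ h3)
      obtain ⟨j, k1, k2, k3, k4⟩ := ih ⟨i, h1, by omega, h3⟩
      refine ⟨j, k1, by omega, k3, fun k m1 m2 => ?_⟩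
      by_cases e : k = n + 1
      · rwa [e]
      · exact k4 k m1 (by omega)

/-- star property -/
def Star (R : RootSystemBase V) (Sg : Finset V) : Prop :=
  ∃ β, ∀ γ ∈ R.Δ, ∀ δ ∈ R.Δ, R.ht Sg γ = 1 → R.ht Sg δ = 1 →
      γ ≠ β → δ ≠ β → γ + δ ∉ R.Δ

include hl hC

lemma ht_one {Sg : Finset V} (hSg : Sg ⊆ R.Δ0) {a b : ℕ} (i : ℕ) (ha1 : 1 ≤ a) (hb : b ≤ 2 * ℓ)
    (hi1 : a ≤ i) (hi : i < b) (hiS : α (fold ℓ i) ∈ Sg)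
    (hk : ∀ k, a ≤ k → k < b → k ≠ i → α (fold ℓ k) ∉ Sg) :
    R.ht Sg (F α ℓ a - F α ℓ b) = 1 := by
  rw [ht_F_card hl hC hSg ha1 hb (by omega),
    Finset.sum_eq_single_of_mem i (Finset.mem_Ico.2 ⟨hi1, hi⟩), if_pos hiS]
  intro k hk1 hk2
  rw [Finset.mem_Ico] at hk1
  rw [if_neg (hk k hk1.1 hk1.2 hk2)]

lemma edge {Sg : Finset V} {β : V} (hs : ∀ γ ∈ R.Δ, ∀ δ ∈ R.Δ, R.ht Sg γ = 1 → R.ht Sg δ = 1 →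
      γ ≠ β → δ ≠ β → γ + δ ∉ R.Δ) {a b c : ℕ} (ha : 1 ≤ a) (hab : a < b) (hbc : b < c)
      (hc : c ≤ 2 * ℓ) (h1 : R.ht Sg (F α ℓ a - F α ℓ b) = 1)
      (h2 : R.ht Sg (F α ℓ b - F α ℓ c) = 1) :
    F α ℓ a - F α ℓ b = β ∨ F α ℓ b - F α ℓ c = β := by
  by_contra hcon
  push Not at hcon
  apply hs _ (F_mem hl hC ha (by omega) (by omega) (by omega) hab.ne) _
    (F_mem hl hC (by omega) (by omega) (by omega) hc hbc.ne) h1 h2 hcon.1 hcon.2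
  rw [sub_add_sub_cancel]
  exact F_mem hl hC ha (by omega) (by omega) (by omega) (by omega)

lemma two_edges {Sg : Finset V} (hs : Star R Sg) {a b c a' b' c' : ℕ}
    (ha : 1 ≤ a) (hab : a < b) (hbc : b < c) (hc : c ≤ 2 * ℓ)
    (ha' : 1 ≤ a') (hab' : a' < b') (hbc' : b' < c') (hc' : c' ≤ 2 * ℓ)
    (h1 : R.ht Sg (F α ℓ a - F α ℓ b) = 1) (h2 : R.ht Sg (F α ℓ b - F α ℓ c) = 1)
    (h1' : R.ht Sg (F α ℓ a' - F α ℓ b') = 1) (h2' : R.ht Sg (F α ℓ b' - F α ℓ c') = 1)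
    (n1 : ¬ ((a = a' ∧ b = b') ∨ (a + b' = 2 * ℓ + 1 ∧ b + a' = 2 * ℓ + 1)))
    (n2 : ¬ ((a = b' ∧ b = c') ∨ (a + c' = 2 * ℓ + 1 ∧ b + b' = 2 * ℓ + 1)))
    (n3 : ¬ ((b = a' ∧ c = b') ∨ (b + b' = 2 * ℓ + 1 ∧ c + a' = 2 * ℓ + 1)))
    (n4 : ¬ ((b = b' ∧ c = c') ∨ (b + c' = 2 * ℓ + 1 ∧ c + b' = 2 * ℓ + 1))) : False := by
  obtain ⟨β, hs⟩ := hs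
  rcases edge hl hC hs ha hab hbc hc h1 h2 with e | e <;>
  rcases edge hl hC hs ha' hab' hbc' hc' h1' h2' with e' | e'
  · exact n1 (F_inj hl hC ha (by omega) hab ha' (by omega) hab' (e.trans e'.symm))
  · exact n2 (F_inj hl hC ha (by omega) hab (by omega) (by omega) hbc' (e.trans e'.symm))
  · exact n3 (F_inj hl hC (by omega) (by omega) hbc ha' (by omega) hab' (e.trans e'.symm))
  · exact n4 (F_inj hl hC (by omega) (by omega) hbc (by omega) (by omega) hbc' (e.trans e'.symm))

lemma classify {Sg : Finset V} (hSg : Sg ⊆ R.Δ0) (hne : Sg.Nonempty) (hs : Star R Sg)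
    (h2 : ∃ β ∈ R.Δ, R.ht Sg β = -2) :
    ∃ r, 1 ≤ r ∧ r ≤ 2 ∧ ∀ k, 1 ≤ k → k ≤ ℓ → (α k ∈ Sg ↔ ℓ - r ≤ k) := by
  by_cases hL : α ℓ ∈ Sg
  · by_cases hex : ∃ i, 1 ≤ i ∧ i ≤ ℓ - 1 ∧ α i ∈ Sg
    · obtain ⟨i, i1, i2, i3, i4⟩ := exists_max_nat (fun k => α k ∈ Sg) _ hex
      have hi : i = ℓ - 1 := by
        by_contra hi
        refine two_edges hl hC hs (a := i) (b := i + 1) (c := 2 * ℓ - i) (a' := i) (b' := i + 2)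
          (c' := 2 * ℓ - 1 - i) (by omega) (by omega) (by omega) (by omega) (by omega) (by omega)
          (by omega) (by omega) ?_ ?_ ?_ ?_ (by omega) (by omega) (by omega) (by omega)
        · refine ht_one hl hC hSg i (by omega) (by omega) (by omega) (by omega) ?_ ?_
          · rwa [show fold ℓ i = i by unfold fold; omega]
          · intro k k1 k2 k3; omega
        · refine ht_one hl hC hSg ℓ (by omega) (by omega) (by omega) (by omega) ?_ ?_
          · rwa [show fold ℓ ℓ = ℓ by unfold fold; omega]
          · intro k k1 k2 k3; exact i4 _ (by unfold fold; omega) (by unfold fold; omega)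
        · refine ht_one hl hC hSg i (by omega) (by omega) (by omega) (by omega) ?_ ?_
          · rwa [show fold ℓ i = i by unfold fold; omega]
          · intro k k1 k2 k3; exact i4 _ (by unfold fold; omega) (by unfold fold; omega)
        · refine ht_one hl hC hSg ℓ (by omega) (by omega) (by omega) (by omega) ?_ ?_
          · rwa [show fold ℓ ℓ = ℓ by unfold fold; omega]
          · intro k k1 k2 k3; exact i4 _ (by unfold fold; omega) (by unfold fold; omega)
      subst hi
      have i3 : α (ℓ - 1) ∈ Sg := i3
      by_cases hex2 : ∃ i, 1 ≤ i ∧ i ≤ ℓ - 2 ∧ α i ∈ Sg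
      · obtain ⟨j, j1, j2, j3, j4⟩ := exists_max_nat (fun k => α k ∈ Sg) _ hex2
        have h1 : R.ht Sg (F α ℓ (ℓ - 1) - F α ℓ ℓ) = 1 := by
          refine ht_one hl hC hSg (ℓ - 1) (by omega) (by omega) (by omega) (by omega) ?_ ?_
          · rwa [show fold ℓ (ℓ - 1) = ℓ - 1 by unfold fold; omega]
          · intro k k1 k2 k3; omega
        have h3 : R.ht Sg (F α ℓ ℓ - F α ℓ (ℓ + 1)) = 1 := by
          refine ht_one hl hC hSg ℓ (by omega) (by omega) (by omega) (by omega) ?_ ?_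
          · rwa [show fold ℓ ℓ = ℓ by unfold fold; omega]
          · intro k k1 k2 k3; omega
        have hj : j = ℓ - 2 := by
          by_contra hj
          refine two_edges hl hC hs (a := j) (b := ℓ - 1) (c := ℓ) (a' := ℓ - 2) (b' := ℓ)
            (c' := ℓ + 1) (by omega) (by omega) (by omega) (by omega) (by omega) (by omega)
            (by omega) (by omega) ?_ h1 ?_ h3 (by omega) (by omega) (by omega) (by omega)
          · refine ht_one hl hC hSg j (by omega) (by omega) (by omega) (by omega) ?_ ?_
            · rwa [show fold ℓ j = j by unfold fold; omega]
            · intro k k1 k2 k3; exact j4 _ (by unfold fold; omega) (by unfold fold; omega)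
          · refine ht_one hl hC hSg (ℓ - 1) (by omega) (by omega) (by omega) (by omega) ?_ ?_
            · rwa [show fold ℓ (ℓ - 1) = ℓ - 1 by unfold fold; omega]
            · intro k k1 k2 k3; exact j4 _ (by unfold fold; omega) (by unfold fold; omega)
        subst hj
        have j3 : α (ℓ - 2) ∈ Sg := j3
        refine ⟨2, by norm_num, le_rfl, fun k k1 k2 => ⟨fun hk => ?_, fun hk => ?_⟩⟩
        · by_contra hlt
          obtain ⟨f, f1, f2, f3, f4⟩ := exists_max_nat (fun k => α k ∈ Sg) (ℓ - 3)
            ⟨k, k1, by omega, hk⟩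
          refine two_edges hl hC hs (a := f) (b := ℓ - 2) (c := ℓ - 1) (a' := ℓ - 1) (b' := ℓ)
            (c' := ℓ + 1) (by omega) (by omega) (by omega) (by omega) (by omega) (by omega)
            (by omega) (by omega) ?_ ?_ h1 h3 (by omega) (by omega) (by omega) (by omega)
          · refine ht_one hl hC hSg f (by omega) (by omega) (by omega) (by omega) ?_ ?_
            · rwa [show fold ℓ f = f by unfold fold; omega]
            · intro k k1 k2 k3; exact f4 _ (by unfold fold; omega) (by unfold fold; omega)
          · refine ht_one hl hC hSg (ℓ - 2) (by omega) (by omega) (by omega) (by omega) ?_ ?_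
            · rwa [show fold ℓ (ℓ - 2) = ℓ - 2 by unfold fold; omega]
            · intro k k1 k2 k3; omega
        · rcases (by omega : k = ℓ ∨ k = ℓ - 1 ∨ k = ℓ - 2) with h | h | h <;> rwa [h]
      · push Not at hex2
        refine ⟨1, le_rfl, by norm_num, fun k k1 k2 => ⟨fun hk => ?_, fun hk => ?_⟩⟩
        · by_contra hlt
          exact hex2 k k1 (by omega) hk
        · rcases (by omega : k = ℓ ∨ k = ℓ - 1) with h | h <;> rwa [h]
    · exfalso
      push Not at hex
      obtain ⟨β, hβ, hβ2⟩ := h2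
      obtain ⟨a, b, a1, a2, b1, b2, hab, rfl⟩ := root_form hl hC hβ
      rw [ht_F hl hC hSg (fun m => if m ≤ ℓ then 1 else 0) _ a1 a2 b1 b2 hab] at hβ2
      · split_ifs at hβ2 <;> omega
      · intro m m1 m2
        by_cases hm : m = ℓ
        · subst hm
          rw [show fold m m = m by unfold fold; omega, if_pos hL, if_pos le_rfl, if_neg (by omega)]
          rfl
        · rw [if_neg (hex (fold ℓ m) (by unfold fold; omega) (by unfold fold; omega))]
          split_ifs <;> omega
  · exfalso
    have hex : ∃ i, 1 ≤ i ∧ i ≤ ℓ ∧ α i ∈ Sg := by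
      obtain ⟨x, hx⟩ := hne
      have := hSg hx
      rw [hC.2.1] at this
      obtain ⟨i, hi, rfl⟩ := Finset.mem_image.1 this
      rw [Finset.mem_Icc] at hi
      exact ⟨i, hi.1, hi.2, hx⟩
    obtain ⟨i, i1, i2, i3, i4⟩ := exists_max_nat (fun k => α k ∈ Sg) _ hex
    have hil : i ≠ ℓ := fun e => hL (e ▸ i3)
    have i3 : α i ∈ Sg := i3
    by_cases hi : i = ℓ - 1
    · have h1 : R.ht Sg (F α ℓ (ℓ - 1) - F α ℓ ℓ) = 1 := by
        refine ht_one hl hC hSg (ℓ - 1) (by omega) (by omega) (by omega) (by omega) ?_ ?_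
        · rwa [show fold ℓ (ℓ - 1) = i by unfold fold; omega]
        · intro k k1 k2 k3; omega
      have h3 : R.ht Sg (F α ℓ ℓ - F α ℓ (ℓ + 2)) = 1 := by
        refine ht_one hl hC hSg (ℓ + 1) (by omega) (by omega) (by omega) (by omega) ?_ ?_
        · rwa [show fold ℓ (ℓ + 1) = i by unfold fold; omega]
        · intro k k1 k2 k3; exact i4 _ (by unfold fold; omega) (by unfold fold; omega)
      by_cases h4 : α (ℓ - 2) ∈ Sg
      · obtain ⟨β, hs⟩ := hs
        have h5 : R.ht Sg (F α ℓ (ℓ - 2) - F α ℓ (ℓ - 1)) = 1 := by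
          refine ht_one hl hC hSg (ℓ - 2) (by omega) (by omega) (by omega) (by omega) ?_ ?_
          · rwa [show fold ℓ (ℓ - 2) = ℓ - 2 by unfold fold; omega]
          · intro k k1 k2 k3; omega
        have h6 : R.ht Sg (F α ℓ (ℓ - 1) - F α ℓ (ℓ + 1)) = 1 := by
          refine ht_one hl hC hSg (ℓ - 1) (by omega) (by omega) (by omega) (by omega) ?_ ?_
          · rwa [show fold ℓ (ℓ - 1) = i by unfold fold; omega]
          · intro k k1 k2 k3; exact i4 _ (by unfold fold; omega) (by unfold fold; omega)
        have hd : F α ℓ ℓ - F α ℓ (ℓ + 2) = F α ℓ (ℓ - 1) - F α ℓ (ℓ + 1) := by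
          have := F_dual (α := α) hl 2 ℓ (ℓ + 2) (by omega) (by omega) rfl
          rwa [show 2 * ℓ + 1 - (ℓ + 2) = ℓ - 1 by omega,
            show 2 * ℓ + 1 - ℓ = ℓ + 1 by omega] at this
        have e1 := edge hl hC hs (a := ℓ - 2) (b := ℓ - 1) (c := ℓ) (by omega) (by omega)
          (by omega) (by omega) h5 h1
        have e2 := edge hl hC hs (a := ℓ - 2) (b := ℓ - 1) (c := ℓ + 1) (by omega) (by omega)
          (by omega) (by omega) h5 h6
        have e3 := edge hl hC hs (a := ℓ - 1) (b := ℓ) (c := ℓ + 2) (by omega) (by omega)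
          (by omega) (by omega) h1 h3
        rw [hd] at e3
        have n12 : F α ℓ (ℓ - 2) - F α ℓ (ℓ - 1) ≠ F α ℓ (ℓ - 1) - F α ℓ ℓ := fun e => by
          have := F_inj hl hC (by omega) (by omega) (by omega) (by omega) (by omega) (by omega) e
          omega
        have n13 : F α ℓ (ℓ - 2) - F α ℓ (ℓ - 1) ≠ F α ℓ (ℓ - 1) - F α ℓ (ℓ + 1) := fun e => by
          have := F_inj hl hC (by omega) (by omega) (by omega) (by omega) (by omega) (by omega) e
          omega
        have n23 : F α ℓ (ℓ - 1) - F α ℓ ℓ ≠ F α ℓ (ℓ - 1) - F α ℓ (ℓ + 1) := fun e => by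
          have := F_inj hl hC (by omega) (by omega) (by omega) (by omega) (by omega) (by omega) e
          omega
        rcases e1 with e1 | e1
        · rcases e3 with e3 | e3
          · exact n12 (e1.trans e3.symm)
          · exact n13 (e1.trans e3.symm)
        · rcases e2 with e2 | e2
          · exact n12 (e2.trans e1.symm)
          · exact n23 (e1.trans e2.symm)
      · refine two_edges hl hC hs (a := ℓ - 1) (b := ℓ) (c := ℓ + 2) (a' := ℓ - 2) (b' := ℓ)
          (c' := ℓ + 3) (by omega) (by omega) (by omega) (by omega) (by omega) (by omega)
          (by omega) (by omega) h1 h3 ?_ ?_ (by omega) (by omega) (by omega) (by omega)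
        · refine ht_one hl hC hSg (ℓ - 1) (by omega) (by omega) (by omega) (by omega) ?_ ?_
          · rwa [show fold ℓ (ℓ - 1) = i by unfold fold; omega]
          · intro k k1 k2 k3
            rwa [show fold ℓ k = ℓ - 2 by unfold fold; omega]
        · refine ht_one hl hC hSg (ℓ + 1) (by omega) (by omega) (by omega) (by omega) ?_ ?_
          · rwa [show fold ℓ (ℓ + 1) = i by unfold fold; omega]
          · intro k k1 k2 k3
            by_cases hk : k = ℓ
            · rwa [show fold ℓ k = ℓ by unfold fold; omega]
            · rwa [show fold ℓ k = ℓ - 2 by unfold fold; omega]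
    · refine two_edges hl hC hs (a := i) (b := i + 1) (c := 2 * ℓ + 1 - i) (a' := i) (b' := i + 2)
        (c' := 2 * ℓ + 1 - i) (by omega) (by omega) (by omega) (by omega) (by omega) (by omega)
        (by omega) (by omega) ?_ ?_ ?_ ?_ (by omega) (by omega) (by omega) (by omega)
      · refine ht_one hl hC hSg i (by omega) (by omega) (by omega) (by omega) ?_ ?_
        · rwa [show fold ℓ i = i by unfold fold; omega]
        · intro k k1 k2 k3; omega
      · refine ht_one hl hC hSg (2 * ℓ - i) (by omega) (by omega) (by omega) (by omega) ?_ ?_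
        · rwa [show fold ℓ (2 * ℓ - i) = i by unfold fold; omega]
        · intro k k1 k2 k3; exact i4 _ (by unfold fold; omega) (by unfold fold; omega)
      · refine ht_one hl hC hSg i (by omega) (by omega) (by omega) (by omega) ?_ ?_
        · rwa [show fold ℓ i = i by unfold fold; omega]
        · intro k k1 k2 k3; exact i4 _ (by unfold fold; omega) (by unfold fold; omega)
      · refine ht_one hl hC hSg (2 * ℓ - i) (by omega) (by omega) (by omega) (by omega) ?_ ?_
        · rwa [show fold ℓ (2 * ℓ - i) = i by unfold fold; omega]
        · intro k k1 k2 k3; exact i4 _ (by unfold fold; omega) (by unfold fold; omega)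

end comb

section final

variable {R : RootSystemBase V} {ℓ : ℕ} {α : ℕ → V} (hl : 3 ≤ ℓ)
  (hC : R.IsTypeOf ℓ α (RootSystemBase.matC ℓ))

include hl hC

lemma ht_r {Sg : Finset V} (hSg : Sg ⊆ R.Δ0) {r : ℕ} (hr2 : r ≤ 2)
    (hD : ∀ k, 1 ≤ k → k ≤ ℓ → (α k ∈ Sg ↔ ℓ - r ≤ k))
    {a b : ℕ} (ha1 : 1 ≤ a) (ha : a ≤ 2 * ℓ) (hb1 : 1 ≤ b) (hb : b ≤ 2 * ℓ) (hab : a ≠ b) :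
    R.ht Sg (F α ℓ a - F α ℓ b) =
      max (0 : ℤ) (min (2 * (r : ℤ) + 1) ((ℓ : ℤ) + r + 1 - a)) -
      max (0 : ℤ) (min (2 * (r : ℤ) + 1) ((ℓ : ℤ) + r + 1 - b)) := by
  rw [ht_F hl hC hSg (fun m => max (0 : ℤ) (min (2 * (r : ℤ) + 1) ((ℓ : ℤ) + r + 1 - m)))
     _ ha1 ha hb1 hb hab]
  intro m m1 m2
  have := Finset.mem_Icc.1 (fold_mem m1 m2)
  simp only [hD (fold ℓ m) this.1 this.2]
  push_cast
  unfold fold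
  split_ifs <;> omega

lemma ht_theta {Sg : Finset V} (hSg : Sg ⊆ R.Δ0) {r : ℕ} (hr2 : r ≤ 2)
    (hD : ∀ k, 1 ≤ k → k ≤ ℓ → (α k ∈ Sg ↔ ℓ - r ≤ k)) :
    R.ht Sg (F α ℓ 1 - F α ℓ (2 * ℓ)) = 2 * r + 1 := by
  rw [ht_r hl hC hSg hr2 hD le_rfl (by omega) (by omega) le_rfl (by omega)]
  push_cast
  omega

lemma cInt_theta {i : ℕ} (hi1 : 1 ≤ i) (hi : i ≤ ℓ) :
    cInt (F α ℓ 1 - F α ℓ (2 * ℓ)) (α i) = if i = 1 then 2 else 0 := by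
  rw [cInt_F hl hC hi1 hi le_rfl (by omega) (by omega) le_rfl]
  have : P ℓ i 1 - P ℓ i (2 * ℓ) = if i = 1 then 2 else 0 := by
    unfold P; split_ifs <;> omega
  rw [← Int.cast_sub, this]; split_ifs <;> simp

lemma ht_refl {Sg : Finset V} (hSg : Sg ⊆ R.Δ0) {i j : ℕ} (hi1 : 1 ≤ i) (hi : i ≤ ℓ)
    (hj1 : 1 ≤ j) (hj : j ≤ ℓ) :
    (R.ht Sg (RootSystemBase.refl (α i) (α j)) : ℝ) =
      (if α j ∈ Sg then 1 else 0) - matC ℓ j i * (if α i ∈ Sg then 1 else 0) := by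
  rw [ht_eq R hSg (refl_mem hl hC hi1 hi (R.base_sub (alpha_mem hl hC hj1 hj))),
    RootSystemBase.refl, map_sub, map_smul, hF_simple R _ (alpha_mem hl hC hi1 hi),
    hF_simple R _ (alpha_mem hl hC hj1 hj),
    hC.2.2 j (Finset.mem_Icc.2 ⟨hj1, hj⟩) i (Finset.mem_Icc.2 ⟨hi1, hi⟩), smul_eq_mul]

omit hC in
lemma pp_flip {i p q : ℕ} (hi1 : 1 ≤ i) (hi : i ≤ ℓ) (hp : 1 ≤ p) (hq : q ≤ 2 * ℓ)
    (hpq : p < q) (h : pp ℓ i q < pp ℓ i p) : F α ℓ p - F α ℓ q = α i := by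
  have : q = p + 1 ∧ (p = i ∨ p = 2 * ℓ - i) := by
    unfold pp at h
    split_ifs at h <;> omega
  rw [this.1, alpha_fold p (by omega)]
  congr 1; unfold fold; omega

omit hC in
lemma pp_ne {i p q : ℕ} (hi1 : 1 ≤ i) (hi : i ≤ ℓ) (hpq : p ≠ q) : pp ℓ i p ≠ pp ℓ i q := by
  unfold pp; split_ifs <;> omega

lemma mem_Dsig {i j p q : ℕ} (hi1 : 1 ≤ i) (hi : i ≤ ℓ) (hj1 : 1 ≤ j) (hj : j ≤ ℓ)
    (hp1 : 1 ≤ p) (hp : p ≤ 2 * ℓ) (hq1 : 1 ≤ q) (hq : q ≤ 2 * ℓ) (hpq : p ≠ q) :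
    F α ℓ p - F α ℓ q ∈ R.Dsig (α i) (α j) ↔ p < q ∧ pp ℓ j (pp ℓ i q) < pp ℓ j (pp ℓ i p) := by
  have rp := pp_range hl hi1 hi hp1 hp
  have rq := pp_range hl hi1 hi hq1 hq
  have rp2 := pp_range hl hj1 hj rp.1 rp.2
  have rq2 := pp_range hl hj1 hj rq.1 rq.2
  have n1 := pp_ne hl hi1 hi hpq
  have n2 := pp_ne hl hj1 hj n1
  unfold Dsig
  rw [Finset.mem_filter, refl_F hl hC hi1 hi hp1 hp hq1 hq,
    refl_F hl hC hj1 hj rp.1 rp.2 rq.1 rq.2, isPos_iff hl hC hp1 hp hq1 hq hpq,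
    isNeg_iff hl hC rp2.1 rp2.2 rq2.1 rq2.2 n2]
  exact ⟨fun h => h.2, fun h => ⟨F_mem hl hC hp1 hp hq1 hq hpq, h⟩⟩

lemma alpha_mem_Dsig {i j : ℕ} (hi1 : 1 ≤ i) (hi : i ≤ ℓ) (hj1 : 1 ≤ j) (hj : j ≤ ℓ)
    (hij : i ≠ j) : α i ∈ R.Dsig (α i) (α j) := by
  have e1 : pp ℓ i i = i + 1 := by unfold pp; split_ifs <;> omega
  have e2 : pp ℓ i (i + 1) = i := by unfold pp; split_ifs <;> omega
  have h := (mem_Dsig (p := i) (q := i + 1) hl hC hi1 hi hj1 hj hi1 (by omega) (by omega)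
    (by omega) (by omega)).2 (by
      rw [e1, e2]
      refine ⟨by omega, ?_⟩
      unfold pp; split_ifs <;> omega)
  rwa [← alpha_eq (α := α) hl hi] at h

lemma Dsig_eq {i j : ℕ} (hi1 : 1 ≤ i) (hi : i ≤ ℓ) (hj1 : 1 ≤ j) (hj : j ≤ ℓ)
    (hij : i ≠ j) :
    R.Dsig (α i) (α j) = {α i, RootSystemBase.refl (α i) (α j)} := by
  ext β
  rw [Finset.mem_insert, Finset.mem_singleton]
  constructor
  · intro h
    obtain ⟨p, q, hp1, hp, hq1, hq, hpq, rfl⟩ := root_form hl hC (Finset.mem_filter.1 h).1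
    rw [mem_Dsig hl hC hi1 hi hj1 hj hp1 hp hq1 hq hpq] at h
    have rp := pp_range hl hi1 hi hp1 hp
    have rq := pp_range hl hi1 hi hq1 hq
    by_cases h1 : pp ℓ i q < pp ℓ i p
    · exact Or.inl (pp_flip hl hi1 hi hp1 hq h.1 h1)
    · right
      have h2 := pp_flip (α := α) hl hj1 hj rp.1 rq.2
        (lt_of_le_of_ne (by omega) (pp_ne hl hi1 hi hpq)) h.2
      rw [← h2, ← refl_F hl hC hi1 hi hp1 hp hq1 hq, refl_refl _ _ (alpha_ne hl hC hi1 hi)]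
  · rintro (rfl | rfl)
    · exact alpha_mem_Dsig hl hC hi1 hi hj1 hj hij
    · have rp := pp_range hl hi1 hi hj1 (show j ≤ 2 * ℓ by omega)
      have rq := pp_range hl hi1 hi (show 1 ≤ j + 1 by omega) (show j + 1 ≤ 2 * ℓ by omega)
      have e : RootSystemBase.refl (α i) (α j) = F α ℓ (pp ℓ i j) - F α ℓ (pp ℓ i (j + 1)) := by
        rw [← refl_F hl hC hi1 hi hj1 (by omega) (by omega) (by omega), ← alpha_eq hl hj]
      rw [e, mem_Dsig hl hC hi1 hi hj1 hj rp.1 rp.2 rq.1 rq.2 (pp_ne hl hi1 hi (by omega))]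
      have inv : ∀ m, pp ℓ i (pp ℓ i m) = m := by
        intro m; unfold pp; split_ifs <;> omega
      rw [inv, inv]
      constructor
      · unfold pp; split_ifs <;> omega
      · unfold pp; split_ifs <;> omega

lemma Dsig_card {i j : ℕ} (hi1 : 1 ≤ i) (hi : i ≤ ℓ) (hj1 : 1 ≤ j) (hj : j ≤ ℓ)
    (hij : i ≠ j) : (R.Dsig (α i) (α j)).card = 2 := by
  rw [Dsig_eq hl hC hi1 hi hj1 hj hij]
  apply Finset.card_pair
  intro e
  have hne : α i ≠ α j := fun h => hij (hC.1 ⟨hi1, hi⟩ ⟨hj1, hj⟩ h)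
  have h := congrArg (hF R {α j}) e
  rw [RootSystemBase.refl, map_sub, map_smul, hF_simple R _ (alpha_mem hl hC hi1 hi),
    hF_simple R _ (alpha_mem hl hC hj1 hj)] at h
  simp [hne] at h

lemma nonRigid_of {Sg : Finset V} (hSg : Sg ⊆ R.Δ0) {r : ℕ} (hr1 : 1 ≤ r) (hr2 : r ≤ 2)
    (hD : ∀ k, 1 ≤ k → k ≤ ℓ → (α k ∈ Sg ↔ ℓ - r ≤ k)) (hrl : r = 1 ∨ ℓ = 3)
    {θ : V} (hθ : R.IsHighest θ) : R.NonRigid Sg θ := by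
  rw [theta_eq hl hC hθ]
  have main : ∀ i j, 1 ≤ i → i ≤ ℓ → 1 ≤ j → j ≤ ℓ → i ≠ j → α i ∈ Sg →
      ((2 * r + 1 : ℤ) : ℝ) ≤ (if i = 1 then 2 else 0) + ((if j = 1 then 2 else 0) + 1) *
        ((if α j ∈ Sg then 1 else 0) - matC ℓ j i) →
      0 < (if α j ∈ Sg then 1 else 0) - matC ℓ j i →
      R.NonRigid Sg (F α ℓ 1 - F α ℓ (2 * ℓ)) := by
    intro i j hi1 hi hj1 hj hij hiS hle hpos
    have hh := ht_refl hl hC hSg hi1 hi hj1 hj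
    rw [if_pos hiS, mul_one] at hh
    refine ⟨α i, alpha_mem hl hC hi1 hi, α j, alpha_mem hl hC hj1 hj,
      fun h => hij (hC.1 ⟨hi1, hi⟩ ⟨hj1, hj⟩ h), Dsig_card hl hC hi1 hi hj1 hj hij, ?_, ?_⟩
    · intro β hβ
      rw [Dsig_eq hl hC hi1 hi hj1 hj hij, Finset.mem_insert, Finset.mem_singleton] at hβ
      have : (0:ℝ) < R.ht Sg β := by
        rcases hβ with rfl | rfl
        · rw [ht_eq R hSg (R.base_sub (alpha_mem hl hC hi1 hi)),
            hF_simple R _ (alpha_mem hl hC hi1 hi), if_pos hiS]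
          norm_num
        · rw [hh]; exact hpos
      exact_mod_cast this
    · rw [ht_theta hl hC hSg hr2 hD, cInt_theta hl hC hi1 hi, cInt_theta hl hC hj1 hj, hh]
      exact hle
  rcases (by omega : r = 1 ∨ (r = 2 ∧ ℓ = 3)) with rfl | ⟨rfl, rfl⟩
  · have hm : matC ℓ ℓ (ℓ - 1) = -2 := by
      unfold matC; rw [if_neg (by omega), if_neg (by omega), if_pos (by omega), if_pos rfl]
    apply main (ℓ - 1) ℓ (by omega) (by omega) (by omega) le_rfl (by omega)
    · rw [hD _ (by omega) (by omega)]
    · rw [hm, if_pos ((hD ℓ (by omega) le_rfl).2 (by omega)), if_neg (by omega), if_neg (by omega)]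
      norm_num
    · rw [hm, if_pos ((hD ℓ (by omega) le_rfl).2 (by omega))]
      norm_num
  · have hm : matC 3 1 2 = -1 := by
      unfold matC; norm_num
    apply main 2 1 (by omega) (by omega) (by omega) (by omega) (by omega)
    · rw [hD _ (by omega) (by omega)]; omega
    · rw [hm, if_pos ((hD 1 (by omega) (by omega)).2 (by omega))]
      norm_num
    · rw [hm, if_pos ((hD 1 (by omega) (by omega)).2 (by omega))]
      norm_num

lemma rigid_of {Sg : Finset V} (hSg : Sg ⊆ R.Δ0) (h4 : 4 ≤ ℓ)
    (hD : ∀ k, 1 ≤ k → k ≤ ℓ → (α k ∈ Sg ↔ ℓ - 2 ≤ k))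
    {θ : V} (hθ : R.IsHighest θ) : ¬ R.NonRigid Sg θ := by
  rw [theta_eq hl hC hθ]
  rintro ⟨x, hx, y, hy, hxy, -, hpos, hle⟩
  rw [hC.2.1] at hx hy
  obtain ⟨i, hi, rfl⟩ := Finset.mem_image.1 hx
  obtain ⟨j, hj, rfl⟩ := Finset.mem_image.1 hy
  rw [Finset.mem_Icc] at hi hj
  have hij : i ≠ j := fun h => hxy (by rw [h])
  have hiS : α i ∈ Sg := by
    have h1 := hpos _ (alpha_mem_Dsig hl hC hi.1 hi.2 hj.1 hj.2 hij)
    have h2 := ht_eq R hSg (R.base_sub (alpha_mem hl hC hi.1 hi.2))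
    rw [hF_simple R _ (alpha_mem hl hC hi.1 hi.2)] at h2
    by_contra hcon
    rw [if_neg hcon] at h2
    have : R.ht Sg (α i) = 0 := by exact_mod_cast h2
    omega
  have hi2 := (hD i hi.1 hi.2).1 hiS
  rw [ht_theta hl hC hSg le_rfl hD, cInt_theta hl hC hi.1 hi.2, cInt_theta hl hC hj.1 hj.2,
    ht_refl hl hC hSg hi.1 hi.2 hj.1 hj.2, if_pos hiS, if_neg (by omega)] at hle
  by_cases hj1 : j = 1
  · subst hj1
    rw [if_pos rfl, if_neg (fun h => by have := (hD 1 hj.1 hj.2).1 h; omega)] at hle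
    unfold matC at hle
    split_ifs at hle <;> first | omega | (push_cast at hle; linarith)
  · rw [if_neg hj1] at hle
    unfold matC at hle
    split_ifs at hle <;> first | omega | (push_cast at hle; linarith)

lemma set_eq_of {Sg T : Finset V} (hSg : Sg ⊆ R.Δ0) (hT : T ⊆ R.Δ0)
    (h : ∀ k, 1 ≤ k → k ≤ ℓ → (α k ∈ Sg ↔ α k ∈ T)) : Sg = T := by
  ext x
  constructor
  · intro hx
    have := hSg hx
    rw [hC.2.1] at this
    obtain ⟨i, hi, rfl⟩ := Finset.mem_image.1 this
    rw [Finset.mem_Icc] at hi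
    exact (h i hi.1 hi.2).1 hx
  · intro hx
    have := hT hx
    rw [hC.2.1] at this
    obtain ⟨i, hi, rfl⟩ := Finset.mem_image.1 this
    rw [Finset.mem_Icc] at hi
    exact (h i hi.1 hi.2).2 hx

lemma alpha_inj {i j : ℕ} (hi1 : 1 ≤ i) (hi : i ≤ ℓ) (hj1 : 1 ≤ j) (hj : j ≤ ℓ) :
    α i = α j ↔ i = j :=
  ⟨fun h => hC.1 ⟨hi1, hi⟩ ⟨hj1, hj⟩ h, fun h => by rw [h]⟩

lemma pair_sub : ({α (ℓ - 1), α ℓ} : Finset V) ⊆ R.Δ0 := by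
  intro x hx
  simp only [Finset.mem_insert, Finset.mem_singleton] at hx
  rcases hx with rfl | rfl <;> exact alpha_mem hl hC (by omega) (by omega)

lemma pair_mem {k : ℕ} (h1 : 1 ≤ k) (h2 : k ≤ ℓ) :
    α k ∈ ({α (ℓ - 1), α ℓ} : Finset V) ↔ ℓ - 1 ≤ k := by
  simp only [Finset.mem_insert, Finset.mem_singleton]
  rw [alpha_inj hl hC h1 h2 (by omega) (by omega), alpha_inj hl hC h1 h2 (by omega) (by omega)]
  omega

lemma triple_sub : ({α 1, α 2, α 3} : Finset V) ⊆ R.Δ0 := by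
  intro x hx
  simp only [Finset.mem_insert, Finset.mem_singleton] at hx
  rcases hx with rfl | rfl | rfl <;> exact alpha_mem hl hC (by omega) (by omega)

lemma triple_mem (h3 : ℓ = 3) {k : ℕ} (h1 : 1 ≤ k) (h2 : k ≤ ℓ) :
    α k ∈ ({α 1, α 2, α 3} : Finset V) ↔ ℓ - 2 ≤ k := by
  simp only [Finset.mem_insert, Finset.mem_singleton]
  rw [alpha_inj hl hC h1 h2 (by omega) (by omega), alpha_inj hl hC h1 h2 (by omega) (by omega),
    alpha_inj hl hC h1 h2 (by omega) (by omega)]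
  omega

lemma ht_single {j : ℕ} (hj1 : 1 ≤ j) (hj : j ≤ ℓ)
    {a b : ℕ} (ha1 : 1 ≤ a) (ha : a ≤ 2 * ℓ) (hb1 : 1 ≤ b) (hb : b ≤ 2 * ℓ) (hab : a ≠ b) :
    R.ht {α j} (F α ℓ a - F α ℓ b) =
      ((if a ≤ j then 1 else 0) + (if a ≤ 2 * ℓ - j ∧ j ≠ ℓ then 1 else 0)) -
      ((if b ≤ j then 1 else 0) + (if b ≤ 2 * ℓ - j ∧ j ≠ ℓ then 1 else 0)) := by
  rw [ht_F hl hC (by simpa using alpha_mem hl hC hj1 hj)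
    (fun m => (if m ≤ j then 1 else 0) + (if m ≤ 2 * ℓ - j ∧ j ≠ ℓ then 1 else 0))
    _ ha1 ha hb1 hb hab]
  intro m m1 m2
  have := Finset.mem_Icc.1 (fold_mem m1 m2)
  simp only [Finset.mem_singleton, alpha_inj hl hC this.1 this.2 hj1 hj]
  unfold fold
  split_ifs <;> omega

end final

section final2

variable {L : Type*} [LieRing L] [LieAlgebra ℂ L] [FiniteDimensional ℂ L]
  {G : GradedLieData V L} {ℓ : ℕ} {α : ℕ → V} (hl : 3 ≤ ℓ)
  (hC : G.base.IsTypeOf ℓ α (RootSystemBase.matC ℓ))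

include hl hC

lemma monge_one {Sg : Finset V} (hSg : Sg ⊆ G.base.Δ0)
    (hD : ∀ k, 1 ≤ k → k ≤ ℓ → (α k ∈ Sg ↔ ℓ - 1 ≤ k)) : G.Monge Sg := by
  have hβ := alpha_eq (α := α) hl (le_refl ℓ)
  apply monge_of G hSg (α ℓ) (alpha_mem hl hC (by omega) le_rfl)
    ((hD ℓ (by omega) le_rfl).2 (by omega))
  · refine ⟨F α ℓ (ℓ - 1) - F α ℓ ℓ, F_mem hl hC (by omega) (by omega) (by omega) (by omega)
      (by omega), ?_, ?_⟩
    · rw [ht_r hl hC hSg (by norm_num) hD (by omega) (by omega) (by omega) (by omega) (by omega)]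
      push_cast
      omega
    · rw [hβ]
      intro e
      have := F_inj hl hC (by omega) (by omega) (by omega) (by omega) (by omega) (by omega) e
      omega
  · intro γ hγ h1 hne
    obtain ⟨a, b, a1, a2, b1, b2, hab, rfl⟩ := root_form hl hC hγ
    rw [ht_r hl hC hSg (by norm_num) hD a1 a2 b1 b2 hab] at h1
    have hcase : (a ≤ ℓ - 1 ∧ b = ℓ) ∨ (a = ℓ ∧ b = ℓ + 1) ∨ (a = ℓ + 1 ∧ ℓ + 2 ≤ b) := by
      push_cast at h1; omega
    rw [ht_single hl hC (by omega) le_rfl a1 a2 b1 b2 hab]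
    rcases hcase with ⟨h, rfl⟩ | ⟨rfl, rfl⟩ | ⟨rfl, h⟩
    · constructor
      · split_ifs <;> omega
      · rw [hβ, sub_add_sub_cancel]
        exact F_mem hl hC a1 a2 (by omega) (by omega) (by omega)
    · exact absurd hβ.symm hne
    · constructor
      · split_ifs <;> omega
      · rw [hβ, add_comm, sub_add_sub_cancel]
        exact F_mem hl hC (by omega) (by omega) (by omega) (by omega) (by omega)
  · intro γ hγ h1
    obtain ⟨a, b, a1, a2, b1, b2, hab, rfl⟩ := root_form hl hC hγ
    rw [ht_r hl hC hSg (by norm_num) hD a1 a2 b1 b2 hab] at h1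
    have hcase : (a ≤ ℓ - 1 ∧ b = ℓ + 1) ∨ (a = ℓ ∧ ℓ + 2 ≤ b) := by
      push_cast at h1; omega
    rw [ht_single hl hC (by omega) le_rfl a1 a2 b1 b2 hab]
    rcases hcase with ⟨h, rfl⟩ | ⟨rfl, h⟩
    · constructor
      · split_ifs <;> omega
      · rw [hβ, sub_sub_sub_cancel_right]
        exact F_mem hl hC a1 a2 (by omega) (by omega) (by omega)
    · constructor
      · split_ifs <;> omega
      · rw [hβ, sub_sub_sub_cancel_left]
        exact F_mem hl hC (by omega) (by omega) (by omega) (by omega) (by omega)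

lemma monge_two {Sg : Finset V} (hSg : Sg ⊆ G.base.Δ0) (h3 : ℓ = 3)
    (hD : ∀ k, 1 ≤ k → k ≤ ℓ → (α k ∈ Sg ↔ ℓ - 2 ≤ k)) : G.Monge Sg := by
  subst h3
  have hβ := alpha_eq (α := α) hl (show 2 ≤ 3 by norm_num)
  have hβ' : α 2 = F α 3 4 - F α 3 5 := (alpha_fold (α := α) (ℓ := 3) 4 (by norm_num)).symm
  apply monge_of G hSg (α 2) (alpha_mem hl hC (by omega) (by omega))
    ((hD 2 (by omega) (by omega)).2 (by omega))
  · refine ⟨F α 3 1 - F α 3 2, F_mem hl hC (by omega) (by omega) (by omega) (by omega)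
      (by omega), ?_, ?_⟩
    · rw [ht_r hl hC hSg (by norm_num) hD (by omega) (by omega) (by omega) (by omega) (by omega)]
      norm_num
    · rw [hβ]
      intro e
      have := F_inj hl hC (by omega) (by omega) (by omega) (by omega) (by omega) (by omega) e
      omega
  · intro γ hγ h1 hne
    obtain ⟨a, b, a1, a2, b1, b2, hab, rfl⟩ := root_form hl hC hγ
    rw [ht_r hl hC hSg (by norm_num) hD a1 a2 b1 b2 hab] at h1
    obtain rfl : b = a + 1 := by push_cast at h1; omega
    rw [ht_single hl hC (by omega) (by omega) a1 a2 b1 b2 hab]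
    rcases (by omega : a = 1 ∨ a = 2 ∨ a = 3 ∨ a = 4 ∨ a = 5) with rfl | rfl | rfl | rfl | rfl
    · refine ⟨by norm_num, ?_⟩
      rw [hβ, sub_add_sub_cancel]
      exact F_mem hl hC (by omega) (by omega) (by omega) (by omega) (by omega)
    · exact absurd hβ.symm hne
    · refine ⟨by norm_num, ?_⟩
      rw [hβ, add_comm, sub_add_sub_cancel]
      exact F_mem hl hC (by omega) (by omega) (by omega) (by omega) (by omega)
    · exact absurd hβ'.symm hne
    · refine ⟨by norm_num, ?_⟩
      rw [hβ', add_comm, sub_add_sub_cancel]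
      exact F_mem hl hC (by omega) (by omega) (by omega) (by omega) (by omega)
  · intro γ hγ h1
    obtain ⟨a, b, a1, a2, b1, b2, hab, rfl⟩ := root_form hl hC hγ
    rw [ht_r hl hC hSg (by norm_num) hD a1 a2 b1 b2 hab] at h1
    obtain rfl : b = a + 2 := by push_cast at h1; omega
    rw [ht_single hl hC (by omega) (by omega) a1 a2 b1 b2 hab]
    rcases (by omega : a = 1 ∨ a = 2 ∨ a = 3 ∨ a = 4) with rfl | rfl | rfl | rfl
    · refine ⟨by norm_num, ?_⟩
      rw [hβ, sub_sub_sub_cancel_right]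
      exact F_mem hl hC (by omega) (by omega) (by omega) (by omega) (by omega)
    · refine ⟨by norm_num, ?_⟩
      rw [hβ, sub_sub_sub_cancel_left]
      exact F_mem hl hC (by omega) (by omega) (by omega) (by omega) (by omega)
    · refine ⟨by norm_num, ?_⟩
      rw [hβ', sub_sub_sub_cancel_right]
      exact F_mem hl hC (by omega) (by omega) (by omega) (by omega) (by omega)
    · refine ⟨by norm_num, ?_⟩
      rw [hβ', sub_sub_sub_cancel_left]
      exact F_mem hl hC (by omega) (by omega) (by omega) (by omega) (by omega)

lemma mainC {Sg : Finset V} (hSg : Sg ⊆ G.base.Δ0) (hne : Sg.Nonempty)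
    {θ : V} (hθ : G.base.IsHighest θ) :
    (G.Monge Sg ∧ G.base.NonRigid Sg θ) ↔
      ((ℓ = 3 ∧ Sg = {α 1, α 2, α 3}) ∨ Sg = {α (ℓ - 1), α ℓ}) := by
  constructor
  · rintro ⟨hM, hN⟩
    obtain ⟨r, hr1, hr2, hD⟩ := classify hl hC hSg hne (star_of_monge G hSg hM)
      (exists_ht2_of_monge G hM)
    rcases (by omega : r = 1 ∨ r = 2) with rfl | rfl
    · right
      apply set_eq_of hl hC hSg (pair_sub hl hC)
      intro k k1 k2
      rw [hD k k1 k2, pair_mem hl hC k1 k2]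
    · left
      have h3 : ℓ = 3 := by
        by_contra h
        exact rigid_of hl hC hSg (by omega) hD hθ hN
      refine ⟨h3, ?_⟩
      apply set_eq_of hl hC hSg (triple_sub hl hC)
      intro k k1 k2
      rw [hD k k1 k2, triple_mem hl hC h3 k1 k2]
  · rintro (⟨h3, hS⟩ | hS)
    · have hD : ∀ k, 1 ≤ k → k ≤ ℓ → (α k ∈ Sg ↔ ℓ - 2 ≤ k) := by
        intro k k1 k2; rw [hS, triple_mem hl hC h3 k1 k2]
      exact ⟨monge_two hl hC hSg h3 hD,
        nonRigid_of hl hC hSg (by norm_num) le_rfl hD (Or.inr h3) hθ⟩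
    · have hD : ∀ k, 1 ≤ k → k ≤ ℓ → (α k ∈ Sg ↔ ℓ - 1 ≤ k) := by
        intro k k1 k2; rw [hS, pair_mem hl hC k1 k2]
      exact ⟨monge_one hl hC hSg hD,
        nonRigid_of hl hC hSg le_rfl (by norm_num) hD (Or.inl rfl) hθ⟩

end final2

end CProof

/-- Let `𝔤` be a complex simple Lie algebra of type `Cₗ`, `ℓ ≥ 3`
(so `𝔤 ≅ sp(2ℓ, ℂ)`) with simple roots `α 1, …, α ℓ` in the standard ordering (`α ℓ`
the long root), graded by a subset `Σ` of the simple roots.  (a) If `ℓ ≥ 4`, the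
grading is of Monge type and `Σ` contains `3` simple roots, then the grading is
rigid.  (b) The non-rigid gradings of Monge type of type `C` are exactly
`Σ = {α₁, α₂, α₃}` for `C₃` and `Σ = {α_{ℓ-1}, α_ℓ}` for `Cₗ`, `ℓ ≥ 3`. -/
theorem statement14 {V : Type*} [NormedAddCommGroup V] [InnerProductSpace ℝ V]
    {L : Type*} [LieRing L] [LieAlgebra ℂ L] [FiniteDimensional ℂ L]
    (G : GradedLieData V L)
    (ℓ : ℕ) (hl : 3 ≤ ℓ) (α : ℕ → V)
    (hC : G.base.IsTypeOf ℓ α (RootSystemBase.matC ℓ))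
    (Sg : Finset V) (hSg : Sg ⊆ G.base.Δ0) (hne : Sg.Nonempty)
    (θ : V) (hθ : G.base.IsHighest θ) :
    (4 ≤ ℓ → Sg.card = 3 → G.Monge Sg → ¬ G.base.NonRigid Sg θ) ∧
    ((G.Monge Sg ∧ G.base.NonRigid Sg θ) ↔
      ((ℓ = 3 ∧ Sg = {α 1, α 2, α 3}) ∨ Sg = {α (ℓ - 1), α ℓ})) := by
  have main := CProof.mainC hl hC hSg hne hθ
  refine ⟨fun h4 hcard hM hN => ?_, main⟩
  rcases main.1 ⟨hM, hN⟩ with ⟨h3, -⟩ | hS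
  · omega
  · have h2 : Sg.card ≤ 2 := by rw [hS]; exact Finset.card_le_two
    omega
end
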